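/- Assume γ ∈ (0,1). Let η ∈ (0,1] and let φ : [0,1] → ℝ be η-Hölder, set S_n(φ)(x) = Σ_{k=0}^{n−1} φ(T^k(x)) − n ∫ φ dν and σ_n² = Var_ν(S_n(φ)), and assume σ_n² → ∞. Then σ_n²/n converges to some σ² > 0, and for every positive sequence (a_n) with a_n → 0 and a_n n^{γ/(2−γ)} → ∞, the moderate deviation principle holds: for every Borel set A ⊆ ℝ, − inf_{t ∈ A°} t²/(2σ²) ≤ liminf_n a_n log ν( √(a_n/n) · S_n(φ) ∈ A ) ≤ limsup_n a_n log ν( √(a_n/n) · S_n(φ) ∈ A ) ≤ − inf_{t ∈ closure(A)} t²/(2σ²), where A° is the interior of A. -/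

import Mathlib

open MeasureTheory Set Filter

/-- The interval map `T` of the example: `T(x) = x (1 + c / |log x|^β)` on `(0, 1/2]`
with `β = 1/γ - 1`, `c = (log 2)^β`, `T(x) = 2x - 1` on `(1/2, 1]`, and `T(0) = 0`. -/
noncomputable def Tmap (γ : ℝ) (x : ℝ) : ℝ :=
  if x ≤ 0 then 0
  else if x ≤ 1 / 2 then x * (1 + (Real.log 2) ^ (1 / γ - 1) / |Real.log x| ^ (1 / γ - 1))
  else 2 * x - 1

namespace S18

lemma sqrt_sq_diff (x y z : ℝ) : |√(x ^ 2 + z ^ 2) - √(y ^ 2 + z ^ 2)| ≤ |x - y| := by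
  have key : ∀ x y : ℝ, √(x ^ 2 + z ^ 2) - √(y ^ 2 + z ^ 2) ≤ |x - y| := by
    intro x y
    have h1 : √(x ^ 2 + z ^ 2) ≤ √(y ^ 2 + z ^ 2) + |x - y| := by
      apply Real.sqrt_le_iff.2
      refine ⟨by positivity, ?_⟩
      have h2 : |y| ≤ √(y ^ 2 + z ^ 2) := Real.abs_le_sqrt (by nlinarith [sq_nonneg z])
      have h3 : √(y ^ 2 + z ^ 2) ^ 2 = y ^ 2 + z ^ 2 := Real.sq_sqrt (by positivity)
      have h4 : |x - y| ^ 2 = (x - y) ^ 2 := sq_abs _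
      have h5 : y * (x - y) ≤ |y| * |x - y| := by rw [← abs_mul]; exact le_abs_self _
      have h6 := mul_le_mul_of_nonneg_right h2 (abs_nonneg (x - y))
      nlinarith
    linarith
  rw [abs_le]
  constructor
  · have := key y x
    rw [abs_sub_comm] at this
    linarith
  · exact key x y

lemma seq_block (u : ℕ → ℝ) (hu : ∀ n, 0 ≤ u n) (C : ℝ)
    (h : ∀ n k, |u (n + k) - √(u n ^ 2 + u k ^ 2)| ≤ C) (N b : ℕ) (hb : 1 ≤ b) :
    |u (b * N) - √b * u N| ≤ 5 * C * √b - 5 * C := by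
  have hC : 0 ≤ C := (abs_nonneg _).trans (h 0 0)
  have hs2 : (1.41 : ℝ) ≤ √2 := by
    apply Real.le_sqrt_of_sq_le; norm_num
  have dbl : ∀ c : ℕ, 1 ≤ c → |u (c * N) - √c * u N| ≤ 5 * C * √c - 5 * C →
      |u ((2 * c) * N) - √(2 * c) * u N| ≤ √2 * (5 * C * √c - 5 * C) + C := by
    intro c hc ih
    have h1 := h (c * N) (c * N)
    have e1 : c * N + c * N = 2 * c * N := by ring
    have e2 : √(u (c * N) ^ 2 + u (c * N) ^ 2) = √2 * u (c * N) := by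
      rw [← two_mul, Real.sqrt_mul (by norm_num), Real.sqrt_sq (hu _)]
    have e3 : √(2 * (c : ℝ)) = √2 * √c := Real.sqrt_mul (by norm_num) _
    rw [e1, e2] at h1
    rw [e3]
    have e4 : u (2 * c * N) - √2 * √c * u N
        = (u (2 * c * N) - √2 * u (c * N)) + √2 * (u (c * N) - √c * u N) := by ring
    rw [e4]
    refine (abs_add_le _ _).trans ?_
    rw [abs_mul, abs_of_nonneg (Real.sqrt_nonneg 2)]
    have := mul_le_mul_of_nonneg_left ih (Real.sqrt_nonneg 2)
    linarith
  induction b using Nat.strong_induction_on with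
  | _ b ih =>
    rcases Nat.even_or_odd' b with ⟨c, hc | hc⟩
    · have hc1 : 1 ≤ c := by omega
      have := dbl c hc1 (ih c (by omega) hc1)
      subst hc
      push_cast
      refine this.trans ?_
      rw [Real.sqrt_mul (by norm_num)]
      nlinarith
    · rcases Nat.eq_zero_or_pos c with h0 | hc1
      · subst h0; subst hc; simp
      · have h1 := dbl c hc1 (ih c (by omega) hc1)
        have h2 := h (2 * c * N) N
        have h3 := sqrt_sq_diff (u (2 * c * N)) (√(2 * c) * u N) (u N)
        have e1 : 2 * c * N + N = b * N := by rw [hc]; ring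
        have e2 : √((√(2 * (c : ℝ)) * u N) ^ 2 + u N ^ 2) = √b * u N := by
          rw [mul_pow, Real.sq_sqrt (by positivity)]
          have : 2 * (c : ℝ) * u N ^ 2 + u N ^ 2 = (b : ℝ) * u N ^ 2 := by
            rw [hc]; push_cast; ring
          rw [this, Real.sqrt_mul (by positivity), Real.sqrt_sq (hu _)]
        rw [e1] at h2
        rw [e2] at h3
        have h4 : √2 * √c ≤ √b := by
          rw [← Real.sqrt_mul (by norm_num)]
          apply Real.sqrt_le_sqrt
          rw [hc]; push_cast; linarith
        have e4 : u (b * N) - √b * u N = (u (b * N) - √(u (2 * c * N) ^ 2 + u N ^ 2))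
          + (√(u (2 * c * N) ^ 2 + u N ^ 2) - √b * u N) := by ring
        rw [e4]
        refine (abs_add_le _ _).trans ?_
        nlinarith [mul_le_mul_of_nonneg_left h4 hC]

lemma seq_conv (u : ℕ → ℝ) (hu : ∀ n, 0 ≤ u n) (C : ℝ)
    (h : ∀ n k, |u (n + k) - √(u n ^ 2 + u k ^ 2)| ≤ C) :
    ∃ w D : ℝ, 0 ≤ w ∧ ∀ n, |u n - w * √n| ≤ D := by
  have hC : 0 ≤ C := (abs_nonneg _).trans (h 0 0)
  set v : ℕ → ℝ := fun n => u n / √n with hv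
  have key1 : ∀ N b : ℕ, 1 ≤ N → 1 ≤ b → |v (b * N) - v N| ≤ 5 * C / √N := by
    intro N b hN hb
    have hN' : 0 < √(N : ℝ) := Real.sqrt_pos.2 (by exact_mod_cast hN)
    have hb' : 0 < √(b : ℝ) := Real.sqrt_pos.2 (by exact_mod_cast hb)
    have h1 := seq_block u hu C h N b hb
    have e : v (b * N) - v N = (u (b * N) - √b * u N) / (√b * √N) := by
      simp only [hv]
      push_cast
      rw [Real.sqrt_mul (by positivity)]
      field_simp
    rw [e, abs_div, abs_of_pos (mul_pos hb' hN'), div_le_div_iff₀ (mul_pos hb' hN') hN']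
    have : |u (b * N) - √b * u N| ≤ 5 * C * √b := by linarith
    nlinarith
  have key : ∀ N b : ℕ, 1 ≤ N → 1 ≤ b → |v N - v b| ≤ 5 * C / √N + 5 * C / √b := by
    intro N b hN hb
    have h1 := key1 N b hN hb
    have h2 := key1 b N hb hN
    rw [mul_comm] at h2
    have : v N - v b = -(v (b * N) - v N) + (v (b * N) - v b) := by ring
    rw [this]
    refine (abs_add_le _ _).trans ?_
    rw [abs_neg]
    linarith
  have ht : Tendsto (fun n : ℕ => 5 * C / √n) atTop (nhds 0) := by
    apply Tendsto.div_atTop tendsto_const_nhds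
    exact Real.tendsto_sqrt_atTop.comp tendsto_natCast_atTop_atTop
  have hcau : CauchySeq v := by
    rw [Metric.cauchySeq_iff']
    intro ε hε
    obtain ⟨n0, hn0⟩ := eventually_atTop.1 (ht.eventually (gt_mem_nhds (half_pos hε)))
    refine ⟨max n0 1, fun n hn => ?_⟩
    rw [Real.dist_eq]
    have := key n (max n0 1) (le_trans (le_max_right _ _) hn) (le_max_right _ _)
    have a1 := hn0 n (le_trans (le_max_left _ _) hn)
    have a2 := hn0 (max n0 1) (le_max_left _ _)
    linarith
  obtain ⟨w, hw⟩ := cauchySeq_tendsto_of_complete hcau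
  refine ⟨w, max (5 * C) (u 0), ge_of_tendsto' hw fun n => by simp only [hv]; have := hu n; positivity, ?_⟩
  intro n
  rcases Nat.eq_zero_or_pos n with rfl | hn
  · simp [abs_of_nonneg (hu 0)]
  · have hn' : 0 < √(n : ℝ) := Real.sqrt_pos.2 (by exact_mod_cast hn)
    have h1 : |v n - w| ≤ 5 * C / √n + 0 := by
      have t1 : Tendsto (fun b => |v n - v b|) atTop (nhds |v n - w|) :=
        (tendsto_const_nhds.sub hw).abs
      have t2 : Tendsto (fun b : ℕ => 5 * C / √n + 5 * C / √b) atTop (nhds (5 * C / √n + 0)) :=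
        tendsto_const_nhds.add ht
      refine le_of_tendsto_of_tendsto t1 t2 ?_
      filter_upwards [eventually_ge_atTop 1] with b hb
      exact key n b hn hb
    have e : u n - w * √n = (v n - w) * √n := by
      simp only [hv]; field_simp
    rw [e, abs_mul, abs_of_pos hn']
    rw [add_zero, le_div_iff₀ hn'] at h1
    exact h1.trans (le_max_left _ _)

end S18

namespace S18

/-- Decoupling data: the law `m` regenerates after time about `N`. -/
structure Decoup (ι κ : Type) [MeasurableSpace ι] [MeasurableSpace κ] (m ν : Measure ℝ)
    (S : ℕ → ℝ → ℝ) (γ c C : ℝ) where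
  P : ℕ → Measure ι
  hP : ∀ N, IsProbabilityMeasure (P N)
  Γ : ℕ → ι × ℝ → ℝ
  a : ℕ → ι → ℝ
  U : ℕ → ι → ℝ
  ha : ∀ N, Measurable (a N)
  hU : ∀ N, Measurable (U N)
  hΓ : ∀ N, MeasurePreserving (Γ N) ((P N).prod m) m
  hD : ∀ N, ∀ᵐ p ∂((P N).prod m), ∀ k, |S (N + k) (Γ N p) - a N p.1 - S k p.2| ≤ U N p.1
  haB : ∀ N s, |a N s| ≤ C * N
  hU0 : ∀ N s, 0 ≤ U N s
  hUi : ∀ N, ∫⁻ s, ENNReal.ofReal (Real.exp (c * U N s ^ γ)) ∂(P N) ≤ ENNReal.ofReal C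
  Q : Measure κ
  hQ : IsProbabilityMeasure Q
  Γ' : κ × ℝ → ℝ
  U' : κ → ℝ
  hU' : Measurable U'
  hΓ' : MeasurePreserving Γ' (Q.prod m) ν
  hD' : ∀ᵐ p ∂(Q.prod m), ∀ k, |S k (Γ' p) - S k p.2| ≤ U' p.1
  hU0' : ∀ s, 0 ≤ U' s
  hUi' : ∫⁻ s, ENNReal.ofReal (Real.exp (c * U' s ^ γ)) ∂Q ≤ ENNReal.ofReal C
  hmν : m ≤ ENNReal.ofReal C • ν
  hS : ∀ n, Measurable (S n)
  hS0 : ∀ x, S 0 x = 0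
  hSL : ∀ n k x, |S (n + k) x - S n x| ≤ C * k
  hC : 0 ≤ C
  hc : 0 < c
  hγ : γ ∈ Ioo (0 : ℝ) 1
  hm : IsProbabilityMeasure m
  hν : IsProbabilityMeasure ν

lemma pow_le_exp {γ c : ℝ} (hγ : 0 < γ) (hc : 0 < c) (j : ℕ) :
    ∃ B : ℝ, 0 < B ∧ ∀ u : ℝ, 0 ≤ u → u ^ j ≤ B * Real.exp (c * u ^ γ) := by
  obtain ⟨k, hk⟩ := exists_nat_ge (j / γ)
  refine ⟨k.factorial / c ^ k + 1, by positivity, fun u hu => ?_⟩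
  have hexp : 1 ≤ Real.exp (c * u ^ γ) := Real.one_le_exp (by positivity)
  have hB : 0 ≤ k.factorial / c ^ k := by positivity
  rcases le_total u 1 with h1 | h1
  · have : u ^ j ≤ 1 := pow_le_one₀ hu h1
    nlinarith
  · have h2 : u ^ j ≤ (u ^ γ) ^ k := by
      rw [← Real.rpow_natCast, ← Real.rpow_natCast, ← Real.rpow_mul hu]
      apply Real.rpow_le_rpow_of_exponent_le h1
      rw [div_le_iff₀ hγ] at hk
      linarith
    have h3 := Real.pow_div_factorial_le_exp (c * u ^ γ) (by positivity) k
    have h4 : (u ^ γ) ^ k = k.factorial / c ^ k * ((c * u ^ γ) ^ k / k.factorial) := by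
      rw [mul_pow]; field_simp
    rw [h4] at h2
    have := mul_le_mul_of_nonneg_left h3 hB
    linarith

/-- integrals controlled by a `lintegral` bound -/
lemma int_bound {α : Type*} [MeasurableSpace α] (μ : Measure α) (U : α → ℝ) (hU : Measurable U)
    (hU0 : ∀ s, 0 ≤ U s) (γ c C : ℝ) (hC : 0 ≤ C)
    (hUi : ∫⁻ s, ENNReal.ofReal (Real.exp (c * U s ^ γ)) ∂μ ≤ ENNReal.ofReal C)
    (f : ℝ → ℝ) (hf : Measurable f) (B : ℝ)
    (hfB : ∀ u, 0 ≤ u → 0 ≤ f u ∧ f u ≤ B * Real.exp (c * u ^ γ)) :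
    Integrable (fun s => f (U s)) μ ∧ ∫ s, f (U s) ∂μ ≤ B * C := by
  have hm : Measurable fun s => Real.exp (c * U s ^ γ) := by fun_prop
  have hB : ∀ s, 0 ≤ B * Real.exp (c * U s ^ γ) :=
    fun s => (hfB (U s) (hU0 s)).1.trans (hfB (U s) (hU0 s)).2
  have hi : Integrable (fun s => Real.exp (c * U s ^ γ)) μ := by
    refine ⟨hm.aestronglyMeasurable, ?_⟩
    rw [hasFiniteIntegral_iff_ofReal (ae_of_all _ fun s => (Real.exp_pos _).le)]
    exact hUi.trans_lt ENNReal.ofReal_lt_top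
  have hle : ∫ s, Real.exp (c * U s ^ γ) ∂μ ≤ C := by
    rw [integral_eq_lintegral_of_nonneg_ae (ae_of_all _ fun s => (Real.exp_pos _).le)
      hm.aestronglyMeasurable]
    exact ENNReal.toReal_le_of_le_ofReal hC hUi
  have hfi : Integrable (fun s => f (U s)) μ := by
    refine (hi.const_mul B).mono' (hf.comp hU).aestronglyMeasurable (ae_of_all _ fun s => ?_)
    rw [Real.norm_of_nonneg (hfB _ (hU0 s)).1]
    exact (hfB _ (hU0 s)).2
  refine ⟨hfi, ?_⟩
  by_cases hB0 : 0 ≤ B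
  · calc ∫ s, f (U s) ∂μ ≤ ∫ s, B * Real.exp (c * U s ^ γ) ∂μ :=
          integral_mono hfi (hi.const_mul B) fun s => (hfB _ (hU0 s)).2
      _ = B * ∫ s, Real.exp (c * U s ^ γ) ∂μ := integral_const_mul _ _
      _ ≤ B * C := by gcongr
  · exfalso
    have h1 := hfB 0 le_rfl
    have h2 := Real.exp_pos (c * 0 ^ γ)
    push Not at hB0
    nlinarith

/-- L2 norm -/
noncomputable def l2 {α : Type*} [MeasurableSpace α] (μ : Measure α) (f : α → ℝ) : ℝ :=
  √(∫ x, f x ^ 2 ∂μ)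

lemma l2_eq {α : Type*} [MeasurableSpace α] (μ : Measure α) (f : α → ℝ) (hf : MemLp f 2 μ) :
    l2 μ f = (eLpNorm f 2 μ).toReal := by
  rw [hf.eLpNorm_eq_integral_rpow_norm (by norm_num) (by norm_num),
    ENNReal.toReal_ofReal (by positivity), l2, Real.sqrt_eq_rpow]
  simp

lemma l2_tri {α : Type*} [MeasurableSpace α] (μ : Measure α) (f g h : α → ℝ)
    (hf : MemLp f 2 μ) (hg : MemLp g 2 μ) (hh : MemLp h 2 μ) (hle : ∀ᵐ x ∂μ, |f x - g x| ≤ h x) :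
    |l2 μ f - l2 μ g| ≤ l2 μ h := by
  have key : ∀ f g : α → ℝ, MemLp f 2 μ → MemLp g 2 μ → (∀ᵐ x ∂μ, |f x - g x| ≤ h x) →
      l2 μ f ≤ l2 μ g + l2 μ h := by
    intro f g hf hg hle
    rw [l2_eq μ f hf, l2_eq μ g hg, l2_eq μ h hh, ← ENNReal.toReal_add hg.2.ne hh.2.ne]
    apply ENNReal.toReal_mono (ENNReal.add_ne_top.2 ⟨hg.2.ne, hh.2.ne⟩)
    have e : f = g + (f - g) := by ext; simp
    calc eLpNorm f 2 μ = eLpNorm (g + (f - g)) 2 μ := by rw [← e]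
      _ ≤ eLpNorm g 2 μ + eLpNorm (f - g) 2 μ :=
        eLpNorm_add_le hg.1 (hf.sub hg).1 (by norm_num)
      _ ≤ _ := by
        gcongr
        apply eLpNorm_mono_ae
        filter_upwards [hle] with x hx
        rw [Real.norm_eq_abs, Real.norm_eq_abs]
        exact hx.trans (le_abs_self _)
  rw [abs_le]
  constructor
  · have := key g f hg hf (by filter_upwards [hle] with x hx; rwa [abs_sub_comm])
    linarith
  · have := key f g hf hg hle
    linarith

lemma l2_nonneg {α : Type*} [MeasurableSpace α] (μ : Measure α) (f : α → ℝ) : 0 ≤ l2 μ f :=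
  Real.sqrt_nonneg _

lemma l2_sq {α : Type*} [MeasurableSpace α] (μ : Measure α) (f : α → ℝ) :
    l2 μ f ^ 2 = ∫ x, f x ^ 2 ∂μ :=
  Real.sq_sqrt (integral_nonneg fun _ => sq_nonneg _)

lemma mp_integral {α : Type*} [MeasurableSpace α] {μ : Measure α} {m : Measure ℝ} {Γ : α → ℝ}
    (h : MeasurePreserving Γ μ m) (f : ℝ → ℝ) (hf : Measurable f) :
    ∫ p, f (Γ p) ∂μ = ∫ x, f x ∂m := by
  rw [← h.map_eq, integral_map h.measurable.aemeasurable hf.aestronglyMeasurable]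

lemma fst_integral {α : Type*} [MeasurableSpace α] {μ : Measure α} {m : Measure ℝ}
    [IsProbabilityMeasure μ] [IsProbabilityMeasure m] (f : α → ℝ) :
    ∫ p, f p.1 ∂(μ.prod m) = ∫ x, f x ∂μ := by
  simpa using integral_fun_fst (μ := μ) (ν := m) f

lemma snd_integral {α : Type*} [MeasurableSpace α] {μ : Measure α} {m : Measure ℝ}
    [IsProbabilityMeasure μ] [IsProbabilityMeasure m] (f : ℝ → ℝ) :
    ∫ p, f p.2 ∂(μ.prod m) = ∫ x, f x ∂m := by
  simpa using integral_fun_snd (μ := μ) (ν := m) f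

end S18

namespace S18

lemma sqrt_add_le' (x y : ℝ) (hx : 0 ≤ x) (hy : 0 ≤ y) : √(x + y) ≤ √x + √y := by
  apply Real.sqrt_le_iff.2
  refine ⟨by positivity, ?_⟩
  have := Real.sq_sqrt hx
  have := Real.sq_sqrt hy
  nlinarith [mul_nonneg (Real.sqrt_nonneg x) (Real.sqrt_nonneg y)]

lemma int_of_bdd {α : Type*} [MeasurableSpace α] {μ : Measure α} [IsProbabilityMeasure μ]
    {f : α → ℝ} (hf : Measurable f) {B : ℝ} (hB : ∀ x, |f x| ≤ B) : Integrable f μ :=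
  Integrable.of_bound hf.aestronglyMeasurable B (ae_of_all _ hB)

lemma memLp_of_bdd {α : Type*} [MeasurableSpace α] {μ : Measure α} [IsProbabilityMeasure μ]
    {f : α → ℝ} (hf : Measurable f) {B : ℝ} (hB : ∀ x, |f x| ≤ B) : MemLp f 2 μ :=
  MemLp.of_bound hf.aestronglyMeasurable B (ae_of_all _ hB)

lemma abs_pow_bdd {f B : ℝ} (h : |f| ≤ B) (j : ℕ) : |f ^ j| ≤ B ^ j := by
  rw [abs_pow]; exact pow_le_pow_left₀ (abs_nonneg _) h j

lemma four_add (x e : ℝ) : (x + e) ^ 4 ≤ 9 / 8 * x ^ 4 + 17576 * e ^ 4 := by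
  have h2 : (x + e) ^ 2 ≤ 26 / 25 * x ^ 2 + 26 * e ^ 2 := by
    nlinarith [sq_nonneg (x / 5 - 5 * e)]
  have h4 : (26 / 25 * x ^ 2 + 26 * e ^ 2) ^ 2 ≤ 9 / 8 * x ^ 4 + 17576 * e ^ 4 := by
    nlinarith [sq_nonneg (26 / 125 * x ^ 2 - 130 * e ^ 2), sq_nonneg (x ^ 2), sq_nonneg (e ^ 2)]
  calc (x + e) ^ 4 = ((x + e) ^ 2) ^ 2 := by ring
    _ ≤ (26 / 25 * x ^ 2 + 26 * e ^ 2) ^ 2 := by gcongr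
    _ ≤ _ := h4

lemma cube_le (y δ : ℝ) (hδ : 0 < δ) : |y| ^ 3 ≤ δ * y ^ 4 + 1 / δ ^ 3 := by
  have e : y ^ 4 = |y| ^ 4 := by rw [← abs_pow, abs_of_nonneg (by positivity)]
  rw [e]
  have hz := abs_nonneg y
  generalize |y| = z at *
  rcases le_total (δ * z) 1 with h | h
  · have hz' : z ≤ 1 / δ := by rw [le_div_iff₀ hδ]; linarith
    have : z ^ 3 ≤ (1 / δ) ^ 3 := by gcongr
    rw [div_pow, one_pow] at this
    have : 0 ≤ δ * z ^ 4 := by positivity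
    linarith
  · have : z ^ 3 * 1 ≤ z ^ 3 * (δ * z) := by gcongr
    have : 0 ≤ 1 / δ ^ 3 := by positivity
    nlinarith

namespace Decoup
variable {ι κ : Type} [MeasurableSpace ι] [MeasurableSpace κ] {m ν : Measure ℝ}
    {S : ℕ → ℝ → ℝ} {γ c C : ℝ} (d : Decoup ι κ m ν S γ c C)
include d

lemma SB (n : ℕ) (x : ℝ) : |S n x| ≤ C * n := by
  have := d.hSL 0 n x
  simpa [d.hS0] using this

lemma Uj (j : ℕ) : ∃ B : ℝ, 0 ≤ B ∧ ∀ N, Integrable (fun s => d.U N s ^ j) (d.P N) ∧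
    ∫ s, d.U N s ^ j ∂(d.P N) ≤ B := by
  obtain ⟨B, hB, h⟩ := pow_le_exp d.hγ.1 d.hc j
  exact ⟨B * C, mul_nonneg hB.le d.hC, fun N => int_bound (d.P N) (d.U N) (d.hU N) (d.hU0 N) γ c C
    d.hC (d.hUi N) (fun u => u ^ j) (by fun_prop) B fun u hu => ⟨by positivity, h u hu⟩⟩

lemma Uj' (j : ℕ) : ∃ B : ℝ, 0 ≤ B ∧ Integrable (fun s => d.U' s ^ j) d.Q ∧
    ∫ s, d.U' s ^ j ∂d.Q ≤ B := by
  obtain ⟨B, hB, h⟩ := pow_le_exp d.hγ.1 d.hc j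
  exact ⟨B * C, mul_nonneg hB.le d.hC, int_bound d.Q d.U' d.hU' d.hU0' γ c C
    d.hC d.hUi' (fun u => u ^ j) (by fun_prop) B fun u hu => ⟨by positivity, h u hu⟩⟩

lemma hDa (N : ℕ) : ∀ᵐ p ∂((d.P N).prod m), |S N (d.Γ N p) - d.a N p.1| ≤ d.U N p.1 := by
  filter_upwards [d.hD N] with p hp
  have := hp 0
  simpa [d.hS0] using this

lemma mean_m (h0 : ∀ n, ∫ x, S n x ∂ν = 0) : ∃ B : ℝ, 0 ≤ B ∧ ∀ n, |∫ x, S n x ∂m| ≤ B := by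
  have := d.hm; have := d.hQ
  obtain ⟨B, hB0, hBi, hB⟩ := d.Uj' 1
  simp only [pow_one] at hBi hB
  refine ⟨B, hB0, fun n => ?_⟩
  have e1 : ∫ p, S n (d.Γ' p) ∂(d.Q.prod m) = 0 := by rw [mp_integral d.hΓ' _ (d.hS n), h0]
  have e2 : ∫ p, S n p.2 ∂(d.Q.prod m) = ∫ x, S n x ∂m := snd_integral _
  have i1 : Integrable (fun p => S n (d.Γ' p)) (d.Q.prod m) :=
    int_of_bdd ((d.hS n).comp d.hΓ'.measurable) fun p => d.SB n _
  have i2 : Integrable (fun p : κ × ℝ => S n p.2) (d.Q.prod m) :=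
    int_of_bdd ((d.hS n).comp measurable_snd) fun p => d.SB n _
  have i3 : Integrable (fun p : κ × ℝ => d.U' p.1) (d.Q.prod m) := hBi.comp_fst m
  rw [← e2, ← abs_neg, ← zero_sub, ← e1, ← integral_sub i1 i2]
  refine (abs_integral_le_integral_abs).trans ?_
  calc ∫ p, |S n (d.Γ' p) - S n p.2| ∂(d.Q.prod m) ≤ ∫ p : κ × ℝ, d.U' p.1 ∂(d.Q.prod m) := by
        apply integral_mono_ae (i1.sub i2).abs i3
        filter_upwards [d.hD'] with p hp using hp n
    _ = _ := fst_integral _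
    _ ≤ B := hB

lemma mean_a (h0 : ∀ n, ∫ x, S n x ∂ν = 0) :
    ∃ B : ℝ, 0 ≤ B ∧ ∀ n, |∫ x, d.a n x ∂(d.P n)| ≤ B := by
  have := d.hm
  obtain ⟨B, hB0, hB⟩ := d.Uj 1
  obtain ⟨B2, hB20, hB2⟩ := d.mean_m h0
  simp only [pow_one] at hB
  refine ⟨B + B2, by positivity, fun n => ?_⟩
  have := d.hP n
  have e1 : ∫ p, S n (d.Γ n p) ∂((d.P n).prod m) = ∫ x, S n x ∂m := mp_integral (d.hΓ n) _ (d.hS n)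
  have e2 : ∫ p, d.a n p.1 ∂((d.P n).prod m) = ∫ x, d.a n x ∂(d.P n) := fst_integral _
  have i1 : Integrable (fun p => S n (d.Γ n p)) ((d.P n).prod m) :=
    int_of_bdd ((d.hS n).comp (d.hΓ n).measurable) fun p => d.SB n _
  have i2 : Integrable (fun p : ι × ℝ => d.a n p.1) ((d.P n).prod m) :=
    int_of_bdd ((d.ha n).comp measurable_fst) fun p => d.haB n _
  have i3 : Integrable (fun p : ι × ℝ => d.U n p.1) ((d.P n).prod m) := (hB n).1.comp_fst m
  have h3 : |∫ x, S n x ∂m - ∫ x, d.a n x ∂(d.P n)| ≤ B := by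
    rw [← e1, ← e2, ← integral_sub i1 i2]
    refine (abs_integral_le_integral_abs).trans ?_
    calc ∫ p, |S n (d.Γ n p) - d.a n p.1| ∂((d.P n).prod m)
        ≤ ∫ p : ι × ℝ, d.U n p.1 ∂((d.P n).prod m) := by
          apply integral_mono_ae (i1.sub i2).abs i3
          exact d.hDa n
      _ = _ := fst_integral _
      _ ≤ B := (hB n).2
  have h4 := hB2 n
  rw [abs_le] at h3 h4 ⊢
  constructor <;> linarith

lemma l2_nu : ∃ B : ℝ, 0 ≤ B ∧ ∀ n, |l2 ν (S n) - l2 m (S n)| ≤ B := by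
  have := d.hm; have := d.hQ
  obtain ⟨B, hB0, hBi, hB⟩ := d.Uj' 2
  refine ⟨l2 (d.Q.prod m) fun p => d.U' p.1, l2_nonneg _ _, fun n => ?_⟩
  have e1 : l2 ν (S n) = l2 (d.Q.prod m) fun p => S n (d.Γ' p) := by
    unfold l2; rw [mp_integral d.hΓ' (fun x => S n x ^ 2) ((d.hS n).pow_const 2)]
  have e2 : l2 m (S n) = l2 (d.Q.prod m) fun p => S n p.2 := by
    unfold l2; rw [snd_integral (fun x => S n x ^ 2)]
  rw [e1, e2]
  refine l2_tri _ _ _ _ (memLp_of_bdd ((d.hS n).comp d.hΓ'.measurable) fun p => d.SB n _)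
    (memLp_of_bdd ((d.hS n).comp measurable_snd) fun p => d.SB n _) ?_ ?_
  · refine (memLp_two_iff_integrable_sq (d.hU'.comp measurable_fst).aestronglyMeasurable).2 ?_
    exact hBi.comp_fst m
  · filter_upwards [d.hD'] with p hp using hp n

lemma l2U : ∃ B : ℝ, 0 ≤ B ∧ ∀ N, MemLp (fun p : ι × ℝ => d.U N p.1) 2 ((d.P N).prod m) ∧
    l2 ((d.P N).prod m) (fun p : ι × ℝ => d.U N p.1) ≤ B := by
  have := d.hm
  obtain ⟨B, hB0, hB⟩ := d.Uj 2
  refine ⟨√B, by positivity, fun N => ?_⟩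
  have := d.hP N
  constructor
  · refine (memLp_two_iff_integrable_sq ((d.hU N).comp measurable_fst).aestronglyMeasurable).2 ?_
    exact (hB N).1.comp_fst m
  · unfold l2
    apply Real.sqrt_le_sqrt
    rw [fst_integral (fun s => d.U N s ^ 2)]
    exact (hB N).2

lemma l2_a : ∃ B : ℝ, 0 ≤ B ∧ ∀ n, |l2 (d.P n) (d.a n) - l2 m (S n)| ≤ B := by
  have := d.hm
  obtain ⟨B, hB0, hB⟩ := d.l2U
  refine ⟨B, hB0, fun n => ?_⟩
  have := d.hP n
  have e1 : l2 m (S n) = l2 ((d.P n).prod m) fun p => S n (d.Γ n p) := by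
    unfold l2; rw [mp_integral (d.hΓ n) (fun x => S n x ^ 2) ((d.hS n).pow_const 2)]
  have e2 : l2 (d.P n) (d.a n) = l2 ((d.P n).prod m) fun p => d.a n p.1 := by
    unfold l2; rw [fst_integral (fun x => d.a n x ^ 2)]
  rw [e1, e2, abs_sub_comm]
  refine (l2_tri _ _ _ _ (memLp_of_bdd ((d.hS n).comp (d.hΓ n).measurable) fun p => d.SB n _)
    (memLp_of_bdd ((d.ha n).comp measurable_fst) fun p => d.haB n _) (hB n).1 ?_).trans (hB n).2
  exact d.hDa n

lemma ind_integral (N : ℕ) (f : ι → ℝ) (g : ℝ → ℝ) :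
    ∫ p : ι × ℝ, f p.1 * g p.2 ∂((d.P N).prod m) = (∫ s, f s ∂(d.P N)) * ∫ x, g x ∂m := by
  have := d.hm; have := d.hP N
  exact integral_prod_mul f g

lemma sqrt_add_small (x y e B : ℝ) (hx : 0 ≤ x) (hB : 0 ≤ B) (hxe : 0 ≤ x + e) (he : |e| ≤ B) :
    |√(x + e) - √x| ≤ √B := by
  rw [abs_le] at he
  rw [abs_le]
  constructor
  · have : √x ≤ √(x + e) + √B := by
      calc √x ≤ √((x + e) + B) := Real.sqrt_le_sqrt (by linarith)
        _ ≤ _ := sqrt_add_le' _ _ hxe hB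
    linarith
  · have : √(x + e) ≤ √x + √B := by
      calc √(x + e) ≤ √(x + B) := Real.sqrt_le_sqrt (by linarith)
        _ ≤ _ := sqrt_add_le' _ _ hx hB
    linarith

lemma l2_step (h0 : ∀ n, ∫ x, S n x ∂ν = 0) : ∃ B : ℝ, ∀ n k,
    |l2 m (S (n + k)) - √(l2 m (S n) ^ 2 + l2 m (S k) ^ 2)| ≤ B := by
  have := d.hm
  obtain ⟨B, hB0, hB⟩ := d.l2U
  obtain ⟨B1, hB10, hB1⟩ := d.mean_m h0
  obtain ⟨B2, hB20, hB2⟩ := d.mean_a h0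
  obtain ⟨B3, hB30, hB3⟩ := d.l2_a
  refine ⟨B + √(2 * B2 * B1) + B3, fun n k => ?_⟩
  have := d.hP n
  have e1 : l2 m (S (n + k)) = l2 ((d.P n).prod m) fun p => S (n + k) (d.Γ n p) := by
    unfold l2; rw [mp_integral (d.hΓ n) (fun x => S (n + k) x ^ 2) ((d.hS _).pow_const 2)]
  have ab : ∀ p : ι × ℝ, |d.a n p.1 + S k p.2| ≤ C * n + C * k := fun p =>
    (abs_add_le _ _).trans (add_le_add (d.haB n _) (d.SB k _))
  have am : Measurable fun p : ι × ℝ => d.a n p.1 + S k p.2 :=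
    ((d.ha n).comp measurable_fst).add ((d.hS k).comp measurable_snd)
  have t1 := (l2_tri ((d.P n).prod m) (fun p => S (n + k) (d.Γ n p))
    (fun p => d.a n p.1 + S k p.2) (fun p => d.U n p.1)
    (memLp_of_bdd ((d.hS _).comp (d.hΓ n).measurable) fun p => d.SB _ _)
    (memLp_of_bdd am ab) (hB n).1 (by
      filter_upwards [d.hD n] with p hp
      have := hp k
      rwa [← sub_sub])).trans (hB n).2
  have e2 : ∫ p : ι × ℝ, (d.a n p.1 + S k p.2) ^ 2 ∂((d.P n).prod m) =
      (l2 (d.P n) (d.a n) ^ 2 + l2 m (S k) ^ 2) +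
        2 * ((∫ s, d.a n s ∂(d.P n)) * ∫ x, S k x ∂m) := by
    have : ∀ p : ι × ℝ, (d.a n p.1 + S k p.2) ^ 2 =
      (d.a n p.1 ^ 2 + S k p.2 ^ 2) + 2 * (d.a n p.1 * S k p.2) := fun p => by ring
    simp_rw [this]
    have j1 : Integrable (fun p : ι × ℝ => d.a n p.1 ^ 2) ((d.P n).prod m) :=
      int_of_bdd (((d.ha n).pow_const 2).comp measurable_fst) fun p => abs_pow_bdd (d.haB n _) 2
    have j2 : Integrable (fun p : ι × ℝ => S k p.2 ^ 2) ((d.P n).prod m) :=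
      int_of_bdd (((d.hS k).pow_const 2).comp measurable_snd) fun p => abs_pow_bdd (d.SB k _) 2
    have j3 : Integrable (fun p : ι × ℝ => d.a n p.1 * S k p.2) ((d.P n).prod m) :=
      int_of_bdd (B := (C * n) * (C * k))
        (((d.ha n).comp measurable_fst).mul ((d.hS k).comp measurable_snd)) fun p => by
        rw [abs_mul]
        exact mul_le_mul (d.haB n _) (d.SB k _) (abs_nonneg _) ((abs_nonneg _).trans (d.haB n p.1))
    have j12 : Integrable (fun p : ι × ℝ => d.a n p.1 ^ 2 + S k p.2 ^ 2) ((d.P n).prod m) :=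
      j1.add j2
    rw [integral_add j12 (j3.const_mul 2), integral_add j1 j2, integral_const_mul,
      fst_integral (fun s => d.a n s ^ 2), snd_integral (fun s => S k s ^ 2), d.ind_integral,
      l2_sq, l2_sq]
  have t2 : |l2 ((d.P n).prod m) (fun p => d.a n p.1 + S k p.2) -
      √(l2 (d.P n) (d.a n) ^ 2 + l2 m (S k) ^ 2)| ≤ √(2 * B2 * B1) := by
    rw [l2, e2]
    refine d.sqrt_add_small _ 0 _ _ (by positivity) (by positivity) ?_ ?_
    · rw [← e2]; exact integral_nonneg fun _ => sq_nonneg _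
    · rw [abs_mul, abs_mul, abs_two, mul_assoc]
      gcongr
      exacts [hB2 n, hB1 k]
  have t3 := (sqrt_sq_diff _ _ (l2 m (S k)) ).trans (hB3 n)
  rw [e1]
  rw [abs_le] at *
  constructor <;> linarith

lemma var_conv (h0 : ∀ n, ∫ x, S n x ∂ν = 0) : ∃ w D : ℝ, 0 ≤ w ∧ 0 ≤ D ∧
    (∀ n : ℕ, |l2 m (S n) - w * √n| ≤ D) ∧ (∀ n : ℕ, |l2 ν (S n) - w * √n| ≤ D) ∧
    (∀ n : ℕ, |l2 (d.P n) (d.a n) - w * √n| ≤ D) := by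
  obtain ⟨B, hB⟩ := d.l2_step h0
  obtain ⟨w, D, hw, hD⟩ := seq_conv (fun n => l2 m (S n)) (fun n => l2_nonneg _ _) B hB
  obtain ⟨B1, hB10, hB1⟩ := d.l2_nu
  obtain ⟨B2, hB20, hB2⟩ := d.l2_a
  have hD0 : 0 ≤ D := (abs_nonneg _).trans (hD 0)
  refine ⟨w, D + B1 + B2, hw, by positivity, fun n => ?_, fun n => ?_, fun n => ?_⟩
  all_goals
    have h1 := hD n
    have h2 := hB1 n
    have h3 := hB2 n
    rw [abs_le] at *
    constructor <;> linarith

end Decoup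
end S18

namespace S18

lemma four_seq (q : ℕ → ℝ) (A : ℝ) (hA : 0 ≤ A) (h0 : q 0 = 0) (h1 : q 1 ≤ A)
    (h2 : ∀ k, q (2 * k) ≤ 2.8 * q k + A * (k ^ 2 + 1))
    (h3 : ∀ n, q (n + 1) ≤ 9 / 8 * q n + A) : ∀ n : ℕ, q n ≤ 10 * A * n ^ 2 := by
  intro n
  induction n using Nat.strong_induction_on with
  | _ n ih =>
    rcases Nat.even_or_odd' n with ⟨k, hk | hk⟩
    · rcases Nat.eq_zero_or_pos k with h | h
      · subst h; subst hk; simp [h0]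
      · have := ih k (by omega)
        have h4 := h2 k
        have hk1 : (1 : ℝ) ≤ k := by exact_mod_cast h
        have : (1 : ℝ) ≤ (k : ℝ) ^ 2 := by nlinarith
        rw [hk]; push_cast
        nlinarith
    · rcases Nat.eq_zero_or_pos k with h | h
      · subst h; subst hk; norm_num; linarith
      · have := ih k (by omega)
        have h4 := h2 k
        have h5 := h3 (2 * k)
        have hk1 : (1 : ℝ) ≤ k := by exact_mod_cast h
        have : (1 : ℝ) ≤ (k : ℝ) ^ 2 := by nlinarith
        rw [hk]; push_cast
        nlinarith

namespace Decoup
variable {ι κ : Type} [MeasurableSpace ι] [MeasurableSpace κ] {m ν : Measure ℝ}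
    {S : ℕ → ℝ → ℝ} {γ c C : ℝ} (d : Decoup ι κ m ν S γ c C)
include d

lemma a_int (n j : ℕ) : Integrable (fun s => d.a n s ^ j) (d.P n) := by
  have := d.hP n
  exact int_of_bdd ((d.ha n).pow_const j) fun s => abs_pow_bdd (d.haB n s) j

lemma S_int (n j : ℕ) : Integrable (fun s => S n s ^ j) m := by
  have := d.hm
  exact int_of_bdd ((d.hS n).pow_const j) fun s => abs_pow_bdd (d.SB n s) j

lemma a_int_abs (n j : ℕ) : Integrable (fun s => |d.a n s| ^ j) (d.P n) := by
  have := (d.a_int n j).abs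
  simpa [abs_pow] using this

lemma four_a : ∃ B : ℝ, 0 ≤ B ∧ ∀ n,
    ∫ s, d.a n s ^ 4 ∂(d.P n) ≤ 9 / 8 * ∫ x, S n x ^ 4 ∂m + B := by
  have := d.hm
  obtain ⟨B, hB0, hB⟩ := d.Uj 4
  refine ⟨17576 * B, by positivity, fun n => ?_⟩
  have := d.hP n
  rw [← mp_integral (d.hΓ n) (fun x => S n x ^ 4) ((d.hS n).pow_const 4),
    ← fst_integral (m := m) (fun s => d.a n s ^ 4)]
  have i1 : Integrable (fun p => S n (d.Γ n p) ^ 4) ((d.P n).prod m) :=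
    (d.hΓ n).integrable_comp_of_integrable (d.S_int n 4)
  have i3 : Integrable (fun p : ι × ℝ => d.U n p.1 ^ 4) ((d.P n).prod m) := (hB n).1.comp_fst m
  calc _ ≤ ∫ p, (9 / 8 * S n (d.Γ n p) ^ 4 + 17576 * d.U n p.1 ^ 4) ∂((d.P n).prod m) := by
        apply integral_mono_ae ((d.a_int n 4).comp_fst m) ((i1.const_mul _).add (i3.const_mul _))
        filter_upwards [d.hDa n] with p hp
        have h1 := four_add (S n (d.Γ n p)) (d.a n p.1 - S n (d.Γ n p))
        have h2 : (d.a n p.1 - S n (d.Γ n p)) ^ 4 ≤ d.U n p.1 ^ 4 := by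
          rw [abs_sub_comm] at hp
          have := abs_pow_bdd hp 4
          exact (le_abs_self _).trans this
        simp only [Pi.add_apply]
        rw [add_sub_cancel] at h1
        linarith
    _ = 9 / 8 * ∫ p, S n (d.Γ n p) ^ 4 ∂((d.P n).prod m) + 17576 * ∫ s, d.U n s ^ 4 ∂(d.P n) := by
        rw [integral_add (i1.const_mul _) (i3.const_mul _), integral_const_mul, integral_const_mul,
          fst_integral (fun s => d.U n s ^ 4)]
    _ ≤ _ := by gcongr; exact (hB n).2

lemma four_step : ∃ B : ℝ, 0 ≤ B ∧ ∀ n k, ∫ x, S (n + k) x ^ 4 ∂m ≤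
    9 / 8 * ∫ p : ι × ℝ, (d.a n p.1 + S k p.2) ^ 4 ∂((d.P n).prod m) + B := by
  have := d.hm
  obtain ⟨B, hB0, hB⟩ := d.Uj 4
  refine ⟨17576 * B, by positivity, fun n k => ?_⟩
  have := d.hP n
  rw [← mp_integral (d.hΓ n) (fun x => S (n + k) x ^ 4) ((d.hS _).pow_const 4)]
  have i1 : Integrable (fun p => S (n + k) (d.Γ n p) ^ 4) ((d.P n).prod m) :=
    (d.hΓ n).integrable_comp_of_integrable (d.S_int _ 4)
  have i2 : Integrable (fun p : ι × ℝ => (d.a n p.1 + S k p.2) ^ 4) ((d.P n).prod m) := by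
    refine int_of_bdd (B := (C * n + C * k) ^ 4) ?_ fun p => abs_pow_bdd
      ((abs_add_le _ _).trans (add_le_add (d.haB n _) (d.SB k _))) 4
    exact (((d.ha n).comp measurable_fst).add ((d.hS k).comp measurable_snd)).pow_const 4
  have i3 : Integrable (fun p : ι × ℝ => d.U n p.1 ^ 4) ((d.P n).prod m) := (hB n).1.comp_fst m
  calc _ ≤ ∫ p : ι × ℝ, (9 / 8 * (d.a n p.1 + S k p.2) ^ 4 + 17576 * d.U n p.1 ^ 4)
          ∂((d.P n).prod m) := by
        apply integral_mono_ae i1 ((i2.const_mul _).add (i3.const_mul _))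
        filter_upwards [d.hD n] with p hp
        have hp := hp k
        rw [sub_sub] at hp
        have h1 := four_add (d.a n p.1 + S k p.2) (S (n + k) (d.Γ n p) - (d.a n p.1 + S k p.2))
        have h2 : (S (n + k) (d.Γ n p) - (d.a n p.1 + S k p.2)) ^ 4 ≤ d.U n p.1 ^ 4 := by
          have := abs_pow_bdd hp 4
          exact (le_abs_self _).trans this
        simp only [Pi.add_apply]
        rw [add_sub_cancel] at h1
        linarith
    _ = 9 / 8 * ∫ p : ι × ℝ, (d.a n p.1 + S k p.2) ^ 4 ∂((d.P n).prod m)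
          + 17576 * ∫ s, d.U n s ^ 4 ∂(d.P n) := by
        rw [integral_add (i2.const_mul _) (i3.const_mul _), integral_const_mul, integral_const_mul,
          fst_integral (fun s => d.U n s ^ 4)]
    _ ≤ _ := by gcongr; exact (hB n).2

lemma four_expand (n k : ℕ) : ∫ p : ι × ℝ, (d.a n p.1 + S k p.2) ^ 4 ∂((d.P n).prod m) =
    (∫ s, d.a n s ^ 4 ∂(d.P n)) + 4 * ((∫ s, d.a n s ^ 3 ∂(d.P n)) * ∫ x, S k x ∂m) +
    6 * ((∫ s, d.a n s ^ 2 ∂(d.P n)) * ∫ x, S k x ^ 2 ∂m) +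
    4 * ((∫ s, d.a n s ∂(d.P n)) * ∫ x, S k x ^ 3 ∂m) + ∫ x, S k x ^ 4 ∂m := by
  have := d.hm
  have := d.hP n
  have e : ∀ p : ι × ℝ, (d.a n p.1 + S k p.2) ^ 4 = (((d.a n p.1 ^ 4 + 4 * (d.a n p.1 ^ 3 * S k p.2))
    + 6 * (d.a n p.1 ^ 2 * S k p.2 ^ 2)) + 4 * (d.a n p.1 * S k p.2 ^ 3)) + S k p.2 ^ 4 :=
    fun p => by ring
  simp_rw [e]
  have S1 : Integrable (fun x => S k x) m := by simpa using d.S_int k 1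
  have a1 : Integrable (fun x => d.a n x) (d.P n) := by simpa using d.a_int n 1
  have k1 : Integrable (fun p : ι × ℝ => d.a n p.1 ^ 4) ((d.P n).prod m) := (d.a_int n 4).comp_fst m
  have k2 : Integrable (fun p : ι × ℝ => 4 * (d.a n p.1 ^ 3 * S k p.2)) ((d.P n).prod m) :=
    ((d.a_int n 3).mul_prod S1).const_mul 4
  have k3 : Integrable (fun p : ι × ℝ => 6 * (d.a n p.1 ^ 2 * S k p.2 ^ 2)) ((d.P n).prod m) :=
    ((d.a_int n 2).mul_prod (d.S_int k 2)).const_mul 6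
  have k4 : Integrable (fun p : ι × ℝ => 4 * (d.a n p.1 * S k p.2 ^ 3)) ((d.P n).prod m) :=
    (a1.mul_prod (d.S_int k 3)).const_mul 4
  have k5 : Integrable (fun p : ι × ℝ => S k p.2 ^ 4) ((d.P n).prod m) :=
    (d.S_int k 4).comp_snd (d.P n)
  rw [integral_add (by exact ((k1.add k2).add k3).add k4) k5,
    integral_add (by exact (k1.add k2).add k3) k4, integral_add (by exact k1.add k2) k3,
    integral_add k1 k2, integral_const_mul, integral_const_mul, integral_const_mul,
    fst_integral (fun s => d.a n s ^ 4), snd_integral (fun s => S k s ^ 4),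
    d.ind_integral n (fun s => d.a n s ^ 3) (fun s => S k s), d.ind_integral n (fun s => d.a n s ^ 2)
     (fun s => S k s ^ 2), d.ind_integral n (fun s => d.a n s) (fun s => S k s ^ 3)]

lemma S_four (h0 : ∀ n, ∫ x, S n x ∂ν = 0) : ∃ B : ℝ, 0 ≤ B ∧
    ∀ n : ℕ, ∫ x, S n x ^ 4 ∂m ≤ B * n ^ 2 := by
  have := d.hm
  obtain ⟨B1, hB10, hB1⟩ := d.four_a
  obtain ⟨B2, hB20, hB2⟩ := d.four_step
  obtain ⟨B3, hB30, hB3⟩ := d.mean_m h0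
  obtain ⟨B4, hB40, hB4⟩ := d.mean_a h0
  obtain ⟨w, D, hw, hD0, hD1, -, hD3⟩ := d.var_conv h0
  obtain ⟨L, hL0, hL⟩ : ∃ L : ℝ, 0 ≤ L ∧ ∀ x : ℝ, 0 ≤ x → (w * √x + D) ^ 2 ≤ L * (x + 1) := by
    refine ⟨2 * w ^ 2 + 2 * D ^ 2, by positivity, fun x hx => ?_⟩
    have := Real.sq_sqrt hx
    nlinarith [sq_nonneg (w * √x - D), mul_nonneg (sq_nonneg D) hx, sq_nonneg w]
  have sqS : ∀ n : ℕ, ∫ x, S n x ^ 2 ∂m ≤ L * (n + 1) := fun n => by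
    rw [← l2_sq]
    have := hD1 n
    rw [abs_le] at this
    refine le_trans ?_ (hL n (by positivity))
    have := l2_nonneg m (S n)
    gcongr
    linarith
  have sqa : ∀ n : ℕ, ∫ x, d.a n x ^ 2 ∂(d.P n) ≤ L * (n + 1) := fun n => by
    rw [← l2_sq]
    have := hD3 n
    rw [abs_le] at this
    refine le_trans ?_ (hL n (by positivity))
    have := l2_nonneg (d.P n) (d.a n)
    gcongr
    linarith
  set q : ℕ → ℝ := fun n => ∫ x, S n x ^ 4 ∂m with hq
  set δ : ℝ := 1 / (40 * (B3 + B4 + 1)) with hδ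
  have hδ0 : 0 < δ := by positivity
  have hB3δ : 4 * B3 * δ ≤ 1 / 10 := by
    rw [hδ, mul_one_div, div_le_div_iff₀ (by positivity) (by norm_num)]; linarith
  have hB4δ : 4 * B4 * δ ≤ 1 / 10 := by
    rw [hδ, mul_one_div, div_le_div_iff₀ (by positivity) (by norm_num)]; linarith
  have q0 : ∀ n, 0 ≤ q n := fun n => integral_nonneg fun x => by positivity
  have cubS : ∀ n, |∫ x, S n x ^ 3 ∂m| ≤ δ * q n + 1 / δ ^ 3 := fun n => by
    calc |∫ x, S n x ^ 3 ∂m| ≤ ∫ x, |S n x ^ 3| ∂m := abs_integral_le_integral_abs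
      _ ≤ ∫ x, (δ * S n x ^ 4 + 1 / δ ^ 3) ∂m := by
        apply integral_mono (d.S_int n 3).abs
          (((d.S_int n 4).const_mul δ).add (integrable_const _))
        intro x
        simp only [abs_pow]
        exact cube_le _ _ hδ0
      _ = _ := by
        rw [integral_add ((d.S_int n 4).const_mul δ) (integrable_const _), integral_const_mul]
        simp [hq]
  have cuba : ∀ n, |∫ x, d.a n x ^ 3 ∂(d.P n)| ≤ δ * ∫ x, d.a n x ^ 4 ∂(d.P n) + 1 / δ ^ 3 :=
    fun n => by
    have := d.hP n
    calc |∫ x, d.a n x ^ 3 ∂(d.P n)| ≤ ∫ x, |d.a n x ^ 3| ∂(d.P n) := abs_integral_le_integral_abs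
      _ ≤ ∫ x, (δ * d.a n x ^ 4 + 1 / δ ^ 3) ∂(d.P n) := by
        apply integral_mono (d.a_int n 3).abs
          (((d.a_int n 4).const_mul δ).add (integrable_const _))
        intro x
        simp only [abs_pow]
        exact cube_le _ _ hδ0
      _ = _ := by
        rw [integral_add ((d.a_int n 4).const_mul δ) (integrable_const _), integral_const_mul]
        simp
  have dbl : ∀ k : ℕ, q (2 * k) ≤ 2.8 * q k + (9 / 8 * (1.1 * B1 + 4 * B3 / δ ^ 3 + 4 * B4 / δ ^ 3 +
      12 * L ^ 2) + B2) * (k ^ 2 + 1) := fun k => by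
    have h1 := hB2 k k
    rw [← two_mul, d.four_expand] at h1
    have h2 := hB1 k
    have h3 : (∫ s, d.a k s ^ 3 ∂(d.P k)) * ∫ x, S k x ∂m ≤
        (δ * ∫ x, d.a k x ^ 4 ∂(d.P k) + 1 / δ ^ 3) * B3 := by
      refine (le_abs_self _).trans ?_
      rw [abs_mul]
      exact mul_le_mul (cuba k) (hB3 k) (abs_nonneg _) ((abs_nonneg _).trans (cuba k))
    have h4 : (∫ s, d.a k s ∂(d.P k)) * ∫ x, S k x ^ 3 ∂m ≤
        B4 * (δ * q k + 1 / δ ^ 3) := by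
      refine (le_abs_self _).trans ?_
      rw [abs_mul]
      exact mul_le_mul (hB4 k) (cubS k) (abs_nonneg _) hB40
    have h5 : (∫ s, d.a k s ^ 2 ∂(d.P k)) * ∫ x, S k x ^ 2 ∂m ≤ (L * (k + 1)) * (L * (k + 1)) :=
      mul_le_mul (sqa k) (sqS k) (integral_nonneg fun x => by positivity) (by positivity)
    have h6 : (L * ((k : ℝ) + 1)) * (L * (k + 1)) ≤ 2 * L ^ 2 * (k ^ 2 + 1) := by
      nlinarith [sq_nonneg (L * ((k : ℝ) - 1))]
    have ha0 : 0 ≤ ∫ x, d.a k x ^ 4 ∂(d.P k) := integral_nonneg fun x => by positivity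
    have h7 : 4 * B3 * δ * ∫ x, d.a k x ^ 4 ∂(d.P k) ≤ 1 / 10 * ∫ x, d.a k x ^ 4 ∂(d.P k) := by
      gcongr
    have h8 : 4 * B4 * δ * q k ≤ 1 / 10 * q k := by
      have := q0 k
      gcongr
    set A4 := ∫ x, d.a k x ^ 4 ∂(d.P k)
    have e3 : 4 * B3 / δ ^ 3 = 4 * (1 / δ ^ 3 * B3) := by ring
    have e4 : 4 * B4 / δ ^ 3 = 4 * (B4 * (1 / δ ^ 3)) := by ring
    have key : q (2 * k) ≤ 2.8 * q k + (9 / 8 * (1.1 * B1 + 4 * B3 / δ ^ 3 + 4 * B4 / δ ^ 3) + B2) +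
        9 / 8 * (12 * L ^ 2) * (k ^ 2 + 1) := by
      have hqk := q0 k
      have h2' : A4 ≤ 9 / 8 * q k + B1 := h2
      have h1' : q (2 * k) ≤ _ := h1
      change q (2 * k) ≤ 9 / 8 * (A4 + _ + _ + _ + q k) + B2 at h1'
      rw [e3, e4]
      nlinarith
    have hpos : 0 ≤ 9 / 8 * (1.1 * B1 + 4 * B3 / δ ^ 3 + 4 * B4 / δ ^ 3) + B2 := by positivity
    nlinarith [mul_nonneg hpos (sq_nonneg (k : ℝ))]
  have one : ∀ n, q (n + 1) ≤ 9 / 8 * q n + 17576 * C ^ 4 := fun n => by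
    calc q (n + 1) ≤ ∫ x, (9 / 8 * S n x ^ 4 + 17576 * C ^ 4) ∂m := by
          apply integral_mono (d.S_int _ 4) (((d.S_int n 4).const_mul _).add (integrable_const _))
          intro x
          have h1 := four_add (S n x) (S (n + 1) x - S n x)
          rw [add_sub_cancel] at h1
          have h2 := d.hSL n 1 x
          simp only [Nat.cast_one, mul_one] at h2
          have h3 := (le_abs_self _).trans (abs_pow_bdd h2 4)
          simp only [Pi.add_apply]
          linarith
      _ = _ := by
        rw [integral_add ((d.S_int n 4).const_mul _) (integrable_const _), integral_const_mul]
        simp [hq]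
  have qz : q 0 = 0 := by simp [hq, d.hS0]
  set A := (9 / 8 * (1.1 * B1 + 4 * B3 / δ ^ 3 + 4 * B4 / δ ^ 3 + 12 * L ^ 2) + B2) with hA
  have hA0 : 0 ≤ A := by positivity
  have hC4 : 0 ≤ 17576 * C ^ 4 := by positivity
  refine ⟨10 * (A + 17576 * C ^ 4), by positivity,
    four_seq q (A + 17576 * C ^ 4) (by positivity) qz ?_ ?_ ?_⟩
  · have := one 0
    rw [qz] at this
    simp only [zero_add, mul_zero] at this
    linarith
  · intro k
    have := dbl k
    nlinarith [mul_nonneg hC4 (sq_nonneg (k : ℝ))]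
  · intro n
    have := one n
    linarith

lemma a_four (h0 : ∀ n, ∫ x, S n x ∂ν = 0) : ∃ B : ℝ, 0 ≤ B ∧
    ∀ n : ℕ, ∫ x, d.a n x ^ 4 ∂(d.P n) ≤ B * (n ^ 2 + 1) := by
  obtain ⟨B1, hB10, hB1⟩ := d.four_a
  obtain ⟨B2, hB20, hB2⟩ := d.S_four h0
  refine ⟨9 / 8 * B2 + B1, by positivity, fun n => ?_⟩
  have := hB1 n
  have := hB2 n
  nlinarith [mul_nonneg hB10 (sq_nonneg (n : ℝ))]

/-- third absolute moment, and second moment asymptotics -/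
lemma a_moments (h0 : ∀ n, ∫ x, S n x ∂ν = 0) : ∃ w B : ℝ, 0 ≤ w ∧ 0 ≤ B ∧
    (∀ n : ℕ, |l2 ν (S n) - w * √n| ≤ B) ∧
    (∀ n : ℕ, l2 m (S n) ≤ B * (√n + 1)) ∧
    (∀ n : ℕ, |∫ x, d.a n x ∂(d.P n)| ≤ B) ∧
    (∀ n : ℕ, |∫ x, d.a n x ^ 2 ∂(d.P n) - w ^ 2 * n| ≤ B * (√n + 1)) ∧
    (∀ n : ℕ, ∫ x, |d.a n x| ^ 3 ∂(d.P n) ≤ B * (√n + 1) ^ 3) := by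
  obtain ⟨w, D, hw, hD0, hD1, hD2, hD3⟩ := d.var_conv h0
  obtain ⟨B1, hB10, hB1⟩ := d.mean_a h0
  obtain ⟨B2, hB20, hB2⟩ := d.a_four h0
  set B := D + (w + D) + B1 + (D * (2 * w + D)) + (B2 + 1) with hB
  have hww : 0 ≤ D * (2 * w + D) := by positivity
  refine ⟨w, B, hw, by positivity, fun n => ?_, fun n => ?_, fun n => ?_, fun n => ?_, fun n => ?_⟩
  · have := hD2 n; linarith
  · have := hD1 n
    rw [abs_le] at this
    have hs := Real.sqrt_nonneg (n : ℝ)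
    nlinarith [mul_nonneg hww hs, mul_nonneg hB10 hs, mul_nonneg hB20 hs, mul_nonneg hD0 hs]
  · have := hB1 n; linarith
  · rw [← l2_sq]
    have := hD3 n
    have hs := Real.sqrt_nonneg (n : ℝ)
    have hsq := Real.sq_sqrt (Nat.cast_nonneg n : (0 : ℝ) ≤ n)
    have e : l2 (d.P n) (d.a n) ^ 2 - w ^ 2 * n =
      (l2 (d.P n) (d.a n) - w * √n) * ((l2 (d.P n) (d.a n) - w * √n) + 2 * w * √n) := by
      nlinarith
    rw [e, abs_mul]
    calc _ ≤ D * (D + 2 * w * √n) := by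
          gcongr
          refine (abs_add_le _ _).trans ?_
          gcongr
          rw [abs_of_nonneg (by positivity)]
      _ ≤ _ := by
        have h1 : 0 ≤ D * w := by positivity
        have h2 : 0 ≤ D * D := by positivity
        nlinarith [mul_nonneg h2 hs, mul_nonneg hB10 hs, mul_nonneg hB20 hs, mul_nonneg hD0 hs,
          mul_nonneg h1 hs, mul_nonneg hw hs]
  · have hs := Real.sqrt_nonneg (n : ℝ)
    set δ := 1 / (√(n : ℝ) + 1) with hδ
    have hδ0 : 0 < δ := by positivity
    have := d.hP n
    have h1 : ∫ x, |d.a n x| ^ 3 ∂(d.P n) ≤ δ * ∫ x, d.a n x ^ 4 ∂(d.P n) + 1 / δ ^ 3 := by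
      calc _ ≤ ∫ x, (δ * d.a n x ^ 4 + 1 / δ ^ 3) ∂(d.P n) := by
            apply integral_mono (d.a_int_abs n 3)
              (((d.a_int n 4).const_mul δ).add (integrable_const _))
            intro x
            exact cube_le _ _ hδ0
        _ = _ := by
          rw [integral_add ((d.a_int n 4).const_mul δ) (integrable_const _), integral_const_mul]
          simp
    have hsq := Real.sq_sqrt (Nat.cast_nonneg n : (0 : ℝ) ≤ n)
    have h2 : (n : ℝ) ^ 2 + 1 ≤ (√(n : ℝ) + 1) ^ 4 := by
      nlinarith [mul_nonneg hs hs, mul_nonneg (mul_nonneg hs hs) hs]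
    have h3 : δ * ∫ x, d.a n x ^ 4 ∂(d.P n) ≤ B2 * (√(n : ℝ) + 1) ^ 3 := by
      calc _ ≤ δ * (B2 * (√(n : ℝ) + 1) ^ 4) := by
            gcongr; exact (hB2 n).trans (by gcongr)
        _ = _ := by rw [hδ]; field_simp
    have h4 : 1 / δ ^ 3 = (√(n : ℝ) + 1) ^ 3 := by rw [hδ]; simp
    have h5 : B2 + 1 ≤ B := by linarith
    calc _ ≤ (B2 + 1) * (√(n : ℝ) + 1) ^ 3 := by linarith
      _ ≤ _ := by gcongr

end Decoup
end S18

namespace S18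

lemma norm_ei (x : ℝ) : ‖Complex.exp (Complex.I * x)‖ = 1 := Complex.norm_exp_I_mul_ofReal x

lemma ei_lip (x y : ℝ) : ‖Complex.exp (Complex.I * x) - Complex.exp (Complex.I * y)‖ ≤ |x - y| := by
  have e : Complex.exp (Complex.I * x) - Complex.exp (Complex.I * y) =
      Complex.exp (Complex.I * y) * (Complex.exp (Complex.I * (x - y : ℝ)) - 1) := by
    rw [mul_sub, ← Complex.exp_add, mul_one]; congr 2; push_cast; ring
  rw [e, norm_mul, norm_ei, one_mul]
  exact Real.norm_exp_I_mul_ofReal_sub_one_le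

lemma ei_taylor (x : ℝ) : ‖Complex.exp (Complex.I * x) - (1 + Complex.I * x - x ^ 2 / 2)‖
    ≤ 4 * |x| ^ 3 := by
  rcases le_total |x| 1 with h | h
  · have h1 := Complex.norm_exp_sub_sum_le_norm_mul_exp (Complex.I * x) 3
    have e : ∑ i ∈ Finset.range 3, (Complex.I * (x : ℂ)) ^ i / (i.factorial : ℂ) =
        1 + Complex.I * x - x ^ 2 / 2 := by
      simp [Finset.sum_range_succ, Nat.factorial, mul_pow]
      ring
    rw [e] at h1
    have hn : ‖Complex.I * (x : ℂ)‖ = |x| := by simp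
    rw [hn] at h1
    refine h1.trans ?_
    have : Real.exp |x| ≤ 4 := (Real.exp_le_exp.2 h).trans (by linarith [Real.exp_one_lt_d9])
    rw [mul_comm]; gcongr
  · have hn : ‖Complex.I * (x : ℂ)‖ = |x| := by simp
    have hn2 : ‖(x : ℂ) ^ 2 / 2‖ = |x| ^ 2 / 2 := by simp
    calc _ ≤ ‖Complex.exp (Complex.I * x)‖ + ‖1 + Complex.I * x - x ^ 2 / 2‖ := norm_sub_le _ _
      _ ≤ 1 + ((1 + |x|) + |x| ^ 2 / 2) := by
        rw [norm_ei]
        gcongr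
        refine (norm_sub_le _ _).trans ?_
        rw [hn2]
        gcongr
        refine (norm_add_le _ _).trans ?_
        rw [hn]; simp
      _ ≤ _ := by
        have h2 : 1 ≤ |x| ^ 2 := by nlinarith
        have h3 : |x| ^ 2 ≤ |x| ^ 3 := by nlinarith
        nlinarith

lemma pow_sub_norm (z w : ℂ) (hz : ‖z‖ ≤ 1) (hw : ‖w‖ ≤ 1) (b : ℕ) :
    ‖z ^ b - w ^ b‖ ≤ b * ‖z - w‖ := by
  induction b with
  | zero => simp
  | succ b ih =>
    have e : z ^ (b + 1) - w ^ (b + 1) = z ^ b * (z - w) + (z ^ b - w ^ b) * w := by ring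
    rw [e]
    refine (norm_add_le _ _).trans ?_
    rw [norm_mul, norm_mul, norm_pow]
    have h1 : ‖z‖ ^ b ≤ 1 := pow_le_one₀ (norm_nonneg _) hz
    push_cast
    have := norm_nonneg (z - w)
    have := norm_nonneg (z ^ b - w ^ b)
    nlinarith

namespace Decoup
variable {ι κ : Type} [MeasurableSpace ι] [MeasurableSpace κ] {m ν : Measure ℝ}
    {S : ℕ → ℝ → ℝ} {γ c C : ℝ} (d : Decoup ι κ m ν S γ c C)

/-- characteristic function of `S n` under `m` -/
noncomputable def chi (_d : Decoup ι κ m ν S γ c C) (n : ℕ) (l : ℝ) : ℂ :=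
  ∫ x, Complex.exp (Complex.I * (l * S n x : ℝ)) ∂m

/-- characteristic function of `a n` under `P n` -/
noncomputable def psi (d : Decoup ι κ m ν S γ c C) (n : ℕ) (l : ℝ) : ℂ :=
  ∫ x, Complex.exp (Complex.I * (l * d.a n x : ℝ)) ∂(d.P n)

include d

lemma ei_int {α : Type*} [MeasurableSpace α] (μ : Measure α) [IsProbabilityMeasure μ] (f : α → ℝ)
    (hf : Measurable f) : Integrable (fun x => Complex.exp (Complex.I * (f x : ℝ))) μ := by
  refine Integrable.of_bound (C := 1) ?_ (ae_of_all _ fun x => (norm_ei _).le)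
  exact Measurable.aestronglyMeasurable (by fun_prop)

lemma ei_norm {α : Type*} [MeasurableSpace α] (μ : Measure α) [IsProbabilityMeasure μ] (f : α → ℝ) :
    ‖∫ x, Complex.exp (Complex.I * (f x : ℝ)) ∂μ‖ ≤ 1 := by
  have := norm_integral_le_of_norm_le_const (μ := μ) (ae_of_all _ fun x => (norm_ei (f x)).le)
  simpa using this

lemma psi_norm (n : ℕ) (l : ℝ) : ‖d.psi n l‖ ≤ 1 := by
  have := d.hP n
  exact d.ei_norm _ _

lemma chi_step : ∃ B : ℝ, 0 ≤ B ∧ ∀ N k l, ‖d.chi (N + k) l - d.psi N l * d.chi k l‖ ≤ B * |l| := by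
  have := d.hm
  obtain ⟨B, hB0, hB⟩ := d.Uj 1
  simp only [pow_one] at hB
  refine ⟨B, hB0, fun N k l => ?_⟩
  have := d.hP N
  have mS := d.hS
  have ma := d.ha N
  have mG := (d.hΓ N).measurable
  have e1 : d.chi (N + k) l =
      ∫ p, Complex.exp (Complex.I * (l * S (N + k) (d.Γ N p) : ℝ)) ∂((d.P N).prod m) := by
    have h := integral_map (μ := (d.P N).prod m) mG.aemeasurable (f := fun x : ℝ =>
      Complex.exp (Complex.I * (l * S (N + k) x : ℝ)))
      (Measurable.aestronglyMeasurable (by fun_prop))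
    rw [(d.hΓ N).map_eq] at h
    exact h
  have e2 : d.psi N l * d.chi k l =
      ∫ p : ι × ℝ, Complex.exp (Complex.I * (l * (d.a N p.1 + S k p.2) : ℝ)) ∂((d.P N).prod m) := by
    rw [psi, chi, ← integral_prod_mul]
    congr 1; ext p; rw [← Complex.exp_add]; congr 1; push_cast; ring
  have i1 := d.ei_int ((d.P N).prod m) (fun p => l * S (N + k) (d.Γ N p)) (by fun_prop)
  have i2 := d.ei_int ((d.P N).prod m) (fun p => l * (d.a N p.1 + S k p.2)) (by fun_prop)
  have i3 : Integrable (fun p : ι × ℝ => d.U N p.1 * |l|) ((d.P N).prod m) :=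
    ((hB N).1.comp_fst m).mul_const _
  rw [e1, e2, ← integral_sub i1 i2]
  calc _ ≤ ∫ p : ι × ℝ, d.U N p.1 * |l| ∂((d.P N).prod m) := by
        apply norm_integral_le_of_norm_le i3
        filter_upwards [d.hD N] with p hp
        refine (ei_lip _ _).trans ?_
        rw [← mul_sub, abs_mul, mul_comm]
        have := hp k
        rw [sub_sub] at this
        gcongr
    _ = (∫ s, d.U N s ∂(d.P N)) * |l| := by
        rw [integral_mul_const, fst_integral (fun s => d.U N s)]
    _ ≤ _ := by gcongr; exact (hB N).2

lemma chi_iter : ∃ B : ℝ, 0 ≤ B ∧ ∀ N b k l,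
    ‖d.chi (b * N + k) l - d.psi N l ^ b * d.chi k l‖ ≤ B * (b * |l|) := by
  obtain ⟨B, hB0, hB⟩ := d.chi_step
  refine ⟨B, hB0, fun N b k l => ?_⟩
  induction b with
  | zero => simp
  | succ b ih =>
    have h1 := hB N (b * N + k) l
    have e0 : (b + 1) * N + k = N + (b * N + k) := by ring
    rw [e0]
    have e : d.chi (N + (b * N + k)) l - d.psi N l ^ (b + 1) * d.chi k l =
      (d.chi (N + (b * N + k)) l - d.psi N l * d.chi (b * N + k) l) +
      d.psi N l * (d.chi (b * N + k) l - d.psi N l ^ b * d.chi k l) := by ring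
    rw [e]
    refine (norm_add_le _ _).trans ?_
    rw [norm_mul]
    have h2 := d.psi_norm N l
    have h3 : ‖d.psi N l‖ * ‖d.chi (b * N + k) l - d.psi N l ^ b * d.chi k l‖ ≤
      1 * (B * (b * |l|)) := by gcongr
    push_cast
    linarith

lemma chi_one (h0 : ∀ n, ∫ x, S n x ∂ν = 0) : ∃ B : ℝ, 0 ≤ B ∧ ∀ (n : ℕ) l,
    ‖d.chi n l - 1‖ ≤ B * (|l| * (√n + 1)) := by
  have := d.hm
  obtain ⟨w, B, hw, hB0, -, hB, -⟩ := d.a_moments h0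
  refine ⟨B, hB0, fun n l => ?_⟩
  have mS := d.hS
  have i1 := d.ei_int m (fun p => l * S n p) (by fun_prop)
  have e : d.chi n l - 1 = ∫ x, (Complex.exp (Complex.I * (l * S n x : ℝ)) - 1) ∂m := by
    rw [integral_sub i1 (integrable_const _)]; simp [chi]
  rw [e]
  have S1 : Integrable (fun x => S n x) m := by simpa using d.S_int n 1
  have hl2 : ∫ x, |S n x| ∂m ≤ l2 m (S n) := by
    have h1 : (∫ x, |S n x| ∂m) ^ 2 ≤ ∫ x, |S n x| ^ 2 ∂m :=
      by
        have := (convexOn_pow (𝕜 := ℝ) 2).map_integral_le (μ := m) (f := fun x => |S n x|)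
          (by fun_prop) isClosed_Ici (ae_of_all _ fun x => Set.mem_Ici.2 (abs_nonneg _)) S1.abs
          (by simpa [Function.comp_def] using d.S_int n 2)
        simpa using this
    simp only [sq_abs] at h1
    rw [l2]
    exact Real.le_sqrt_of_sq_le h1
  calc _ ≤ ∫ x, |S n x| * |l| ∂m := by
        apply norm_integral_le_of_norm_le (S1.abs.mul_const _)
        refine ae_of_all _ fun x => ?_
        refine (Real.norm_exp_I_mul_ofReal_sub_one_le).trans ?_
        rw [Real.norm_eq_abs, abs_mul, mul_comm]
    _ = (∫ x, |S n x| ∂m) * |l| := by rw [integral_mul_const]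
    _ ≤ (B * (√n + 1)) * |l| := by gcongr; exact hl2.trans (hB n)
    _ = _ := by ring

lemma psi_taylor (w B : ℝ)
    (h1 : ∀ n : ℕ, |∫ x, d.a n x ∂(d.P n)| ≤ B)
    (h2 : ∀ n : ℕ, |∫ x, d.a n x ^ 2 ∂(d.P n) - w ^ 2 * n| ≤ B * (√n + 1))
    (h3 : ∀ n : ℕ, ∫ x, |d.a n x| ^ 3 ∂(d.P n) ≤ B * (√n + 1) ^ 3) (N : ℕ) (l : ℝ) :
    ‖d.psi N l - (1 - (l ^ 2 * w ^ 2 * N / 2 : ℝ))‖ ≤ B * |l| + B * (l ^ 2 * (√N + 1)) +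
      4 * B * (|l| * (√N + 1)) ^ 3 := by
  have := d.hP N
  have ma := d.ha N
  have i1 := d.ei_int (d.P N) (fun p => l * d.a N p) (by fun_prop)
  have a1 : Integrable (fun x => d.a N x) (d.P N) := by simpa using d.a_int N 1
  have i2 : Integrable (fun x => (1 : ℂ) + Complex.I * (l * d.a N x : ℝ)
      - ((l * d.a N x : ℝ) : ℂ) ^ 2 / 2) (d.P N) := by
    refine ((integrable_const _).add ?_).sub ?_
    · exact ((a1.const_mul l).ofReal).const_mul _
    · have := (((d.a_int N 2).const_mul (l ^ 2)).ofReal (𝕜 := ℂ)).div_const 2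
      refine this.congr (ae_of_all _ fun x => ?_)
      simp [mul_pow]
  have e2 : ∫ x, ((1 : ℂ) + Complex.I * (l * d.a N x : ℝ) - ((l * d.a N x : ℝ) : ℂ) ^ 2 / 2) ∂(d.P N)
      = 1 + Complex.I * (l * ∫ x, d.a N x ∂(d.P N) : ℝ)
        - (l ^ 2 * ∫ x, d.a N x ^ 2 ∂(d.P N) : ℝ) / 2 := by
    have k1 : Integrable (fun x => Complex.I * ((l * d.a N x : ℝ) : ℂ)) (d.P N) :=
      ((a1.const_mul l).ofReal).const_mul _
    have k2 : Integrable (fun x => ((l ^ 2 * d.a N x ^ 2 : ℝ) : ℂ) / 2) (d.P N) :=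
      (((d.a_int N 2).const_mul (l ^ 2)).ofReal (𝕜 := ℂ)).div_const 2
    have : ∀ x, ((l * d.a N x : ℝ) : ℂ) ^ 2 / 2 = ((l ^ 2 * d.a N x ^ 2 : ℝ) : ℂ) / 2 := fun x => by
      push_cast; ring
    simp_rw [this]
    rw [integral_sub (by exact (integrable_const _).add k1) k2,
      integral_add (integrable_const _) k1, integral_const_mul, integral_div]
    rw [integral_complex_ofReal, integral_complex_ofReal, integral_const_mul, integral_const_mul]
    simp
  have e : d.psi N l - (1 - (l ^ 2 * w ^ 2 * N / 2 : ℝ)) =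
      (∫ x, (Complex.exp (Complex.I * (l * d.a N x : ℝ)) - ((1 : ℂ) + Complex.I * (l * d.a N x : ℝ)
      - ((l * d.a N x : ℝ) : ℂ) ^ 2 / 2)) ∂(d.P N)) + Complex.I * (l * ∫ x, d.a N x ∂(d.P N) : ℝ) -
      (l ^ 2 * (∫ x, d.a N x ^ 2 ∂(d.P N) - w ^ 2 * N) / 2 : ℝ) := by
    rw [integral_sub i1 i2, e2, psi]
    push_cast; ring
  rw [e]
  have n1 : ‖∫ x, (Complex.exp (Complex.I * (l * d.a N x : ℝ)) -
      ((1 : ℂ) + Complex.I * (l * d.a N x : ℝ)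
      - ((l * d.a N x : ℝ) : ℂ) ^ 2 / 2)) ∂(d.P N)‖ ≤ 4 * B * (|l| * (√N + 1)) ^ 3 := by
    calc _ ≤ ∫ x, 4 * |l| ^ 3 * |d.a N x| ^ 3 ∂(d.P N) := by
          apply norm_integral_le_of_norm_le ((d.a_int_abs N 3).const_mul _)
          refine ae_of_all _ fun x => ?_
          refine (ei_taylor _).trans ?_
          rw [abs_mul, mul_pow, mul_assoc]
      _ = 4 * |l| ^ 3 * ∫ x, |d.a N x| ^ 3 ∂(d.P N) := integral_const_mul _ _
      _ ≤ 4 * |l| ^ 3 * (B * (√N + 1) ^ 3) := by gcongr; exact h3 N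
      _ = _ := by ring
  have n2 : ‖Complex.I * (l * ∫ x, d.a N x ∂(d.P N) : ℝ)‖ ≤ B * |l| := by
    rw [norm_mul, Complex.norm_I, one_mul, Complex.norm_real, Real.norm_eq_abs, abs_mul, mul_comm]
    gcongr
    exact h1 N
  have n3 : ‖((l ^ 2 * (∫ x, d.a N x ^ 2 ∂(d.P N) - w ^ 2 * N) / 2 : ℝ) : ℂ)‖ ≤
      B * (l ^ 2 * (√N + 1)) := by
    rw [Complex.norm_real, Real.norm_eq_abs, abs_div, abs_mul, abs_of_nonneg (sq_nonneg l), abs_two]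
    have : l ^ 2 * |∫ x, d.a N x ^ 2 ∂(d.P N) - w ^ 2 * N| ≤ l ^ 2 * (B * (√N + 1)) := by
      gcongr; exact h2 N
    have : 0 ≤ l ^ 2 * |∫ x, d.a N x ^ 2 ∂(d.P N) - w ^ 2 * N| := by positivity
    linarith
  refine (norm_sub_le _ _).trans ?_
  have := norm_add_le (∫ x, (Complex.exp (Complex.I * (l * d.a N x : ℝ)) -
      ((1 : ℂ) + Complex.I * (l * d.a N x : ℝ)
      - ((l * d.a N x : ℝ) : ℂ) ^ 2 / 2)) ∂(d.P N)) (Complex.I * (l * ∫ x, d.a N x ∂(d.P N) : ℝ))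
  linarith

end Decoup
end S18

namespace S18

lemma exp_neg_two {v : ℝ} (hv : 0 ≤ v) : |Real.exp (-v) - (1 - v)| ≤ v ^ 2 := by
  have h1 := Real.add_one_le_exp (-v)
  rw [abs_of_nonneg (by linarith)]
  rcases le_total v 1 with h | h
  · have := Real.abs_exp_sub_one_sub_id_le (x := -v) (by rw [abs_neg, abs_of_nonneg hv]; exact h)
    rw [abs_le] at this
    nlinarith
  · have : Real.exp (-v) ≤ 1 := Real.exp_le_one_iff.2 (by linarith)
    nlinarith

lemma exp_neg_lip {x y : ℝ} (hx : 0 ≤ x) (hy : 0 ≤ y) : |Real.exp (-x) - Real.exp (-y)| ≤ |x - y| := by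
  have key : ∀ x y : ℝ, 0 ≤ x → x ≤ y → |Real.exp (-x) - Real.exp (-y)| ≤ |x - y| := by
    intro x y hx h
    rw [abs_of_nonneg (sub_nonneg.2 (Real.exp_le_exp.2 (by linarith))), abs_sub_comm,
      abs_of_nonneg (sub_nonneg.2 h)]
    have e : Real.exp (-y) = Real.exp (-x) * Real.exp (-(y - x)) := by
      rw [← Real.exp_add]; congr 1; ring
    have h1 : Real.exp (-x) ≤ 1 := Real.exp_le_one_iff.2 (by linarith)
    have h2 := Real.add_one_le_exp (-(y - x))
    have h3 := Real.exp_pos (-x)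
    rw [e]
    nlinarith
  rcases le_total x y with h | h
  · exact key x y hx h
  · rw [abs_sub_comm, abs_sub_comm x]; exact key y x hy h

namespace Decoup
variable {ι κ : Type} [MeasurableSpace ι] [MeasurableSpace κ] {m ν : Measure ℝ}
    {S : ℕ → ℝ → ℝ} {γ c C : ℝ} (d : Decoup ι κ m ν S γ c C)
include d

lemma char_est (h0 : ∀ n, ∫ x, S n x ∂ν = 0) (w B : ℝ) (hB0 : 0 ≤ B)
    (h1 : ∀ n : ℕ, |∫ x, d.a n x ∂(d.P n)| ≤ B)
    (h2 : ∀ n : ℕ, |∫ x, d.a n x ^ 2 ∂(d.P n) - w ^ 2 * n| ≤ B * (√n + 1))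
    (h3 : ∀ n : ℕ, ∫ x, |d.a n x| ^ 3 ∂(d.P n) ≤ B * (√n + 1) ^ 3) :
    ∃ K : ℝ, 0 ≤ K ∧ ∀ (N b r : ℕ) (l : ℝ),
    ‖d.psi (b * N + r) l - (Real.exp (-(l ^ 2 * w ^ 2 * (b * N + r) / 2)) : ℝ)‖ ≤
      K * ((b + 1) * |l| + |l| * (√r + 1) + b * (l ^ 2 * (√N + 1)) + b * (|l| * (√N + 1)) ^ 3 +
        b * (l ^ 2 * N) ^ 2 + l ^ 2 * r) := by
  obtain ⟨B1, hB10, hB1⟩ := d.chi_iter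
  obtain ⟨B2, hB20, hB2⟩ := d.chi_one h0
  refine ⟨B1 + B2 + 4 * B + w ^ 4 + w ^ 2, by positivity, fun N b r l => ?_⟩
  set v : ℝ := l ^ 2 * w ^ 2 * N / 2 with hv
  have hv0 : 0 ≤ v := by positivity
  have t0 : ‖d.psi (b * N + r) l - d.chi (b * N + r) l‖ ≤ B1 * |l| := by
    have := hB1 (b * N + r) 1 0 l
    have e : d.chi 0 l = 1 := by
      have := d.hm
      simp [chi, d.hS0]
    rw [e] at this
    rw [norm_sub_rev]
    simpa using this
  have t1 := hB1 N b r l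
  have t2 : ‖d.psi N l ^ b * d.chi r l - d.psi N l ^ b‖ ≤ B2 * (|l| * (√r + 1)) := by
    have e : d.psi N l ^ b * d.chi r l - d.psi N l ^ b = d.psi N l ^ b * (d.chi r l - 1) := by ring
    rw [e, norm_mul, norm_pow]
    have h4 : ‖d.psi N l‖ ^ b ≤ 1 := pow_le_one₀ (norm_nonneg _) (d.psi_norm N l)
    have h5 := hB2 r l
    have := norm_nonneg (d.chi r l - 1)
    nlinarith
  have t3 : ‖d.psi N l ^ b - ((Real.exp (-v) : ℝ) : ℂ) ^ b‖ ≤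
      b * (B * |l| + B * (l ^ 2 * (√N + 1)) + 4 * B * (|l| * (√N + 1)) ^ 3 + v ^ 2) := by
    refine (pow_sub_norm _ _ (d.psi_norm N l) ?_ b).trans ?_
    · rw [Complex.norm_real, Real.norm_eq_abs, abs_of_pos (Real.exp_pos _)]
      exact Real.exp_le_one_iff.2 (by linarith)
    · gcongr
      have h4 := d.psi_taylor w B h1 h2 h3 N l
      have h5 : ‖((Real.exp (-v) : ℝ) : ℂ) - (1 - (v : ℝ))‖ ≤ v ^ 2 := by
        have : ((Real.exp (-v) : ℝ) : ℂ) - (1 - (v : ℝ)) = ((Real.exp (-v) - (1 - v) : ℝ) : ℂ) := by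
          push_cast; ring
        rw [this, Complex.norm_real]
        exact exp_neg_two hv0
      have h6 : d.psi N l - ((Real.exp (-v) : ℝ) : ℂ) =
        (d.psi N l - (1 - (v : ℝ))) - (((Real.exp (-v) : ℝ) : ℂ) - (1 - (v : ℝ))) := by ring
      rw [h6]
      refine (norm_sub_le _ _).trans ?_
      linarith
  have t4 : ‖((Real.exp (-v) : ℝ) : ℂ) ^ b -
      ((Real.exp (-(l ^ 2 * w ^ 2 * (b * N + r) / 2)) : ℝ) : ℂ)‖ ≤ w ^ 2 * (l ^ 2 * r) := by
    rw [← Complex.ofReal_pow, ← Real.exp_nat_mul, ← Complex.ofReal_sub, Complex.norm_real,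
      Real.norm_eq_abs]
    have e : (b : ℝ) * -v = -(b * v) := by ring
    rw [e]
    refine (exp_neg_lip (by positivity) (by positivity)).trans ?_
    have e2 : b * v - l ^ 2 * w ^ 2 * (b * N + r) / 2 = - (l ^ 2 * w ^ 2 * r / 2) := by
      rw [hv]; ring
    rw [e2, abs_neg, abs_of_nonneg (by positivity)]
    have : 0 ≤ w ^ 2 * (l ^ 2 * r) := by positivity
    linarith
  have e : d.psi (b * N + r) l - (Real.exp (-(l ^ 2 * w ^ 2 * (b * N + r) / 2)) : ℝ) =
      (d.psi (b * N + r) l - d.chi (b * N + r) l) +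
      (d.chi (b * N + r) l - d.psi N l ^ b * d.chi r l) +
      (d.psi N l ^ b * d.chi r l - d.psi N l ^ b) +
      (d.psi N l ^ b - ((Real.exp (-v) : ℝ) : ℂ) ^ b) + (((Real.exp (-v) : ℝ) : ℂ) ^ b -
      ((Real.exp (-(l ^ 2 * w ^ 2 * (b * N + r) / 2)) : ℝ) : ℂ)) := by ring
  rw [e]
  refine ((norm_add_le _ _).trans (add_le_add ((norm_add_le _ _).trans (add_le_add
    ((norm_add_le _ _).trans (add_le_add ((norm_add_le _ _).trans (add_le_add t0 t1)) t2)) t3))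
    t4)).trans ?_
  set p1 := |l| with hp1
  set p2 := |l| * (√r + 1) with hp2
  set p3 := l ^ 2 * (√N + 1) with hp3
  set p4 := (|l| * (√N + 1)) ^ 3 with hp4
  have hv2 : v ^ 2 ≤ w ^ 4 * (l ^ 2 * N) ^ 2 := by
    have : v ^ 2 = w ^ 4 * (l ^ 2 * N) ^ 2 / 4 := by rw [hv]; ring
    have h0 : 0 ≤ w ^ 4 * (l ^ 2 * N) ^ 2 := by positivity
    linarith
  set p5 := (l ^ 2 * (N : ℝ)) ^ 2 with hp5
  set p6 := l ^ 2 * (r : ℝ) with hp6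
  have q1 : 0 ≤ p1 := abs_nonneg _
  have q2 : 0 ≤ p2 := by positivity
  have q3 : 0 ≤ p3 := by positivity
  have q4 : 0 ≤ p4 := by positivity
  have q5 : 0 ≤ p5 := by positivity
  have q6 : 0 ≤ p6 := by positivity
  have hb : (0 : ℝ) ≤ b := Nat.cast_nonneg b
  calc _ ≤ B1 * p1 + B1 * (b * p1) + B2 * p2 + b * (B * p1 + B * p3 + 4 * B * p4 + w ^ 4 * p5) +
        w ^ 2 * p6 := by gcongr
    _ ≤ (B1 + B2 + 4 * B + w ^ 4 + w ^ 2) * ((b + 1) * p1) + (B1 + B2 + 4 * B + w ^ 4 + w ^ 2) * p2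
      + (B1 + B2 + 4 * B + w ^ 4 + w ^ 2) * (b * p3) + (B1 + B2 + 4 * B + w ^ 4 + w ^ 2) * (b * p4)
      + (B1 + B2 + 4 * B + w ^ 4 + w ^ 2) * (b * p5) + (B1 + B2 + 4 * B + w ^ 4 + w ^ 2) * p6 := by
      have w4 : 0 ≤ w ^ 4 := by positivity
      have w2 : 0 ≤ w ^ 2 := by positivity
      have r1 : (B1 + B) * ((b + 1) * p1) ≤ (B1 + B2 + 4 * B + w ^ 4 + w ^ 2) * ((b + 1) * p1) := by
        refine mul_le_mul_of_nonneg_right ?_ (by positivity)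
        linarith
      have r2 : B2 * p2 ≤ (B1 + B2 + 4 * B + w ^ 4 + w ^ 2) * p2 := by
        gcongr; linarith
      have r3 : B * (b * p3) ≤ (B1 + B2 + 4 * B + w ^ 4 + w ^ 2) * (b * p3) := by
        gcongr; linarith
      have r4 : 4 * B * (b * p4) ≤ (B1 + B2 + 4 * B + w ^ 4 + w ^ 2) * (b * p4) := by
        gcongr; linarith
      have r5 : w ^ 4 * (b * p5) ≤ (B1 + B2 + 4 * B + w ^ 4 + w ^ 2) * (b * p5) := by
        gcongr; linarith
      have r6 : w ^ 2 * p6 ≤ (B1 + B2 + 4 * B + w ^ 4 + w ^ 2) * p6 := by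
        gcongr; linarith
      have r7 : 0 ≤ B * p1 := by positivity
      nlinarith
    _ = _ := by ring

lemma psi_lim (h0 : ∀ n, ∫ x, S n x ∂ν = 0) (w B : ℝ) (hB0 : 0 ≤ B)
    (h1 : ∀ n : ℕ, |∫ x, d.a n x ∂(d.P n)| ≤ B)
    (h2 : ∀ n : ℕ, |∫ x, d.a n x ^ 2 ∂(d.P n) - w ^ 2 * n| ≤ B * (√n + 1))
    (h3 : ∀ n : ℕ, ∫ x, |d.a n x| ^ 3 ∂(d.P n) ≤ B * (√n + 1) ^ 3) (t : ℝ) :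
    Tendsto (fun n : ℕ => d.psi n (t / √n)) atTop
      (nhds ((Real.exp (-(t ^ 2 * w ^ 2 / 2)) : ℝ) : ℂ)) := by
  obtain ⟨K, hK0, hK⟩ := d.char_est h0 w B hB0 h1 h2 h3
  rw [tendsto_iff_norm_sub_tendsto_zero]
  have lim : Tendsto (fun n : ℕ => K * (5 * |t| + 3 * t ^ 2 + 27 * |t| ^ 3 + 4 * t ^ 4 + 2 * t ^ 2) *
      ((n : ℝ) ^ (-(1 / 8 : ℝ)))) atTop (nhds 0) := by
    have := ((tendsto_rpow_neg_atTop (show (0 : ℝ) < 1 / 8 by norm_num)).comp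
      tendsto_natCast_atTop_atTop).const_mul
      (K * (5 * |t| + 3 * t ^ 2 + 27 * |t| ^ 3 + 4 * t ^ 4 + 2 * t ^ 2))
    simpa using this
  refine squeeze_zero' (Eventually.of_forall fun _ => norm_nonneg _) ?_ lim
  filter_upwards [eventually_ge_atTop 1] with n hn
  have hn1 : (1 : ℝ) ≤ n := by exact_mod_cast hn
  set x : ℝ := (n : ℝ) ^ (1 / 8 : ℝ) with hx
  have hx1 : 1 ≤ x := Real.one_le_rpow hn1 (by norm_num)
  have hx0 : 0 < x := by linarith
  have x8 : (n : ℝ) = x ^ 8 := by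
    rw [hx, ← Real.rpow_natCast, ← Real.rpow_mul (by positivity)]; norm_num
  have xs : √(n : ℝ) = x ^ 4 := by
    rw [x8, show x ^ 8 = (x ^ 4) ^ 2 by ring]; exact Real.sqrt_sq (by positivity)
  rw [Real.rpow_neg (by positivity), ← hx]
  set N : ℕ := ⌈x ^ 6⌉₊ with hN
  have hx6 : 1 ≤ x ^ 6 := one_le_pow₀ hx1
  have hN1 : x ^ 6 ≤ N := Nat.le_ceil _
  have hN2 : (N : ℝ) ≤ 2 * x ^ 6 := by
    have := Nat.ceil_lt_add_one (show 0 ≤ x ^ 6 by positivity)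
    linarith
  have hNpos : 0 < N := Nat.ceil_pos.2 (by positivity)
  have hsN : √(N : ℝ) ≤ 2 * x ^ 3 := by
    apply Real.sqrt_le_iff.2
    refine ⟨by positivity, ?_⟩
    nlinarith
  have hx3 : 1 ≤ x ^ 3 := one_le_pow₀ hx1
  set b := n / N with hb
  set r := n % N with hr
  have hbr : b * N + r = n := Nat.div_add_mod' n N
  have hrN : (r : ℝ) ≤ N := by exact_mod_cast (Nat.mod_lt n hNpos).le
  have hbx : (b : ℝ) ≤ x ^ 2 := by
    have h4 : (b : ℝ) * N ≤ n := by exact_mod_cast Nat.div_mul_le_self n N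
    have h5 : (b : ℝ) * x ^ 6 ≤ x ^ 8 := by
      rw [← x8]; refine le_trans ?_ h4; gcongr
    have h6 : (b : ℝ) * x ^ 6 ≤ x ^ 2 * x ^ 6 := by rw [← pow_add]; exact h5
    exact le_of_mul_le_mul_right h6 (by positivity)
  have hK' := hK N b r (t / √n)
  rw [hbr] at hK'
  have e1 : (t / √(n : ℝ)) ^ 2 * w ^ 2 * (b * N + r) / 2 = t ^ 2 * w ^ 2 / 2 := by
    have : (b : ℝ) * N + r = n := by exact_mod_cast hbr
    rw [this, div_pow, Real.sq_sqrt (by positivity)]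
    field_simp
  rw [e1] at hK'
  refine hK'.trans ?_
  rw [mul_assoc]
  gcongr
  have hl : |t / √(n : ℝ)| = |t| / x ^ 4 := by rw [xs, abs_div, abs_of_pos (by positivity : 0 < x ^ 4)]
  have hl2 : (t / √(n : ℝ)) ^ 2 = t ^ 2 / x ^ 8 := by rw [xs]; rw [div_pow]; ring
  rw [hl, hl2]
  have hsr : √(r : ℝ) ≤ 2 * x ^ 3 := (Real.sqrt_le_sqrt hrN).trans hsN
  have m2 : x ≤ x ^ 2 := by nlinarith
  have hx2 : 1 ≤ x ^ 2 := one_le_pow₀ hx1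
  have s1 : (b + 1) * (|t| / x ^ 4) ≤ 2 * |t| * x⁻¹ := by
    calc (b + 1) * (|t| / x ^ 4) ≤ (x ^ 2 + x ^ 2) * (|t| / x ^ 4) := by gcongr
      _ = 2 * |t| * (1 / x ^ 2) := by field_simp; ring
      _ ≤ 2 * |t| * x⁻¹ := by
        rw [← one_div]; gcongr
  have s2 : |t| / x ^ 4 * (√(r : ℝ) + 1) ≤ 3 * |t| * x⁻¹ := by
    calc |t| / x ^ 4 * (√(r : ℝ) + 1) ≤ |t| / x ^ 4 * (2 * x ^ 3 + x ^ 3) := by gcongr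
      _ = _ := by field_simp; ring
  have s3 : b * (t ^ 2 / x ^ 8 * (√(N : ℝ) + 1)) ≤ 3 * t ^ 2 * x⁻¹ := by
    calc b * (t ^ 2 / x ^ 8 * (√(N : ℝ) + 1)) ≤ x ^ 2 * (t ^ 2 / x ^ 8 * (2 * x ^ 3 + x ^ 3)) := by
          gcongr
      _ = 3 * t ^ 2 * (1 / x ^ 3) := by field_simp; ring
      _ ≤ 3 * t ^ 2 * x⁻¹ := by
        rw [← one_div]; gcongr
        exact le_self_pow₀ hx1 (by norm_num)
  have s4 : b * (|t| / x ^ 4 * (√(N : ℝ) + 1)) ^ 3 ≤ 27 * |t| ^ 3 * x⁻¹ := by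
    calc b * (|t| / x ^ 4 * (√(N : ℝ) + 1)) ^ 3 ≤ x ^ 2 * (|t| / x ^ 4 * (2 * x ^ 3 + x ^ 3)) ^ 3 := by
          gcongr
      _ = _ := by field_simp; ring
  have s5 : b * (t ^ 2 / x ^ 8 * N) ^ 2 ≤ 4 * t ^ 4 * x⁻¹ := by
    calc b * (t ^ 2 / x ^ 8 * N) ^ 2 ≤ x ^ 2 * (t ^ 2 / x ^ 8 * (2 * x ^ 6)) ^ 2 := by
          gcongr
      _ = 4 * t ^ 4 * (1 / x ^ 2) := by field_simp; ring
      _ ≤ 4 * t ^ 4 * x⁻¹ := by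
        rw [← one_div]; gcongr
  have s6 : t ^ 2 / x ^ 8 * r ≤ 2 * t ^ 2 * x⁻¹ := by
    calc t ^ 2 / x ^ 8 * r ≤ t ^ 2 / x ^ 8 * (2 * x ^ 6) := by
          gcongr; linarith
      _ = 2 * t ^ 2 * (1 / x ^ 2) := by field_simp
      _ ≤ 2 * t ^ 2 * x⁻¹ := by
        rw [← one_div]; gcongr
  linarith

/-- CLT for `a n` : open sets -/
lemma clt (h0 : ∀ n, ∫ x, S n x ∂ν = 0) (w B : ℝ) (hB0 : 0 ≤ B)
    (h1 : ∀ n : ℕ, |∫ x, d.a n x ∂(d.P n)| ≤ B)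
    (h2 : ∀ n : ℕ, |∫ x, d.a n x ^ 2 ∂(d.P n) - w ^ 2 * n| ≤ B * (√n + 1))
    (h3 : ∀ n : ℕ, ∫ x, |d.a n x| ^ 3 ∂(d.P n) ≤ B * (√n + 1) ^ 3) (G : Set ℝ) (hG : IsOpen G) :
    ProbabilityTheory.gaussianReal 0 (Real.toNNReal (w ^ 2)) G ≤
      liminf (fun n : ℕ => d.P n {s | d.a n s / √n ∈ G}) atTop := by
  have := d.hP
  have mm : ∀ n, Measurable fun s => d.a n s / √n := fun n => (d.ha n).div_const _
  let μs : ℕ → ProbabilityMeasure ℝ := fun n => ⟨(d.P n).map fun s => d.a n s / √n,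
    Measure.isProbabilityMeasure_map (mm n).aemeasurable⟩
  let μ : ProbabilityMeasure ℝ := ⟨ProbabilityTheory.gaussianReal 0 (Real.toNNReal (w ^ 2)),
    inferInstance⟩
  have lim : Tendsto μs atTop (nhds μ) := by
    rw [ProbabilityMeasure.tendsto_iff_tendsto_charFun]
    intro t
    have e1 : charFun (μ : Measure ℝ) t = ((Real.exp (-(t ^ 2 * w ^ 2 / 2)) : ℝ) : ℂ) := by
      change charFun (ProbabilityTheory.gaussianReal 0 (Real.toNNReal (w ^ 2))) t = _
      rw [ProbabilityTheory.charFun_gaussianReal]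
      push_cast
      congr 1
      have : ((Real.toNNReal (w ^ 2) : ℝ) : ℂ) = (w : ℂ) ^ 2 := by
        rw [Real.coe_toNNReal _ (sq_nonneg w)]; push_cast; ring
      rw [this]
      ring
    have e2 : ∀ n : ℕ, charFun (μs n : Measure ℝ) t = d.psi n (t / √n) := by
      intro n
      change charFun ((d.P n).map fun s => d.a n s / √n) t = _
      rw [charFun_apply_real, integral_map (mm n).aemeasurable
        (Measurable.aestronglyMeasurable (by fun_prop)), psi]
      congr 1; ext s; congr 1; push_cast; ring
    simp_rw [e2, e1]
    exact d.psi_lim h0 w B hB0 h1 h2 h3 t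
  have := ProbabilityMeasure.le_liminf_measure_open_of_tendsto lim hG
  refine this.trans_eq ?_
  congr 1; ext n
  change ((d.P n).map fun s => d.a n s / √n) G = _
  rw [Measure.map_apply (mm n) hG.measurableSet]
  rfl

end Decoup
end S18

namespace S18

lemma real_exp_taylor (x K : ℝ) (hx : |x| ≤ K) :
    Real.exp x ≤ 1 + x + x ^ 2 / 2 + Real.exp K * |x| ^ 3 := by
  have h1 := Complex.norm_exp_sub_sum_le_norm_mul_exp (x : ℂ) 3
  have e : Complex.exp x - ∑ i ∈ Finset.range 3, ((x : ℂ)) ^ i / (i.factorial : ℂ) =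
      ((Real.exp x - (1 + x + x ^ 2 / 2) : ℝ) : ℂ) := by
    simp [Finset.sum_range_succ, Nat.factorial]
  rw [e, Complex.norm_real, Complex.norm_real, Real.norm_eq_abs, Real.norm_eq_abs] at h1
  have h2 : |x| ^ 3 * Real.exp |x| ≤ |x| ^ 3 * Real.exp K := by gcongr
  have := le_abs_self (Real.exp x - (1 + x + x ^ 2 / 2))
  linarith

lemma real_exp_one (x K : ℝ) (hx : |x| ≤ K) : Real.exp x ≤ 1 + Real.exp K * |x| := by
  have h1 := Complex.norm_exp_sub_sum_le_norm_mul_exp (x : ℂ) 1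
  have e : Complex.exp x - ∑ i ∈ Finset.range 1, ((x : ℂ)) ^ i / (i.factorial : ℂ) =
      ((Real.exp x - 1 : ℝ) : ℂ) := by
    simp
  rw [e, Complex.norm_real, Complex.norm_real, Real.norm_eq_abs, Real.norm_eq_abs] at h1
  have h2 : |x| ^ 1 * Real.exp |x| ≤ |x| ^ 1 * Real.exp K := by gcongr
  have := le_abs_self (Real.exp x - 1)
  rw [pow_one] at *
  linarith

lemma tail_bound {α : Type*} [MeasurableSpace α] (μ : Measure α) (U : α → ℝ) (hU : Measurable U)
    (γ c C : ℝ) (hγ : 0 < γ) (hc : 0 < c)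
    (hUi : ∫⁻ s, ENNReal.ofReal (Real.exp (c * U s ^ γ)) ∂μ ≤ ENNReal.ofReal C) (M : ℝ) (hM : 0 ≤ M) :
    μ {s | M < U s} ≤ ENNReal.ofReal (C * Real.exp (-(c * M ^ γ))) := by
  have h1 := mul_meas_ge_le_lintegral₀ (μ := μ)
    (f := fun s => ENNReal.ofReal (Real.exp (c * U s ^ γ)))
    (by fun_prop) (ENNReal.ofReal (Real.exp (c * M ^ γ)))
  have h2 : μ {s | M < U s} ≤
      μ {s | ENNReal.ofReal (Real.exp (c * M ^ γ)) ≤ ENNReal.ofReal (Real.exp (c * U s ^ γ))} := by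
    apply measure_mono
    intro s hs
    apply ENNReal.ofReal_le_ofReal
    apply Real.exp_le_exp.2
    have : M ≤ U s := le_of_lt hs
    gcongr
  have h3 : ENNReal.ofReal (Real.exp (c * M ^ γ)) * μ {s | M < U s} ≤ ENNReal.ofReal C :=
    ((mul_le_mul_right h2 _).trans h1).trans hUi
  calc μ {s | M < U s} = ENNReal.ofReal (Real.exp (-(c * M ^ γ))) *
        (ENNReal.ofReal (Real.exp (c * M ^ γ)) * μ {s | M < U s}) := by
        rw [← mul_assoc, ← ENNReal.ofReal_mul (Real.exp_pos _).le, ← Real.exp_add]; simp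
    _ ≤ ENNReal.ofReal (Real.exp (-(c * M ^ γ))) * ENNReal.ofReal C := by gcongr
    _ = _ := by rw [← ENNReal.ofReal_mul (Real.exp_pos _).le, mul_comm]

namespace Decoup
variable {ι κ : Type} [MeasurableSpace ι] [MeasurableSpace κ] {m ν : Measure ℝ}
    {S : ℕ → ℝ → ℝ} {γ c C : ℝ} (d : Decoup ι κ m ν S γ c C)
include d

lemma upper_ind (N : ℕ) (M l : ℝ) (hl : 0 ≤ l) (b : ℕ) : ∀ t : ℝ,
    m {x | t < S (b * N) x} ≤ b * d.P N {s | M < d.U N s} + ENNReal.ofReal (Real.exp (-(l * t))) *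
      (∫⁻ s in {s | d.U N s ≤ M}, ENNReal.ofReal (Real.exp (l * (d.a N s + d.U N s))) ∂(d.P N)) ^ b := by
  have := d.hm
  have := d.hP N
  have mS := d.hS
  have ma := d.ha N
  have mU := d.hU N
  set W := ∫⁻ s in {s | d.U N s ≤ M}, ENNReal.ofReal (Real.exp (l * (d.a N s + d.U N s))) ∂(d.P N)
    with hW
  set p := d.P N {s | M < d.U N s} with hp
  induction b with
  | zero =>
    intro t
    rcases lt_or_ge t 0 with h | h
    · simp only [pow_zero, mul_one, Nat.cast_zero, zero_mul, zero_add]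
      refine prob_le_one.trans ?_
      rw [ENNReal.one_le_ofReal]
      apply Real.one_le_exp
      nlinarith
    · have : {x | t < S (0 * N) x} = ∅ := by
        ext x; simp [d.hS0, h]
      rw [this]; simp
  | succ b ih =>
    intro t
    have e0 : (b + 1) * N = N + b * N := by ring
    rw [e0, ← (d.hΓ N).measure_preimage
      ((measurableSet_lt measurable_const (mS _)).nullMeasurableSet)]
    have sub : ∀ᵐ q ∂((d.P N).prod m), q ∈ d.Γ N ⁻¹' {x | t < S (N + b * N) x} →
        q ∈ ({s | M < d.U N s} ×ˢ univ) ∪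
          {q : ι × ℝ | d.U N q.1 ≤ M ∧ t - (d.a N q.1 + d.U N q.1) < S (b * N) q.2} := by
      filter_upwards [d.hD N] with q hq hq2
      have h3 := hq (b * N)
      rw [abs_le] at h3
      simp only [mem_preimage, mem_setOf_eq] at hq2
      by_cases h : M < d.U N q.1
      · left; exact ⟨h, trivial⟩
      · right; exact ⟨not_lt.1 h, by linarith⟩
    have ms : MeasurableSet {q : ι × ℝ | d.U N q.1 ≤ M ∧
        t - (d.a N q.1 + d.U N q.1) < S (b * N) q.2} := by
      have f1 : Measurable fun q : ι × ℝ => d.U N q.1 := mU.comp measurable_fst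
      have f2 : Measurable fun q : ι × ℝ => t - (d.a N q.1 + d.U N q.1) := by fun_prop
      have f3 : Measurable fun q : ι × ℝ => S (b * N) q.2 := (mS _).comp measurable_snd
      exact (measurableSet_le f1 measurable_const).inter (measurableSet_lt f2 f3)
    have mU' : MeasurableSet {s | d.U N s ≤ M} := measurableSet_le mU measurable_const
    refine (measure_mono_ae sub).trans ((measure_union_le _ _).trans ?_)
    rw [Measure.prod_prod, measure_univ, mul_one, ← hp, Measure.prod_apply ms]
    have h4 : ∫⁻ s, m (Prod.mk s ⁻¹' {q : ι × ℝ | d.U N q.1 ≤ M ∧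
        t - (d.a N q.1 + d.U N q.1) < S (b * N) q.2}) ∂(d.P N) ≤
        ∫⁻ s in {s | d.U N s ≤ M}, (b * p + ENNReal.ofReal (Real.exp (-(l * t))) * W ^ b *
          ENNReal.ofReal (Real.exp (l * (d.a N s + d.U N s)))) ∂(d.P N) := by
      rw [← lintegral_indicator mU']
      apply lintegral_mono
      intro s
      by_cases h : d.U N s ≤ M
      · rw [indicator_of_mem (by exact h)]
        have e : (Prod.mk s ⁻¹' {q : ι × ℝ | d.U N q.1 ≤ M ∧
          t - (d.a N q.1 + d.U N q.1) < S (b * N) q.2}) =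
          {x | t - (d.a N s + d.U N s) < S (b * N) x} := by
          ext x; simp [h]
        dsimp only
        rw [e]
        refine (ih _).trans ?_
        have e2 : Real.exp (-(l * (t - (d.a N s + d.U N s)))) =
          Real.exp (-(l * t)) * Real.exp (l * (d.a N s + d.U N s)) := by
          rw [← Real.exp_add]; congr 1; ring
        rw [e2, ENNReal.ofReal_mul (Real.exp_pos _).le]
        apply le_of_eq
        ring
      · rw [indicator_of_notMem (by exact h)]
        have e : (Prod.mk s ⁻¹' {q : ι × ℝ | d.U N q.1 ≤ M ∧
          t - (d.a N q.1 + d.U N q.1) < S (b * N) q.2}) = ∅ := by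
          ext x; simp [h]
        dsimp only
        rw [e]; simp
    have h5 : ∫⁻ s in {s | d.U N s ≤ M}, (b * p + ENNReal.ofReal (Real.exp (-(l * t))) * W ^ b *
          ENNReal.ofReal (Real.exp (l * (d.a N s + d.U N s)))) ∂(d.P N) ≤
        b * p + ENNReal.ofReal (Real.exp (-(l * t))) * W ^ b * W := by
      rw [lintegral_add_left measurable_const, lintegral_const_mul
        (ENNReal.ofReal (Real.exp (-(l * t))) * W ^ b)
        (f := fun s => ENNReal.ofReal (Real.exp (l * (d.a N s + d.U N s)))) (by fun_prop), ← hW,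
        lintegral_const]
      refine add_le_add ?_ le_rfl
      have h6 : ((d.P N).restrict {s | d.U N s ≤ M}) univ ≤ 1 := by
        rw [Measure.restrict_apply_univ]; exact prob_le_one
      exact (mul_le_mul_right h6 (b * p)).trans (le_of_eq (mul_one _))
    calc _ ≤ p + (b * p + ENNReal.ofReal (Real.exp (-(l * t))) * W ^ b * W) := by
          exact add_le_add le_rfl (h4.trans h5)
      _ = _ := by push_cast; ring

set_option maxHeartbeats 1000000 in
lemma W_bound (w B : ℝ) (hB0 : 0 ≤ B)
    (h1 : ∀ n : ℕ, |∫ x, d.a n x ∂(d.P n)| ≤ B)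
    (h2 : ∀ n : ℕ, |∫ x, d.a n x ^ 2 ∂(d.P n) - w ^ 2 * n| ≤ B * (√n + 1))
    (h3 : ∀ n : ℕ, ∫ x, |d.a n x| ^ 3 ∂(d.P n) ≤ B * (√n + 1) ^ 3) :
    ∃ B1 : ℝ, 0 ≤ B1 ∧ ∀ (N : ℕ) (M l K : ℝ), 0 ≤ M → 0 ≤ l → l * (C * N) ≤ K →
      l * M ^ (1 - γ) ≤ c / 4 → 
    (∫⁻ s in {s | d.U N s ≤ M}, ENNReal.ofReal (Real.exp (l * (d.a N s + d.U N s))) ∂(d.P N)) ≤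
     ENNReal.ofReal (Real.exp (l * B1 + l ^ 2 * w ^ 2 * N / 2 + 
      Real.exp K * B1 * (l ^ 2 * (√N + 1) + (l * (√N + 1)) ^ 3) + l ^ 2 * B1 * (√N + 1))) := by
  obtain ⟨A1, hA10, hA1⟩ := pow_le_exp d.hγ.1 (show 0 < 3 / 4 * c by linarith [d.hc]) 1
  obtain ⟨A2, hA20, hA2⟩ := pow_le_exp d.hγ.1 (show 0 < 1 / 2 * c by linarith [d.hc]) 2
  have hC := d.hC
  refine ⟨B + A1 * C + A2 * C + w ^ 2, by positivity, fun N M l K hM hl hK hM2 => ?_⟩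
  have := d.hP N
  have mU := d.hU N
  have hγ := d.hγ
  have hγ0 := hγ.1
  have hγ1 := hγ.2
  -- V
  set V : ι → ℝ := fun s => d.U N s * Real.exp (c / 4 * d.U N s ^ γ) with hV
  have hV0 : ∀ s, 0 ≤ V s := fun s => mul_nonneg (d.hU0 N s) (Real.exp_pos _).le
  have V1 : Integrable V (d.P N) ∧ ∫ s, V s ∂(d.P N) ≤ A1 * C := by
    refine int_bound (d.P N) (d.U N) mU (d.hU0 N) γ c C hC (d.hUi N)
      (fun u => u * Real.exp (c / 4 * u ^ γ)) (by fun_prop) A1 fun u hu => ⟨by positivity, ?_⟩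
    have := hA1 u hu
    rw [pow_one] at this
    calc u * Real.exp (c / 4 * u ^ γ) ≤ A1 * Real.exp (3 / 4 * c * u ^ γ) *
          Real.exp (c / 4 * u ^ γ) := by gcongr
      _ = _ := by rw [mul_assoc, ← Real.exp_add]; congr 2; ring
  have V2 : Integrable (fun s => V s ^ 2) (d.P N) ∧ ∫ s, V s ^ 2 ∂(d.P N) ≤ A2 * C := by
    refine int_bound (d.P N) (d.U N) mU (d.hU0 N) γ c C hC (d.hUi N)
      (fun u => (u * Real.exp (c / 4 * u ^ γ)) ^ 2) (by fun_prop) A2 fun u hu => ⟨by positivity, ?_⟩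
    have := hA2 u hu
    calc (u * Real.exp (c / 4 * u ^ γ)) ^ 2 = u ^ 2 * Real.exp (c / 2 * u ^ γ) := by
          rw [mul_pow, ← Real.exp_nat_mul]; congr 2; push_cast; ring
      _ ≤ A2 * Real.exp (1 / 2 * c * u ^ γ) * Real.exp (c / 2 * u ^ γ) := by gcongr
      _ = _ := by rw [mul_assoc, ← Real.exp_add]; congr 2; ring
  set z : ℝ := √(N : ℝ) + 1 with hz
  have hz1 : 1 ≤ z := by have := Real.sqrt_nonneg (N : ℝ); linarith
  have hzN : (N : ℝ) ≤ z ^ 2 := by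
    have := Real.sqrt_nonneg (N : ℝ)
    have := Real.sq_sqrt (Nat.cast_nonneg N : (0 : ℝ) ≤ N)
    nlinarith
  have a1 : Integrable (fun x => d.a N x) (d.P N) := by simpa using d.a_int N 1
  set eK := Real.exp K with heK
  have heK0 : 0 < eK := Real.exp_pos _
  -- dominating function
  set H : ι → ℝ := fun s => (1 + l * d.a N s + l ^ 2 / 2 * d.a N s ^ 2 + eK * l ^ 3 * |d.a N s| ^ 3) +
    l * V s + eK * l ^ 2 / 2 * (d.a N s ^ 2 / z) + eK * l ^ 2 / 2 * (V s ^ 2 * z) with hH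
  have habs : ∀ s, |l * d.a N s| ≤ K := fun s => by
    rw [abs_mul, abs_of_nonneg hl]
    refine le_trans ?_ hK
    gcongr; exact d.haB N s
  have e3 : ∀ s, |l * d.a N s| ^ 3 = l ^ 3 * |d.a N s| ^ 3 := fun s => by
    rw [abs_mul, abs_of_nonneg hl, mul_pow]
  have dom : ∀ s, d.U N s ≤ M → Real.exp (l * (d.a N s + d.U N s)) ≤ H s := by
    intro s hs
    have hu := d.hU0 N s
    have g1 := real_exp_taylor _ _ (habs s)
    have g2 := real_exp_one _ _ (habs s)
    rw [e3] at g1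
    have lu : l * d.U N s ≤ c / 4 * d.U N s ^ γ := by
      rcases hu.eq_or_lt with h | h
      · rw [← h, mul_zero]; have := d.hc; positivity
      · have : d.U N s = d.U N s ^ (1 - γ) * d.U N s ^ γ := by
          rw [← Real.rpow_add h]; simp
        calc l * d.U N s = l * d.U N s ^ (1 - γ) * d.U N s ^ γ := by rw [mul_assoc, ← this]
          _ ≤ l * M ^ (1 - γ) * d.U N s ^ γ := by
            gcongr
          _ ≤ _ := by gcongr
    have g3 : Real.exp (l * d.U N s) - 1 ≤ l * V s := by
      have h4 := Real.add_one_le_exp (-(l * d.U N s))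
      have h5 : Real.exp (-(l * d.U N s)) * Real.exp (l * d.U N s) = 1 := by
        rw [← Real.exp_add]; simp
      have h6 : Real.exp (l * d.U N s) ≤ Real.exp (c / 4 * d.U N s ^ γ) := Real.exp_le_exp.2 lu
      have h7 := Real.exp_pos (l * d.U N s)
      have h8 : l * d.U N s * Real.exp (l * d.U N s) ≤ l * V s := by
        rw [hV, mul_assoc]; dsimp only; gcongr
      nlinarith
    have g4 : Real.exp (l * (d.a N s + d.U N s)) = Real.exp (l * d.a N s) +
        Real.exp (l * d.a N s) * (Real.exp (l * d.U N s) - 1) := by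
      rw [mul_add, Real.exp_add]; ring
    have g5 : Real.exp (l * d.a N s) * (Real.exp (l * d.U N s) - 1) ≤
        (1 + eK * |l * d.a N s|) * (l * V s) := by
      have : 0 ≤ Real.exp (l * d.U N s) - 1 := by
        have := Real.one_le_exp (mul_nonneg hl hu); linarith
      exact mul_le_mul g2 g3 this (by positivity)
    have g6 : |d.a N s| * V s ≤ 1 / 2 * (d.a N s ^ 2 / z) + 1 / 2 * (V s ^ 2 * z) := by
      have hzz : z * (1 / z) = 1 := by field_simp
      have e : d.a N s ^ 2 / z = |d.a N s| ^ 2 * (1 / z) := by rw [sq_abs]; ring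
      rw [e]
      have : 0 ≤ (|d.a N s| - V s * z) ^ 2 * (1 / z) := by positivity
      have e5 : (|d.a N s| - V s * z) ^ 2 * (1 / z) = |d.a N s| ^ 2 * (1 / z) -
        2 * |d.a N s| * V s * (z * (1 / z)) + V s ^ 2 * z * (z * (1 / z)) := by ring
      rw [e5, hzz] at this
      linarith
    have g7 : (1 + eK * |l * d.a N s|) * (l * V s) ≤ l * V s + eK * l ^ 2 / 2 * (d.a N s ^ 2 / z) +
        eK * l ^ 2 / 2 * (V s ^ 2 * z) := by
      rw [abs_mul, abs_of_nonneg hl]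
      have h9 : eK * l ^ 2 * (|d.a N s| * V s) ≤
        eK * l ^ 2 * (1 / 2 * (d.a N s ^ 2 / z) + 1 / 2 * (V s ^ 2 * z)) := by gcongr
      linarith
    rw [g4, hH]
    dsimp only
    have e9 : (l * d.a N s) ^ 2 / 2 = l ^ 2 / 2 * d.a N s ^ 2 := by ring
    rw [e9] at g1
    linarith
  have j1 : Integrable (fun s => 1 + l * d.a N s) (d.P N) := (integrable_const _).add (a1.const_mul l)
  have j2 : Integrable (fun s => l ^ 2 / 2 * d.a N s ^ 2) (d.P N) := (d.a_int N 2).const_mul _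
  have j3 : Integrable (fun s => eK * l ^ 3 * |d.a N s| ^ 3) (d.P N) :=
    (d.a_int_abs N 3).const_mul _
  have j4 : Integrable (fun s => l * V s) (d.P N) := V1.1.const_mul _
  have j5 : Integrable (fun s => eK * l ^ 2 / 2 * (d.a N s ^ 2 / z)) (d.P N) :=
    ((d.a_int N 2).div_const z).const_mul _
  have j6 : Integrable (fun s => eK * l ^ 2 / 2 * (V s ^ 2 * z)) (d.P N) :=
    (V2.1.mul_const z).const_mul _
  have j123 : Integrable (fun s => 1 + l * d.a N s + l ^ 2 / 2 * d.a N s ^ 2 +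
    eK * l ^ 3 * |d.a N s| ^ 3) (d.P N) := (j1.add j2).add j3
  have j14 : Integrable (fun s => (1 + l * d.a N s + l ^ 2 / 2 * d.a N s ^ 2 +
    eK * l ^ 3 * |d.a N s| ^ 3) + l * V s) (d.P N) := j123.add j4
  have j15 : Integrable (fun s => (1 + l * d.a N s + l ^ 2 / 2 * d.a N s ^ 2 +
    eK * l ^ 3 * |d.a N s| ^ 3) + l * V s + eK * l ^ 2 / 2 * (d.a N s ^ 2 / z)) (d.P N) := j14.add j5
  have jH : Integrable H (d.P N) := j15.add j6
  have eH : ∫ s, H s ∂(d.P N) = 1 + l * ∫ s, d.a N s ∂(d.P N) +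
      l ^ 2 / 2 * ∫ s, d.a N s ^ 2 ∂(d.P N) + eK * l ^ 3 * ∫ s, |d.a N s| ^ 3 ∂(d.P N) +
      l * ∫ s, V s ∂(d.P N) + eK * l ^ 2 / 2 * ((∫ s, d.a N s ^ 2 ∂(d.P N)) / z) +
      eK * l ^ 2 / 2 * ((∫ s, V s ^ 2 ∂(d.P N)) * z) := by
    rw [hH, integral_add j15 j6, integral_add j14 j5, integral_add j123 j4,
      integral_add (by exact j1.add j2) j3, integral_add j1 j2,
      integral_add (integrable_const _) (a1.const_mul l)]
    simp only [integral_const_mul, integral_div, integral_mul_const]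
    simp
  have hH0 : ∀ s, 0 ≤ H s := by
    intro s
    have g1 := real_exp_taylor _ _ (habs s)
    rw [e3] at g1
    have e9 : (l * d.a N s) ^ 2 / 2 = l ^ 2 / 2 * d.a N s ^ 2 := by ring
    rw [e9] at g1
    have g2 := Real.exp_pos (l * d.a N s)
    have g3 : 0 ≤ l * V s := mul_nonneg hl (hV0 s)
    have g4 : 0 ≤ eK * l ^ 2 / 2 * (d.a N s ^ 2 / z) := by positivity
    have g5 : 0 ≤ eK * l ^ 2 / 2 * (V s ^ 2 * z) := by positivity
    rw [hH]
    dsimp only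
    linarith
  calc _ ≤ ∫⁻ s in {s | d.U N s ≤ M}, ENNReal.ofReal (H s) ∂(d.P N) := by
        apply setLIntegral_mono_ae' (measurableSet_le mU measurable_const)
        exact ae_of_all _ fun s hs => ENNReal.ofReal_le_ofReal (dom s hs)
    _ ≤ ∫⁻ s, ENNReal.ofReal (H s) ∂(d.P N) := setLIntegral_le_lintegral _ _
    _ = ENNReal.ofReal (∫ s, H s ∂(d.P N)) :=
        (ofReal_integral_eq_lintegral_ofReal jH (ae_of_all _ hH0)).symm
    _ ≤ _ := by
      apply ENNReal.ofReal_le_ofReal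
      rw [eH]
      set B1 := B + A1 * C + A2 * C + w ^ 2 with hB1
      have q0 : 0 ≤ A1 * C := by positivity
      have q1 : 0 ≤ A2 * C := by positivity
      have q2 : 0 ≤ w ^ 2 := by positivity
      have s1 : l * ∫ s, d.a N s ∂(d.P N) ≤ l * B := by
        gcongr; exact (abs_le.1 (h1 N)).2
      have s2' : ∫ s, d.a N s ^ 2 ∂(d.P N) ≤ w ^ 2 * N + B * z := by
        have := (abs_le.1 (h2 N)).2; linarith
      have s2 : l ^ 2 / 2 * ∫ s, d.a N s ^ 2 ∂(d.P N) ≤ l ^ 2 / 2 * (w ^ 2 * N + B * z) := by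
        gcongr
      have s3 : eK * l ^ 3 * ∫ s, |d.a N s| ^ 3 ∂(d.P N) ≤ eK * l ^ 3 * (B * z ^ 3) := by
        gcongr; exact h3 N
      have s4 : l * ∫ s, V s ∂(d.P N) ≤ l * (A1 * C) := by gcongr; exact V1.2
      have s5' : (∫ s, d.a N s ^ 2 ∂(d.P N)) / z ≤ (w ^ 2 + B) * z := by
        rw [div_le_iff₀ (by linarith)]
        refine s2'.trans ?_
        have : B * z ≤ B * z ^ 2 := by gcongr; nlinarith
        have : w ^ 2 * N ≤ w ^ 2 * z ^ 2 := by gcongr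
        nlinarith
      have s5 : eK * l ^ 2 / 2 * ((∫ s, d.a N s ^ 2 ∂(d.P N)) / z) ≤
        eK * l ^ 2 / 2 * ((w ^ 2 + B) * z) := by gcongr
      have s6 : eK * l ^ 2 / 2 * ((∫ s, V s ^ 2 ∂(d.P N)) * z) ≤ eK * l ^ 2 / 2 * ((A2 * C) * z) := by
        gcongr; exact V2.2
      have f1 : l * B + l * (A1 * C) ≤ l * B1 := by
        rw [← mul_add]; gcongr; linarith
      have f2 : l ^ 2 / 2 * (B * z) ≤ l ^ 2 * B1 * z := by
        have : l ^ 2 * (B * z) ≤ l ^ 2 * (B1 * z) := by gcongr; linarith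
        have : 0 ≤ l ^ 2 * (B * z) := by positivity
        linarith
      have f3 : eK * l ^ 3 * (B * z ^ 3) ≤ eK * B1 * (l * z) ^ 3 := by
        have : eK * l ^ 3 * (B * z ^ 3) ≤ eK * l ^ 3 * (B1 * z ^ 3) := by gcongr; linarith
        refine this.trans (le_of_eq (by ring))
      have f4 : eK * l ^ 2 / 2 * ((w ^ 2 + B) * z) + eK * l ^ 2 / 2 * ((A2 * C) * z) ≤
        eK * B1 * (l ^ 2 * z) := by
        have h10 : 0 ≤ eK * l ^ 2 * z := by positivity
        have h11 : eK * l ^ 2 * z * (w ^ 2 + B + A2 * C) ≤ eK * l ^ 2 * z * B1 := by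
          gcongr; linarith
        have h12 : 0 ≤ eK * l ^ 2 * z * (w ^ 2 + B + A2 * C) := by positivity
        nlinarith
      have := Real.add_one_le_exp (l * B1 + l ^ 2 * w ^ 2 * N / 2 +
        eK * B1 * (l ^ 2 * z + (l * z) ^ 3) + l ^ 2 * B1 * z)
      linarith

end Decoup
end S18

namespace S18

structure Scale (γ : ℝ) (α : ℕ → ℝ) : Prop where
  g0 : 0 < γ
  g1 : γ < 1
  pos : ∀ n, 0 < α n
  lim : Tendsto α atTop (nhds 0)
  grow : Tendsto (fun n : ℕ => α n * (n : ℝ) ^ (γ / (2 - γ))) atTop atTop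

noncomputable def Lsc (α : ℕ → ℝ) (n : ℕ) : ℝ := √((n : ℝ) / α n)

namespace Scale
variable {γ : ℝ} {α : ℕ → ℝ} (h : Scale γ α)
include h

omit h in
lemma L_nonneg (n : ℕ) : 0 ≤ Lsc α n := Real.sqrt_nonneg _

lemma L_sq (n : ℕ) : α n * Lsc α n ^ 2 = n := by
  have := h.pos n
  rw [Lsc, Real.sq_sqrt (by positivity)]
  field_simp

lemma ev_le (e : ℝ) (he : 0 < e) : ∀ᶠ n in atTop, α n ≤ e := by
  filter_upwards [h.lim.eventually (gt_mem_nhds he)] with n hn using hn.le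

lemma key_eq (n : ℕ) (hn : 0 < n) :
    α n * Lsc α n ^ γ = (α n * (n : ℝ) ^ (γ / (2 - γ))) ^ (1 - γ / 2) := by
  have := h.pos n
  have g1 := h.g1
  have hn' : (0 : ℝ) < n := by exact_mod_cast hn
  have h2 : (0 : ℝ) < 2 - γ := by linarith
  rw [Lsc, Real.sqrt_eq_rpow, ← Real.rpow_mul (by positivity), Real.div_rpow (by positivity) this.le,
    Real.mul_rpow this.le (by positivity), ← Real.rpow_mul hn'.le]
  have e1 : γ / (2 - γ) * (1 - γ / 2) = 1 / 2 * γ := by field_simp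
  rw [e1, Real.rpow_sub this, Real.rpow_one]
  have e2 : γ / 2 = 1 / 2 * γ := by ring
  rw [e2]
  ring

lemma Lg : Tendsto (fun n => α n * Lsc α n ^ γ) atTop atTop := by
  have h1 := h.g1
  have := (tendsto_rpow_atTop (show 0 < 1 - γ / 2 by linarith)).comp h.grow
  refine this.congr' ?_
  filter_upwards [eventually_gt_atTop 0] with n hn
  exact (h.key_eq n hn).symm

lemma Lge (n : ℕ) (hn : α n ≤ 1) : √(n : ℝ) ≤ Lsc α n := by
  apply Real.sqrt_le_sqrt
  rw [le_div_iff₀ (h.pos n)]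
  have : (0 : ℝ) ≤ n := Nat.cast_nonneg n
  nlinarith

lemma L : Tendsto (Lsc α) atTop atTop := by
  have h1 : Tendsto (fun n : ℕ => √(n : ℝ)) atTop atTop :=
    Real.tendsto_sqrt_atTop.comp tendsto_natCast_atTop_atTop
  refine tendsto_atTop_mono' _ ?_ h1
  filter_upwards [h.ev_le 1 one_pos] with n hn using h.Lge n hn

lemma aL : Tendsto (fun n => α n * Lsc α n) atTop atTop := by
  refine tendsto_atTop_mono' _ ?_ h.Lg
  filter_upwards [h.L.eventually_ge_atTop 1] with n hn
  have := h.pos n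
  gcongr
  calc Lsc α n ^ γ ≤ Lsc α n ^ (1 : ℝ) := Real.rpow_le_rpow_of_exponent_le hn h.g1.le
    _ = _ := Real.rpow_one _

lemma exp_small (D e R : ℝ) (hD : 0 ≤ D) (he : 0 < e) : ∀ᶠ n in atTop,
    D * Real.exp (-(e * Lsc α n ^ γ)) ≤ Real.exp (-(R / α n)) := by
  filter_upwards [h.ev_le 1 one_pos, h.Lg.eventually_ge_atTop ((R + D) / e)] with n h1 h2
  have hp := h.pos n
  rw [div_le_iff₀ he] at h2
  have h3 : D ≤ Real.exp (D / α n) := by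
    have : D ≤ D / α n := by rw [le_div_iff₀ hp]; nlinarith
    linarith [Real.add_one_le_exp (D / α n)]
  calc D * Real.exp (-(e * Lsc α n ^ γ)) ≤ Real.exp (D / α n) * Real.exp (-(e * Lsc α n ^ γ)) := by
        gcongr
    _ = Real.exp (D / α n - e * Lsc α n ^ γ) := by rw [← Real.exp_add]; congr 1
    _ ≤ _ := by
      apply Real.exp_le_exp.2
      have : e * Lsc α n ^ γ = (α n * Lsc α n ^ γ * e) / α n := by field_simp
      rw [this, ← sub_div, ← neg_div]
      gcongr
      linarith

/-- constants are negligible on the exponential scale -/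
lemma exp_two (e : ℝ) (he : 0 < e) (D : ℝ) (hD : 0 ≤ D) : ∀ᶠ n in atTop, D ≤ Real.exp (e / α n) := by
  filter_upwards [h.ev_le (e / (D + 1)) (by positivity)] with n h1
  have hp := h.pos n
  rw [le_div_iff₀ (by positivity)] at h1
  have : D + 1 ≤ e / α n := by rw [le_div_iff₀ hp]; linarith
  linarith [Real.add_one_le_exp (e / α n)]

end Scale

namespace Decoup
variable {ι κ : Type} [MeasurableSpace ι] [MeasurableSpace κ] {m ν : Measure ℝ}
    {S : ℕ → ℝ → ℝ} {γ c C : ℝ} (d : Decoup ι κ m ν S γ c C)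
include d

lemma tail_P (α : ℕ → ℝ) (h : Scale γ α) : ∃ A : ℝ, 0 ≤ A ∧ ∀ n b N : ℕ, α n ≤ 1 → b ≤ n →
    (b : ENNReal) * d.P N {s | Lsc α n < d.U N s} ≤
      ENNReal.ofReal (A * Real.exp (-(c / 2 * Lsc α n ^ γ))) := by
  have hc := d.hc
  have hC := d.hC
  obtain ⟨A, hA0, hA⟩ := pow_le_exp d.hγ.1 (show 0 < c / 2 by linarith) 2
  refine ⟨A * C, by positivity, fun n b N hα hb => ?_⟩
  have h1 := tail_bound (d.P N) (d.U N) (d.hU N) γ c C d.hγ.1 hc (d.hUi N) (Lsc α n) (Scale.L_nonneg n)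
  have h2 : (b : ℝ) ≤ A * Real.exp (c / 2 * Lsc α n ^ γ) := by
    refine le_trans ?_ (hA _ (Scale.L_nonneg n))
    have h3 := h.L_sq n
    have h4 : (b : ℝ) ≤ n := by exact_mod_cast hb
    have := h.pos n
    nlinarith [sq_nonneg (Lsc α n)]
  calc (b : ENNReal) * d.P N {s | Lsc α n < d.U N s} ≤
        ENNReal.ofReal (b : ℝ) * ENNReal.ofReal (C * Real.exp (-(c * Lsc α n ^ γ))) := by
        rw [ENNReal.ofReal_natCast]; gcongr
    _ = ENNReal.ofReal (b * (C * Real.exp (-(c * Lsc α n ^ γ)))) := by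
        rw [← ENNReal.ofReal_mul (by positivity)]
    _ ≤ _ := by
      apply ENNReal.ofReal_le_ofReal
      calc (b : ℝ) * (C * Real.exp (-(c * Lsc α n ^ γ))) ≤
          A * Real.exp (c / 2 * Lsc α n ^ γ) * (C * Real.exp (-(c * Lsc α n ^ γ))) := by gcongr
        _ = A * C * (Real.exp (c / 2 * Lsc α n ^ γ) * Real.exp (-(c * Lsc α n ^ γ))) := by ring
        _ = _ := by rw [← Real.exp_add]; congr 2; ring

set_option maxHeartbeats 2000000 in
lemma upper_m (w B : ℝ) (hB0 : 0 ≤ B)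
    (h1 : ∀ n : ℕ, |∫ x, d.a n x ∂(d.P n)| ≤ B)
    (h2 : ∀ n : ℕ, |∫ x, d.a n x ^ 2 ∂(d.P n) - w ^ 2 * n| ≤ B * (√n + 1))
    (h3 : ∀ n : ℕ, ∫ x, |d.a n x| ^ 3 ∂(d.P n) ≤ B * (√n + 1) ^ 3)
    (α : ℕ → ℝ) (h : Scale γ α) (θ x e : ℝ) (hθ : 0 < θ) (he : 0 < e) :
    ∀ᶠ n in atTop, m {y | x * Lsc α n < S n y} ≤
      ENNReal.ofReal (Real.exp ((-(θ * x) + θ ^ 2 * w ^ 2 / 2 + e) / α n)) := by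
  obtain ⟨B1, hB1, W⟩ := d.W_bound w B hB0 h1 h2 h3
  obtain ⟨A, hA, tl⟩ := d.tail_P α h
  have hC := d.hC
  have hc := d.hc
  have hw : 0 ≤ w ^ 2 := sq_nonneg w
  -- choice of K
  obtain ⟨K, hK, hKe⟩ : ∃ K : ℝ, 0 < K ∧ θ ^ 2 * B1 / K ≤ e / 4 := by
    refine ⟨4 * θ ^ 2 * (B1 + 1) / e, by positivity, ?_⟩
    rw [div_le_iff₀ (by positivity)]
    field_simp
    nlinarith
  set eK := Real.exp (C * (K + 1)) with heK
  have heK0 : 0 < eK := Real.exp_pos _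
  set D := θ ^ 2 * (eK * B1 * (2 + 8 * (K + 1)) + 2 * B1) with hD
  have hD0 : 0 ≤ D := by positivity
  have evL : ∀ᶠ n in atTop, θ / (α n * Lsc α n) ≤ 1 := by
    filter_upwards [h.aL.eventually_ge_atTop θ, h.aL.eventually_gt_atTop 0] with n h1 h2
    rw [div_le_one h2]; exact h1
  -- √(K / l) large
  have evN : ∀ᶠ n in atTop, D / √(K / (θ / (α n * Lsc α n))) ≤ e / 4 := by
    have t1 : Tendsto (fun n => √(K / (θ / (α n * Lsc α n)))) atTop atTop := by
      refine Real.tendsto_sqrt_atTop.comp ?_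
      have : Tendsto (fun n => (K / θ) * (α n * Lsc α n)) atTop atTop :=
        h.aL.const_mul_atTop (by positivity)
      refine this.congr' ?_
      filter_upwards [h.aL.eventually_gt_atTop 0] with n h2
      field_simp
    have t2 : Tendsto (fun n => D / √(K / (θ / (α n * Lsc α n)))) atTop (nhds 0) :=
      tendsto_const_nhds.div_atTop t1
    filter_upwards [t2.eventually (gt_mem_nhds (show 0 < e / 4 by positivity))] with n hn using hn.le
  have evM : ∀ᶠ n in atTop, θ / (α n * Lsc α n) * Lsc α n ^ (1 - γ) ≤ c / 4 := by
    filter_upwards [h.Lg.eventually_ge_atTop (θ / (c / 4)), h.Lg.eventually_gt_atTop 0,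
      h.L.eventually_gt_atTop 0] with n h1 h2 h3
    have e1 : Lsc α n = Lsc α n ^ (1 - γ) * Lsc α n ^ γ := by
      rw [← Real.rpow_add h3]; simp
    have hp := h.pos n
    have h4 : 0 < Lsc α n ^ (1 - γ) := by positivity
    have h5 : 0 < Lsc α n ^ γ := by positivity
    have : θ / (α n * Lsc α n) * Lsc α n ^ (1 - γ) = θ / (α n * Lsc α n ^ γ) := by
      rw [div_mul_eq_mul_div, div_eq_div_iff (by positivity) (by positivity)]
      nth_rewrite 3 [e1]
      ring
    rw [this, div_le_iff₀ h2]
    rw [div_le_iff₀ (by positivity)] at h1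
    linarith
  filter_upwards [h.ev_le 1 one_pos, evL, evN, evM, h.aL.eventually_gt_atTop 0,
    h.ev_le (e / 4 / (C * (K + 1) + 1)) (by positivity),
    h.exp_small (2 * A) (c / 2) (θ * x - θ ^ 2 * w ^ 2 / 2) (by positivity) (by positivity),
    h.exp_two (e / 4) (by positivity) 2 (by norm_num),
    h.exp_two e he 1 (by norm_num)]
    with n a1 a2 a3 a4 a5 a6 a7 a8 a9
  have hp := h.pos n
  set Ln := Lsc α n with hLn
  have hLn0 : 0 < Ln := by
    by_contra hh
    nlinarith
  set l := θ / (α n * Ln) with hl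
  have hl0 : 0 < l := by positivity
  set N := ⌈K / l⌉₊ with hN
  have hNge : K / l ≤ N := Nat.le_ceil _
  have hNpos : 0 < N := Nat.ceil_pos.2 (by positivity)
  have hNr : (0 : ℝ) < N := by exact_mod_cast hNpos
  have hNlt : (N : ℝ) < K / l + 1 := Nat.ceil_lt_add_one (by positivity)
  have hlN : l * N ≤ K + 1 := by
    have : l * (K / l) = K := by field_simp
    nlinarith
  have hlK : K ≤ l * N := by
    rw [div_le_iff₀ hl0] at hNge; linarith
  set b := n / N with hb
  have hbN : b * N ≤ n := Nat.div_mul_le_self n N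
  have hbN2 : n - b * N ≤ N := by
    have := Nat.div_add_mod n N
    have := Nat.mod_lt n hNpos
    rw [← hb] at *
    have : N * b = b * N := mul_comm _ _
    omega
  have hbn : b ≤ n := Nat.div_le_self n N
  have step1 : m {y | x * Ln < S n y} ≤ m {y | x * Ln - C * N < S (b * N) y} := by
    apply measure_mono
    intro y hy
    have q := d.hSL (b * N) (n - b * N) y
    rw [Nat.add_sub_cancel' hbN] at q
    have q2 : C * ((n - b * N : ℕ) : ℝ) ≤ C * N := by
      gcongr
    have q3 := (abs_le.1 q).2
    have q4 : x * Ln < S n y := hy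
    show x * Ln - C * N < S (b * N) y
    linarith
  have step2 := d.upper_ind N Ln l hl0.le b (x * Ln - C * N)
  have step3 := W N Ln l (C * (K + 1)) hLn0.le hl0.le (by nlinarith) a4
  have step4 := tl n b N a1 hbn
  set E := l * B1 + l ^ 2 * w ^ 2 * N / 2 + eK * B1 * (l ^ 2 * (√N + 1) + (l * (√N + 1)) ^ 3) +
    l ^ 2 * B1 * (√N + 1) with hE
  have step5 : m {y | x * Ln < S n y} ≤ ENNReal.ofReal (A * Real.exp (-(c / 2 * Ln ^ γ))) +
      ENNReal.ofReal (Real.exp (-(l * (x * Ln - C * N)))) * (ENNReal.ofReal (Real.exp E)) ^ b := by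
    refine step1.trans (step2.trans (add_le_add step4 ?_))
    gcongr
  rw [← ENNReal.ofReal_pow (Real.exp_pos _).le, ← Real.exp_nat_mul,
    ← ENNReal.ofReal_mul (Real.exp_pos _).le, ← Real.exp_add,
    ← ENNReal.ofReal_add (by positivity) (by positivity)] at step5
  refine step5.trans (ENNReal.ofReal_le_ofReal ?_)
  -- main exponent
  have z0 : 0 < √(N : ℝ) := Real.sqrt_pos.2 hNr
  have zz : √(N : ℝ) * √(N : ℝ) = N := Real.mul_self_sqrt hNr.le
  have z1 : 1 ≤ √(N : ℝ) := by
    rw [Real.one_le_sqrt]; exact_mod_cast hNpos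
  have main : α n * (-(l * (x * Ln - C * N)) + b * E) ≤
      -(θ * x) + θ ^ 2 * w ^ 2 / 2 + 3 * e / 4 := by
    have m1 : α n * (l * (x * Ln)) = θ * x := by
      rw [hl]; field_simp
    have m2 : α n * (l * (C * N)) ≤ e / 4 := by
      have y1 : α n * (l * (C * N)) ≤ α n * (C * (K + 1)) := by
        have : l * (C * N) ≤ C * (K + 1) := by nlinarith
        gcongr
      rw [le_div_iff₀ (by positivity)] at a6
      nlinarith
    have q0 : α n * (l ^ 2 * n) = θ ^ 2 := by
      have := h.L_sq n
      rw [← this, hl, ← hLn]; field_simp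
    have q1 : α n * (l ^ 2 * (b * N)) ≤ θ ^ 2 := by
      rw [← q0]
      have : (b : ℝ) * N ≤ n := by exact_mod_cast hbN
      gcongr
    set X := α n * (l ^ 2 * (b * N)) with hX
    have hX0 : 0 ≤ X := by positivity
    have m3 : α n * (b * (l * B1)) ≤ e / 4 := by
      have : α n * (b * (l * B1)) = X * (B1 / (l * N)) := by
        rw [hX]; field_simp
      rw [this]
      refine le_trans ?_ hKe
      rw [mul_div_assoc]
      gcongr
    have m4 : α n * (b * (l ^ 2 * w ^ 2 * N / 2)) ≤ θ ^ 2 * w ^ 2 / 2 := by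
      have : α n * (b * (l ^ 2 * w ^ 2 * N / 2)) = X * (w ^ 2 / 2) := by rw [hX]; ring
      rw [this, mul_div_assoc]; gcongr
    have m5 : α n * (b * (l ^ 2 * (√N + 1))) ≤ θ ^ 2 * 2 / √N := by
      have : α n * (b * (l ^ 2 * (√N + 1))) = X * ((√N + 1) / N) := by rw [hX]; field_simp
      rw [this, mul_div_assoc]
      refine mul_le_mul q1 ?_ (by positivity) (by positivity)
      rw [div_le_div_iff₀ hNr z0]
      nlinarith
    have m6 : α n * (b * (l * (√N + 1)) ^ 3) ≤ θ ^ 2 * (8 * (K + 1)) / √N := by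
      have : α n * (b * (l * (√N + 1)) ^ 3) = X * (l * (√N + 1) ^ 3 / N) := by
        rw [hX]; field_simp
      rw [this, mul_div_assoc (θ ^ 2)]
      refine mul_le_mul q1 ?_ (by positivity) (by positivity)
      rw [div_le_div_iff₀ hNr z0]
      have y1 : (√(N : ℝ) + 1) ^ 3 ≤ (2 * √N) ^ 3 := by gcongr; linarith
      calc l * (√(N : ℝ) + 1) ^ 3 * √N ≤ l * (2 * √N) ^ 3 * √N := by gcongr
        _ = 8 * l * (√N * √N) * (√N * √N) := by ring
        _ = 8 * (l * N) * N := by rw [zz]; ring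
        _ ≤ _ := by gcongr
    have m7 : D / √N ≤ e / 4 := by
      refine le_trans ?_ a3
      gcongr
    have expand : α n * (-(l * (x * Ln - C * N)) + b * E) = -(α n * (l * (x * Ln))) +
        α n * (l * (C * N)) + α n * (b * (l * B1)) + α n * (b * (l ^ 2 * w ^ 2 * N / 2)) +
        eK * B1 * (α n * (b * (l ^ 2 * (√N + 1))) + α n * (b * (l * (√N + 1)) ^ 3)) +
        B1 * (α n * (b * (l ^ 2 * (√N + 1)))) := by
      rw [hE]; ring
    have m8 : eK * B1 * (α n * (b * (l ^ 2 * (√N + 1))) + α n * (b * (l * (√N + 1)) ^ 3)) ≤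
        eK * B1 * (θ ^ 2 * 2 / √N + θ ^ 2 * (8 * (K + 1)) / √N) := by gcongr
    have m9 : B1 * (α n * (b * (l ^ 2 * (√N + 1)))) ≤ B1 * (θ ^ 2 * 2 / √N) := by gcongr
    have m10 : eK * B1 * (θ ^ 2 * 2 / √N + θ ^ 2 * (8 * (K + 1)) / √N) + B1 * (θ ^ 2 * 2 / √N) =
      D / √N := by rw [hD]; ring
    rw [expand, m1]
    linarith
  have main2 : -(l * (x * Ln - C * N)) + b * E ≤ (-(θ * x) + θ ^ 2 * w ^ 2 / 2 + 3 * e / 4) / α n := by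
    rw [le_div_iff₀ hp]; linarith
  set X := -(θ * x) + θ ^ 2 * w ^ 2 / 2 with hX
  have r1 : -((θ * x - θ ^ 2 * w ^ 2 / 2) / α n) = X / α n := by rw [hX]; ring
  rw [r1] at a7
  have r2 : Real.exp ((X + e) / α n) = Real.exp ((X + 3 * e / 4) / α n) * Real.exp (e / 4 / α n) := by
    rw [← Real.exp_add]; congr 1; ring
  have r3 : Real.exp (X / α n) ≤ Real.exp ((X + 3 * e / 4) / α n) := by
    apply Real.exp_le_exp.2; gcongr; linarith
  have r4 := Real.exp_le_exp.2 main2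
  have r5 := Real.exp_pos ((X + 3 * e / 4) / α n)
  rw [r2]
  nlinarith

end Decoup
end S18

namespace S18
namespace Decoup
variable {ι κ : Type} [MeasurableSpace ι] [MeasurableSpace κ] {m ν : Measure ℝ}
    {S : ℕ → ℝ → ℝ} {γ c C : ℝ} (d : Decoup ι κ m ν S γ c C)

def neg : Decoup ι κ m ν (fun n x => - S n x) γ c C where
  P := d.P
  hP := d.hP
  Γ := d.Γ
  a := fun N s => - d.a N s
  U := d.U
  ha := fun N => (d.ha N).neg
  hU := d.hU
  hΓ := d.hΓ
  hD := fun N => by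
    filter_upwards [d.hD N] with p hp k
    have := hp k
    rw [← abs_neg] at this
    refine le_trans (le_of_eq ?_) this
    congr 1; ring
  haB := fun N s => by rw [abs_neg]; exact d.haB N s
  hU0 := d.hU0
  hUi := d.hUi
  Q := d.Q
  hQ := d.hQ
  Γ' := d.Γ'
  U' := d.U'
  hU' := d.hU'
  hΓ' := d.hΓ'
  hD' := by
    filter_upwards [d.hD'] with p hp k
    have := hp k
    rw [← abs_neg] at this
    refine le_trans (le_of_eq ?_) this
    congr 1; ring
  hU0' := d.hU0'
  hUi' := d.hUi'
  hmν := d.hmν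
  hS := fun n => (d.hS n).neg
  hS0 := fun x => by simp [d.hS0]
  hSL := fun n k x => by
    have := d.hSL n k x
    rw [← abs_neg] at this
    refine le_trans (le_of_eq ?_) this
    congr 1; ring
  hC := d.hC
  hc := d.hc
  hγ := d.hγ
  hm := d.hm
  hν := d.hν

include d

/-- transfer of an upper bound for `m` to `ν` -/
lemma nu_le (α : ℕ → ℝ) (h : Scale γ α) (x δ : ℝ) (hδ : 0 < δ) (n : ℕ) :
    ν {y | x * Lsc α n < S n y} ≤ ENNReal.ofReal (C * Real.exp (-(c * δ ^ γ * Lsc α n ^ γ))) +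
      m {y | (x - δ) * Lsc α n < S n y} := by
  have := d.hm
  have := d.hQ
  have mS := d.hS
  rw [← d.hΓ'.measure_preimage ((measurableSet_lt measurable_const (mS _)).nullMeasurableSet)]
  have sub : ∀ᵐ q ∂(d.Q.prod m), q ∈ d.Γ' ⁻¹' {y | x * Lsc α n < S n y} →
      q ∈ ({s | δ * Lsc α n < d.U' s} ×ˢ univ) ∪ (univ ×ˢ {y | (x - δ) * Lsc α n < S n y}) := by
    filter_upwards [d.hD'] with q hq hq2
    have h3 := hq n
    rw [abs_le] at h3
    have hq3 : x * Lsc α n < S n (d.Γ' q) := hq2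
    by_cases h : δ * Lsc α n < d.U' q.1
    · left; exact ⟨h, trivial⟩
    · right; refine ⟨trivial, ?_⟩
      show (x - δ) * Lsc α n < S n q.2
      linarith
  refine (measure_mono_ae sub).trans ((measure_union_le _ _).trans ?_)
  rw [Measure.prod_prod, Measure.prod_prod, measure_univ, measure_univ, mul_one, one_mul]
  refine add_le_add ?_ le_rfl
  have := tail_bound d.Q d.U' d.hU' γ c C d.hγ.1 d.hc d.hUi' (δ * Lsc α n)
    (mul_nonneg hδ.le (Scale.L_nonneg n))
  rwa [Real.mul_rpow hδ.le (Scale.L_nonneg n), ← mul_assoc] at this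

lemma upper_nu (w B : ℝ) (hw : 0 < w) (hB0 : 0 ≤ B)
    (h1 : ∀ n : ℕ, |∫ x, d.a n x ∂(d.P n)| ≤ B)
    (h2 : ∀ n : ℕ, |∫ x, d.a n x ^ 2 ∂(d.P n) - w ^ 2 * n| ≤ B * (√n + 1))
    (h3 : ∀ n : ℕ, ∫ x, |d.a n x| ^ 3 ∂(d.P n) ≤ B * (√n + 1) ^ 3)
    (α : ℕ → ℝ) (h : Scale γ α) (x e : ℝ) (hx : 0 < x) (he : 0 < e) :
    ∀ᶠ n in atTop, ν {y | x * Lsc α n < S n y} ≤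
      ENNReal.ofReal (Real.exp (-((x ^ 2 / (2 * w ^ 2) - e) / α n))) := by
  set θ := x / w ^ 2 with hθ
  have hθ0 : 0 < θ := by positivity
  set δ := e / (2 * θ) with hδ
  have hδ0 : 0 < δ := by positivity
  have hδθ : θ * δ = e / 2 := by rw [hδ]; field_simp
  have hc := d.hc
  have hC := d.hC
  filter_upwards [d.upper_m w B hB0 h1 h2 h3 α h θ (x - δ) (e / 4) hθ0 (by positivity),
    h.exp_small C (c * δ ^ γ) (x ^ 2 / (2 * w ^ 2) - 3 * e / 4) hC (by positivity),
    h.exp_two (e / 4) (by positivity) 2 (by norm_num)] with n a1 a2 a3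
  refine (d.nu_le α h x δ hδ0 n).trans ((add_le_add (ENNReal.ofReal_le_ofReal a2) a1).trans ?_)
  rw [← ENNReal.ofReal_add (by positivity) (by positivity)]
  apply ENNReal.ofReal_le_ofReal
  have e1 : (-(θ * (x - δ)) + θ ^ 2 * w ^ 2 / 2 + e / 4) / α n =
      -((x ^ 2 / (2 * w ^ 2) - 3 * e / 4) / α n) := by
    have : -(θ * (x - δ)) + θ ^ 2 * w ^ 2 / 2 = -(x ^ 2 / (2 * w ^ 2)) + e / 2 := by
      rw [mul_sub, hδθ, hθ]; field_simp; ring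
    rw [this]; ring
  rw [e1]
  have e2 : Real.exp (-((x ^ 2 / (2 * w ^ 2) - e) / α n)) =
    Real.exp (-((x ^ 2 / (2 * w ^ 2) - 3 * e / 4) / α n)) * Real.exp (e / 4 / α n) := by
    rw [← Real.exp_add]; congr 1; ring
  rw [e2]
  have := Real.exp_pos (-((x ^ 2 / (2 * w ^ 2) - 3 * e / 4) / α n))
  nlinarith

lemma upper_abs (w B : ℝ) (hw : 0 < w) (hB0 : 0 ≤ B)
    (h1 : ∀ n : ℕ, |∫ x, d.a n x ∂(d.P n)| ≤ B)
    (h2 : ∀ n : ℕ, |∫ x, d.a n x ^ 2 ∂(d.P n) - w ^ 2 * n| ≤ B * (√n + 1))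
    (h3 : ∀ n : ℕ, ∫ x, |d.a n x| ^ 3 ∂(d.P n) ≤ B * (√n + 1) ^ 3)
    (α : ℕ → ℝ) (h : Scale γ α) (x e : ℝ) (hx : 0 < x) (he : 0 < e) :
    ∀ᶠ n in atTop, ν {y | x * Lsc α n < |S n y|} ≤
      ENNReal.ofReal (Real.exp (-((x ^ 2 / (2 * w ^ 2) - e) / α n))) := by
  have k2 := d.neg.upper_nu w B hw hB0
    (fun n => by simpa [neg, integral_neg] using h1 n)
    (fun n => by simpa [neg] using h2 n)
    (fun n => by simpa [neg] using h3 n) α h x (e / 2) hx (by positivity)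
  filter_upwards [d.upper_nu w B hw hB0 h1 h2 h3 α h x (e / 2) hx (by positivity), k2,
    h.exp_two (e / 2) (by positivity) 2 (by norm_num)] with n a1 a2 a3
  have e0 : {y | x * Lsc α n < |S n y|} ⊆ {y | x * Lsc α n < S n y} ∪ {y | x * Lsc α n < -S n y} := by
    intro y hy
    rcases lt_abs.1 (show x * Lsc α n < |S n y| from hy) with h | h
    · left; exact h
    · right; exact h
  refine (measure_mono e0).trans ((measure_union_le _ _).trans ((add_le_add a1 a2).trans ?_))
  rw [← ENNReal.ofReal_add (by positivity) (by positivity)]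
  apply ENNReal.ofReal_le_ofReal
  have e2 : Real.exp (-((x ^ 2 / (2 * w ^ 2) - e) / α n)) =
    Real.exp (-((x ^ 2 / (2 * w ^ 2) - e / 2) / α n)) * Real.exp (e / 2 / α n) := by
    rw [← Real.exp_add]; congr 1; ring
  rw [e2]
  have := Real.exp_pos (-((x ^ 2 / (2 * w ^ 2) - e / 2) / α n))
  nlinarith

end Decoup
end S18

namespace S18

lemma gauss_lower (w y : ℝ) (hw : 0 < w) :
    ENNReal.ofReal (2 * ((√(2 * Real.pi * w ^ 2))⁻¹ * Real.exp (-((|y| + 1) ^ 2 / (2 * w ^ 2))))) ≤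
      ProbabilityTheory.gaussianReal 0 (Real.toNNReal (w ^ 2)) (Ioo (y - 1) (y + 1)) := by
  have hv : Real.toNNReal (w ^ 2) ≠ 0 := by
    simp only [ne_eq, Real.toNNReal_eq_zero, not_le]; positivity
  rw [ProbabilityTheory.gaussianReal_apply _ hv]
  set q := (√(2 * Real.pi * w ^ 2))⁻¹ * Real.exp (-((|y| + 1) ^ 2 / (2 * w ^ 2))) with hq
  have hq0 : 0 ≤ q := by positivity
  calc ENNReal.ofReal (2 * q) = ∫⁻ x in Ioo (y - 1) (y + 1), ENNReal.ofReal q := by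
        rw [lintegral_const, Measure.restrict_apply_univ, Real.volume_Ioo,
          ← ENNReal.ofReal_mul hq0]
        congr 1; ring
    _ ≤ _ := by
      apply setLIntegral_mono_ae' measurableSet_Ioo
      refine ae_of_all _ fun x hx => ?_
      rw [ProbabilityTheory.gaussianPDF]
      apply ENNReal.ofReal_le_ofReal
      rw [ProbabilityTheory.gaussianPDFReal, Real.coe_toNNReal _ (sq_nonneg w), hq]
      gcongr
      rw [neg_div]
      apply neg_le_neg
      refine div_le_div_of_nonneg_right ?_ (by positivity)
      rw [sub_zero, ← sq_abs x]
      gcongr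
      have h1 := hx.1
      have h2 := hx.2
      rw [abs_le]
      have := le_abs_self y
      have := neg_abs_le y
      constructor <;> linarith

namespace Decoup
variable {ι κ : Type} [MeasurableSpace ι] [MeasurableSpace κ] {m ν : Measure ℝ}
    {S : ℕ → ℝ → ℝ} {γ c C : ℝ} (d : Decoup ι κ m ν S γ c C)
include d

lemma lower_ind (N : ℕ) (y δ : ℝ) (b : ℕ) :
    (d.P N {s | |d.a N s - y| ≤ δ ∧ d.U N s ≤ δ}) ^ b ≤
      m {x | |S (b * N) x - b * y| ≤ b * (2 * δ)} := by
  have := d.hm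
  have := d.hP N
  have mS := d.hS
  have ma := d.ha N
  have mU := d.hU N
  induction b with
  | zero => simp [d.hS0]
  | succ b ih =>
    have e0 : (b + 1) * N = N + b * N := by ring
    have f1 : Measurable fun x => |S (N + b * N) x - ((b + 1 : ℕ) : ℝ) * y| :=
      ((mS _).sub_const _).abs
    rw [e0, ← (d.hΓ N).measure_preimage
      ((measurableSet_le f1 measurable_const).nullMeasurableSet), pow_succ, mul_comm]
    refine (mul_le_mul_right ih _).trans ?_
    rw [← Measure.prod_prod]
    apply measure_mono_ae
    filter_upwards [d.hD N] with q hq hq2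
    obtain ⟨⟨g1, g2⟩, g3⟩ := hq2
    have g3' : |S (b * N) q.2 - b * y| ≤ b * (2 * δ) := g3
    have h3 := hq (b * N)
    show |S (N + b * N) (d.Γ N q) - ((b + 1 : ℕ) : ℝ) * y| ≤ ((b + 1 : ℕ) : ℝ) * (2 * δ)
    push_cast
    rw [abs_le] at *
    constructor <;> linarith

lemma lower_ev (h0 : ∀ n, ∫ x, S n x ∂ν = 0) (w B : ℝ) (hw : 0 < w) (hB0 : 0 ≤ B)
    (h1 : ∀ n : ℕ, |∫ x, d.a n x ∂(d.P n)| ≤ B)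
    (h2 : ∀ n : ℕ, |∫ x, d.a n x ^ 2 ∂(d.P n) - w ^ 2 * n| ≤ B * (√n + 1))
    (h3 : ∀ n : ℕ, ∫ x, |d.a n x| ^ 3 ∂(d.P n) ≤ B * (√n + 1) ^ 3) (y : ℝ) :
    ∀ᶠ N : ℕ in atTop,
      ENNReal.ofReal ((√(2 * Real.pi * w ^ 2))⁻¹ * Real.exp (-((|y| + 1) ^ 2 / (2 * w ^ 2)))) ≤
      d.P N {s | |d.a N s - y * √N| ≤ √N ∧ d.U N s ≤ √N} := by
  set q := (√(2 * Real.pi * w ^ 2))⁻¹ * Real.exp (-((|y| + 1) ^ 2 / (2 * w ^ 2))) with hq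
  have hq0 : 0 < q := by positivity
  have k1 := (gauss_lower w y hw).trans (d.clt h0 w B hB0 h1 h2 h3 _ isOpen_Ioo)
  have k2 : ENNReal.ofReal (3 / 2 * q) < liminf (fun n : ℕ => d.P n {s | d.a n s / √n ∈ Ioo (y - 1) (y + 1)}) atTop := by
    refine lt_of_lt_of_le ?_ k1
    rw [ENNReal.ofReal_lt_ofReal_iff (by positivity)]; linarith
  have k3 := eventually_lt_of_lt_liminf k2
  have hc := d.hc
  have k4 : ∀ᶠ N : ℕ in atTop, C * Real.exp (-(c * √(N : ℝ) ^ γ)) ≤ q / 2 := by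
    have t1 : Tendsto (fun N : ℕ => c * √(N : ℝ) ^ γ) atTop atTop :=
      ((tendsto_rpow_atTop d.hγ.1).comp
        (Real.tendsto_sqrt_atTop.comp tendsto_natCast_atTop_atTop)).const_mul_atTop hc
    have t2 : Tendsto (fun N : ℕ => C * Real.exp (-(c * √(N : ℝ) ^ γ))) atTop (nhds (C * 0)) :=
      (Real.tendsto_exp_neg_atTop_nhds_zero.comp t1).const_mul C
    rw [mul_zero] at t2
    filter_upwards [t2.eventually (gt_mem_nhds (show 0 < q / 2 by positivity))] with n hn using hn.le
  filter_upwards [k3, k4, eventually_gt_atTop 0] with N a1 a2 a3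
  have hs : 0 < √(N : ℝ) := Real.sqrt_pos.2 (by exact_mod_cast a3)
  have sub : {s | d.a N s / √N ∈ Ioo (y - 1) (y + 1)} ⊆
      {s | |d.a N s - y * √N| ≤ √N ∧ d.U N s ≤ √N} ∪ {s | √N < d.U N s} := by
    intro s hs'
    by_cases hU : √N < d.U N s
    · right; exact hU
    · left
      refine ⟨?_, not_lt.1 hU⟩
      obtain ⟨u1, u2⟩ := hs'
      rw [lt_div_iff₀ hs] at u1
      rw [div_lt_iff₀ hs] at u2
      rw [abs_le]; constructor <;> linarith
  have l1 := (measure_mono sub).trans (measure_union_le (μ := d.P N) _ _)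
  have l2 := (tail_bound (d.P N) (d.U N) (d.hU N) γ c C d.hγ.1 hc (d.hUi N) (√N) hs.le).trans
    (ENNReal.ofReal_le_ofReal a2)
  have l3 := a1.le.trans (l1.trans (add_le_add le_rfl l2))
  have e1 : 3 / 2 * q = q + q / 2 := by ring
  rw [e1, ENNReal.ofReal_add hq0.le (by positivity)] at l3
  exact (ENNReal.add_le_add_iff_right ENNReal.ofReal_ne_top).1 l3

set_option maxHeartbeats 2000000 in
lemma lower_m (h0 : ∀ n, ∫ x, S n x ∂ν = 0) (w B : ℝ) (hw : 0 < w) (hB0 : 0 ≤ B)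
    (h1 : ∀ n : ℕ, |∫ x, d.a n x ∂(d.P n)| ≤ B)
    (h2 : ∀ n : ℕ, |∫ x, d.a n x ^ 2 ∂(d.P n) - w ^ 2 * n| ≤ B * (√n + 1))
    (h3 : ∀ n : ℕ, ∫ x, |d.a n x| ^ 3 ∂(d.P n) ≤ B * (√n + 1) ^ 3)
    (α : ℕ → ℝ) (h : Scale γ α) (x r e : ℝ) (hr : 0 < r) (he : 0 < e) :
    ∀ᶠ n in atTop, ENNReal.ofReal (Real.exp (-((x ^ 2 / (2 * w ^ 2) + e) / α n))) ≤
      m {y | |S n y - x * Lsc α n| ≤ r * Lsc α n} := by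
  have hC := d.hC
  set κ' := Real.log ((√(2 * Real.pi * w ^ 2))⁻¹) with hκ'
  -- choice of K
  obtain ⟨K, hK0, hK1, hK2⟩ : ∃ K : ℝ, 0 < K ∧ K * |κ'| + (|x| + √K) ^ 2 / (2 * w ^ 2) <
      x ^ 2 / (2 * w ^ 2) + e / 2 ∧ √K < r / 8 := by
    have t1 : Tendsto (fun K : ℝ => K * |κ'| + (|x| + √K) ^ 2 / (2 * w ^ 2)) (nhds 0)
        (nhds (0 * |κ'| + (|x| + √0) ^ 2 / (2 * w ^ 2))) := by
      apply Continuous.tendsto (f := fun K : ℝ => K * |κ'| + (|x| + √K) ^ 2 / (2 * w ^ 2))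
      fun_prop
    have t2 : Tendsto (fun K : ℝ => √K) (nhds 0) (nhds (√0)) := Real.continuous_sqrt.tendsto 0
    rw [Real.sqrt_zero] at t2
    rw [Real.sqrt_zero, zero_mul, zero_add, add_zero, sq_abs] at t1
    have l1 := t1.eventually (gt_mem_nhds (show x ^ 2 / (2 * w ^ 2) < x ^ 2 / (2 * w ^ 2) + e / 2 by linarith))
    have l2 := t2.eventually (gt_mem_nhds (show 0 < r / 8 by linarith))
    have l3 : ∀ᶠ K in nhdsWithin (0 : ℝ) (Ioi 0), (0 < K ∧ K * |κ'| + (|x| + √K) ^ 2 / (2 * w ^ 2) <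
      x ^ 2 / (2 * w ^ 2) + e / 2 ∧ √K < r / 8) := by
      filter_upwards [nhdsWithin_le_nhds l1, nhdsWithin_le_nhds l2, self_mem_nhdsWithin] with K a b c
        using ⟨c, a, b⟩
    exact l3.exists
  have sK : 0 < √K := Real.sqrt_pos.2 hK0
  have sKK : √K * √K = K := Real.mul_self_sqrt hK0.le
  set y := x / √K with hy
  set Λ := |κ'| + (|y| + 1) ^ 2 / (2 * w ^ 2) with hΛ
  have hΛ0 : 0 ≤ Λ := by positivity
  have KΛ : K * Λ < x ^ 2 / (2 * w ^ 2) + e / 2 := by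
    refine lt_of_le_of_lt (le_of_eq ?_) hK1
    have : |y| = |x| / √K := by rw [hy, abs_div, abs_of_pos sK]
    have e1 : |x| + √K = √K * (|y| + 1) := by rw [this]; field_simp
    rw [hΛ, e1, mul_pow, sq (√K), sKK]; ring
  have qΛ : Real.exp (-Λ) ≤ (√(2 * Real.pi * w ^ 2))⁻¹ * Real.exp (-((|y| + 1) ^ 2 / (2 * w ^ 2))) := by
    have : Real.exp κ' = (√(2 * Real.pi * w ^ 2))⁻¹ := Real.exp_log (by positivity)
    rw [← this, ← Real.exp_add]
    apply Real.exp_le_exp.2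
    have := neg_abs_le κ'
    rw [hΛ]; linarith
  -- blocks
  set b : ℕ → ℕ := fun n => ⌈K / α n⌉₊ with hb
  set N : ℕ → ℕ := fun n => n / b n with hN
  have bpos : ∀ n, 0 < b n := fun n => Nat.ceil_pos.2 (div_pos hK0 (h.pos n))
  have b1 : ∀ n, K ≤ α n * b n := fun n => by
    have := Nat.le_ceil (K / α n)
    rw [div_le_iff₀ (h.pos n)] at this
    rw [mul_comm]; exact this
  have b2 : ∀ n, α n * b n ≤ K + α n := fun n => by
    have h1 := (Nat.ceil_lt_add_one (div_pos hK0 (h.pos n)).le).le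
    have h2 := h.pos n
    have : α n * (⌈K / α n⌉₊ : ℝ) ≤ α n * (K / α n + 1) := by gcongr
    refine this.trans (le_of_eq ?_)
    field_simp
  have tb : Tendsto (fun n => α n * b n) atTop (nhds K) := by
    refine tendsto_of_tendsto_of_tendsto_of_le_of_le tendsto_const_nhds ?_ b1 b2
    simpa using h.lim.const_add K
  have tan : Tendsto (fun n : ℕ => α n * n) atTop atTop := by
    have : Tendsto (fun n => (α n * Lsc α n) * (α n * Lsc α n)) atTop atTop := h.aL.atTop_mul_atTop₀ h.aL
    refine this.congr fun n => ?_
    rw [← h.L_sq n]; ring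
  have N1 : ∀ n, b n * N n ≤ n := fun n => Nat.mul_div_le n (b n)
  have N2 : ∀ n, n - b n * N n < b n := fun n => by
    have h1 := Nat.div_add_mod n (b n)
    have h2 := Nat.mod_lt n (bpos n)
    have h3 : b n * N n = b n * (n / b n) := rfl
    omega
  have N3 : ∀ n : ℕ, (n : ℝ) - b n ≤ b n * N n := fun n => by
    have h1 := N2 n
    have h2 := N1 n
    have h3 : n ≤ b n * N n + b n := by omega
    have : (n : ℝ) ≤ b n * N n + b n := by exact_mod_cast h3
    linarith
  have tbn : Tendsto (fun n => (b n : ℝ) * N n / n) atTop (nhds 1) := by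
    have t3 : Tendsto (fun n : ℕ => 1 - (α n * b n) / (α n * n)) atTop (nhds (1 - 0)) :=
      (tb.div_atTop tan).const_sub 1
    rw [sub_zero] at t3
    refine tendsto_of_tendsto_of_tendsto_of_le_of_le' t3 tendsto_const_nhds ?_ ?_
    · filter_upwards [eventually_gt_atTop 0] with n hn
      have hn' : (0 : ℝ) < n := by exact_mod_cast hn
      have := h.pos n
      rw [mul_div_mul_left _ _ this.ne', le_div_iff₀ hn', sub_mul, div_mul_cancel₀ _ hn'.ne']
      linarith [N3 n]
    · filter_upwards [eventually_gt_atTop 0] with n hn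
      have hn' : (0 : ℝ) < n := by exact_mod_cast hn
      rw [div_le_one hn']
      exact_mod_cast N1 n
  set ρ : ℕ → ℝ := fun n => √((α n * b n / K) * (b n * N n / n)) with hρ
  have tρ : Tendsto ρ atTop (nhds 1) := by
    have : Tendsto (fun n => (α n * b n / K) * (b n * N n / n)) atTop (nhds (K / K * 1)) :=
      (tb.div_const K).mul tbn
    have := (Real.continuous_sqrt.tendsto _).comp this
    rw [div_self hK0.ne', mul_one, Real.sqrt_one] at this
    exact this
  have eρ : ∀ n, 0 < n → b n * √(N n : ℝ) = ρ n * (√K * Lsc α n) := fun n hn => by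
    have hn' : (0 : ℝ) < n := by exact_mod_cast hn
    have := h.pos n
    have e1 : (b n : ℝ) = √((b n : ℝ) ^ 2) := by rw [Real.sqrt_sq (by positivity)]
    rw [hρ, Lsc, e1]
    dsimp only
    rw [← Real.sqrt_mul (by positivity), ← Real.sqrt_mul (by positivity),
      ← Real.sqrt_mul (by positivity)]
    congr 1
    field_simp
  have tN : Tendsto N atTop atTop := by
    have t4 : Tendsto (fun n => (α n * n) * ((b n * N n / n) / (α n * b n))) atTop atTop :=
      tan.atTop_mul_pos (by positivity) (tbn.div tb hK0.ne')
    have t5 : Tendsto (fun n => (N n : ℝ)) atTop atTop := by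
      refine t4.congr' ?_
      filter_upwards [eventually_gt_atTop 0] with n hn
      have hn' : (0 : ℝ) < n := by exact_mod_cast hn
      have := h.pos n
      have : (0 : ℝ) < b n := by exact_mod_cast bpos n
      field_simp
    exact tendsto_natCast_atTop_iff.1 t5
  have pN := tN.eventually (d.lower_ev h0 w B hw hB0 h1 h2 h3 y)
  have tρ2 : Tendsto (fun n => |x| * |ρ n - 1|) atTop (nhds (|x| * |1 - 1|)) :=
    ((tρ.sub_const 1).abs).const_mul _
  rw [sub_self, abs_zero, mul_zero] at tρ2
  filter_upwards [pN, eventually_gt_atTop 0, tρ.eventually (gt_mem_nhds (show (1 : ℝ) < 2 by norm_num)),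
    tρ2.eventually (gt_mem_nhds (show 0 < r / 4 by positivity)),
    h.aL.eventually_ge_atTop (C * (K + 1) / (r / 4)), h.ev_le 1 one_pos,
    h.ev_le (e / 2 / (Λ + 1)) (by positivity)] with n a1 a2 a3 a4 a5 a6 a7
  have hp := h.pos n
  have l1 := d.lower_ind (N n) (y * √(N n)) (√(N n)) (b n)
  have hL0 := Scale.L_nonneg (α := α) n
  have l2 : m {z | |S (b n * N n) z - b n * (y * √(N n))| ≤ b n * (2 * √(N n))} ≤
      m {y | |S n y - x * Lsc α n| ≤ r * Lsc α n} := by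
    apply measure_mono
    intro z hz
    have hz' : |S (b n * N n) z - b n * (y * √(N n))| ≤ b n * (2 * √(N n)) := hz
    show |S n z - x * Lsc α n| ≤ r * Lsc α n
    have q := d.hSL (b n * N n) (n - b n * N n) z
    rw [Nat.add_sub_cancel' (N1 n)] at q
    have q2 : C * ((n - b n * N n : ℕ) : ℝ) ≤ C * b n := by
      have : ((n - b n * N n : ℕ) : ℝ) ≤ b n := by exact_mod_cast (N2 n).le
      gcongr
    have q3 : C * b n ≤ r / 4 * Lsc α n := by
      rw [div_le_iff₀ (by positivity)] at a5
      have y1 : α n * (C * b n) ≤ C * (K + 1) := by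
        have := b2 n
        nlinarith
      have y2 : α n * (C * b n) ≤ α n * (r / 4 * Lsc α n) := by linarith
      exact le_of_mul_le_mul_left y2 hp
    have q4 : (b n : ℝ) * (y * √(N n)) = x * ρ n * Lsc α n := by
      have := eρ n a2
      calc (b n : ℝ) * (y * √(N n)) = y * (b n * √(N n)) := by ring
        _ = _ := by rw [this, hy]; field_simp
    have q5 : (b n : ℝ) * (2 * √(N n)) ≤ r / 2 * Lsc α n := by
      have := eρ n a2
      calc (b n : ℝ) * (2 * √(N n)) = 2 * (b n * √(N n)) := by ring
        _ = 2 * ρ n * √K * Lsc α n := by rw [this]; ring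
        _ ≤ 2 * 2 * (r / 8) * Lsc α n := by gcongr
        _ = _ := by ring
    have q6 : |x * ρ n * Lsc α n - x * Lsc α n| ≤ r / 4 * Lsc α n := by
      have : x * ρ n * Lsc α n - x * Lsc α n = x * (ρ n - 1) * Lsc α n := by ring
      rw [this, abs_mul, abs_mul, abs_of_nonneg hL0]
      gcongr
    rw [q4] at hz'
    rw [abs_le] at *
    constructor <;> linarith
  refine le_trans ?_ (l1.trans l2)
  have l3 : ENNReal.ofReal (Real.exp (-Λ)) ^ b n ≤
      (d.P (N n) {s | |d.a (N n) s - y * √(N n)| ≤ √(N n) ∧ d.U (N n) s ≤ √(N n)}) ^ b n := by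
    gcongr
    exact (ENNReal.ofReal_le_ofReal qΛ).trans a1
  refine le_trans ?_ l3
  rw [← ENNReal.ofReal_pow (Real.exp_pos _).le, ← Real.exp_nat_mul]
  apply ENNReal.ofReal_le_ofReal
  apply Real.exp_le_exp.2
  rw [mul_neg]
  apply neg_le_neg
  rw [le_div_iff₀ hp]
  have y3 := b2 n
  rw [le_div_iff₀ (by positivity)] at a7
  nlinarith

lemma lower_nu (h0 : ∀ n, ∫ x, S n x ∂ν = 0) (w B : ℝ) (hw : 0 < w) (hB0 : 0 ≤ B)
    (h1 : ∀ n : ℕ, |∫ x, d.a n x ∂(d.P n)| ≤ B)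
    (h2 : ∀ n : ℕ, |∫ x, d.a n x ^ 2 ∂(d.P n) - w ^ 2 * n| ≤ B * (√n + 1))
    (h3 : ∀ n : ℕ, ∫ x, |d.a n x| ^ 3 ∂(d.P n) ≤ B * (√n + 1) ^ 3)
    (α : ℕ → ℝ) (h : Scale γ α) (x r e : ℝ) (hr : 0 < r) (he : 0 < e) :
    ∀ᶠ n in atTop, ENNReal.ofReal (Real.exp (-((x ^ 2 / (2 * w ^ 2) + e) / α n))) ≤
      ν {y | |S n y - x * Lsc α n| ≤ r * Lsc α n} := by
  filter_upwards [d.lower_m h0 w B hw hB0 h1 h2 h3 α h x r (e / 2) hr (by positivity),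
    h.exp_two (e / 2) (by positivity) C d.hC] with n a1 a2
  have k1 : m {y | |S n y - x * Lsc α n| ≤ r * Lsc α n} ≤
    ENNReal.ofReal C * ν {y | |S n y - x * Lsc α n| ≤ r * Lsc α n} := by
    have := d.hmν {y | |S n y - x * Lsc α n| ≤ r * Lsc α n}
    simpa using this
  have k2 := a1.trans (k1.trans (mul_le_mul_left (ENNReal.ofReal_le_ofReal a2) _))
  calc ENNReal.ofReal (Real.exp (-((x ^ 2 / (2 * w ^ 2) + e) / α n)))
      = ENNReal.ofReal (Real.exp (-(e / 2 / α n))) *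
        ENNReal.ofReal (Real.exp (-((x ^ 2 / (2 * w ^ 2) + e / 2) / α n))) := by
        rw [← ENNReal.ofReal_mul (Real.exp_pos _).le, ← Real.exp_add]; congr 2; ring
    _ ≤ ENNReal.ofReal (Real.exp (-(e / 2 / α n))) * (ENNReal.ofReal (Real.exp (e / 2 / α n)) *
        ν {y | |S n y - x * Lsc α n| ≤ r * Lsc α n}) := by gcongr
    _ = _ := by
        rw [← mul_assoc, ← ENNReal.ofReal_mul (Real.exp_pos _).le, ← Real.exp_add]; simp

end Decoup
end S18

namespace S18

lemma log_oexp (x : ℝ) : ENNReal.log (ENNReal.ofReal (Real.exp x)) = (x : EReal) := by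
  rw [ENNReal.log_ofReal_of_pos (Real.exp_pos _), Real.log_exp]

lemma elog_le (a x : ℝ) (ha : 0 < a) (p : ENNReal) (h : p ≤ ENNReal.ofReal (Real.exp (x / a))) :
    (a : EReal) * ENNReal.log p ≤ (x : EReal) := by
  have h1 := ENNReal.log_monotone h
  rw [log_oexp] at h1
  have h2 : (0 : EReal) ≤ a := by exact_mod_cast ha.le
  refine (mul_le_mul_of_nonneg_left h1 h2).trans (le_of_eq ?_)
  rw [← EReal.coe_mul]
  congr 1; field_simp

lemma le_elog (a x : ℝ) (ha : 0 < a) (p : ENNReal) (h : ENNReal.ofReal (Real.exp (x / a)) ≤ p) :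
    (x : EReal) ≤ (a : EReal) * ENNReal.log p := by
  have h1 := ENNReal.log_monotone h
  rw [log_oexp] at h1
  have h2 : (0 : EReal) ≤ a := by exact_mod_cast ha.le
  refine le_trans (le_of_eq ?_) (mul_le_mul_of_nonneg_left h1 h2)
  rw [← EReal.coe_mul]
  congr 1; field_simp

namespace Decoup
variable {ι κ : Type} [MeasurableSpace ι] [MeasurableSpace κ] {m ν : Measure ℝ}
    {S : ℕ → ℝ → ℝ} {γ c C : ℝ} (d : Decoup ι κ m ν S γ c C)
include d

lemma mdp_lower (h0 : ∀ n, ∫ x, S n x ∂ν = 0) (w B : ℝ) (hw : 0 < w) (hB0 : 0 ≤ B)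
    (h1 : ∀ n : ℕ, |∫ x, d.a n x ∂(d.P n)| ≤ B)
    (h2 : ∀ n : ℕ, |∫ x, d.a n x ^ 2 ∂(d.P n) - w ^ 2 * n| ≤ B * (√n + 1))
    (h3 : ∀ n : ℕ, ∫ x, |d.a n x| ^ 3 ∂(d.P n) ≤ B * (√n + 1) ^ 3)
    (α : ℕ → ℝ) (h : Scale γ α) (A : Set ℝ) :
    -(⨅ t ∈ interior A, ((t ^ 2 / (2 * w ^ 2) : ℝ) : EReal)) ≤
      liminf (fun n : ℕ => ((α n : ℝ) : EReal) *
        ENNReal.log (ν {x | Real.sqrt (α n / n) * S n x ∈ A})) atTop := by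
  rw [EReal.neg_le]
  refine le_iInf₂ fun t ht => ?_
  rw [EReal.neg_le, ← EReal.coe_neg]
  obtain ⟨r, hr, hr2⟩ := Metric.isOpen_iff.1 isOpen_interior t ht
  have key : ∀ e : ℝ, 0 < e → ((-(t ^ 2 / (2 * w ^ 2) + e) : ℝ) : EReal) ≤
      liminf (fun n : ℕ => ((α n : ℝ) : EReal) *
        ENNReal.log (ν {x | Real.sqrt (α n / n) * S n x ∈ A})) atTop := by
    intro e he
    refine le_liminf_of_le (by isBoundedDefault) ?_
    filter_upwards [d.lower_nu h0 w B hw hB0 h1 h2 h3 α h t (r / 2) e (by positivity) he,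
      eventually_gt_atTop 0] with n a1 a2
    have hp := h.pos n
    have hn : (0 : ℝ) < n := by exact_mod_cast a2
    apply le_elog _ _ hp
    rw [neg_div]
    refine a1.trans (measure_mono ?_)
    intro y hy
    have hy' : |S n y - t * Lsc α n| ≤ r / 2 * Lsc α n := hy
    show √(α n / n) * S n y ∈ A
    apply interior_subset
    apply hr2
    rw [Metric.mem_ball, Real.dist_eq]
    have e1 : √(α n / n) * Lsc α n = 1 := by
      rw [Lsc, ← Real.sqrt_mul (by positivity)]
      have : α n / n * (n / α n) = 1 := by field_simp
      rw [this, Real.sqrt_one]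
    have e2 : √(α n / n) * S n y - t = √(α n / n) * (S n y - t * Lsc α n) := by
      rw [mul_sub]
      linear_combination t * e1
    rw [e2, abs_mul, abs_of_nonneg (Real.sqrt_nonneg _)]
    calc √(α n / n) * |S n y - t * Lsc α n| ≤ √(α n / n) * (r / 2 * Lsc α n) := by gcongr
      _ = r / 2 := by linear_combination (r / 2) * e1
      _ < r := by linarith
  have t1 : Tendsto (fun e : ℝ => ((-(t ^ 2 / (2 * w ^ 2) + e) : ℝ) : EReal)) (nhdsWithin 0 (Ioi 0))
      (nhds ((-(t ^ 2 / (2 * w ^ 2) + 0) : ℝ) : EReal)) := by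
    apply Tendsto.mono_left _ nhdsWithin_le_nhds
    refine (continuous_coe_real_ereal.tendsto _).comp ?_
    exact (tendsto_id.const_add _).neg
  rw [add_zero] at t1
  refine le_of_tendsto t1 ?_
  filter_upwards [self_mem_nhdsWithin] with e he using key e he

lemma mdp_upper (w B : ℝ) (hw : 0 < w) (hB0 : 0 ≤ B)
    (h1 : ∀ n : ℕ, |∫ x, d.a n x ∂(d.P n)| ≤ B)
    (h2 : ∀ n : ℕ, |∫ x, d.a n x ^ 2 ∂(d.P n) - w ^ 2 * n| ≤ B * (√n + 1))
    (h3 : ∀ n : ℕ, ∫ x, |d.a n x| ^ 3 ∂(d.P n) ≤ B * (√n + 1) ^ 3)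
    (α : ℕ → ℝ) (h : Scale γ α) (A : Set ℝ) :
      limsup (fun n : ℕ => ((α n : ℝ) : EReal) *
        ENNReal.log (ν {x | Real.sqrt (α n / n) * S n x ∈ A})) atTop ≤ 
    -(⨅ t ∈ closure A, ((t ^ 2 / (2 * w ^ 2) : ℝ) : EReal)) := by
  have := d.hν
  rcases (closure A).eq_empty_or_nonempty with hA | hA
  · rw [closure_empty_iff] at hA
    have : ∀ n, ((α n : ℝ) : EReal) * ENNReal.log (ν {x | Real.sqrt (α n / n) * S n x ∈ A}) = ⊥ := by
      intro n
      rw [hA]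
      simp [EReal.coe_mul_bot_of_pos (h.pos n)]
    simp only [this, limsup_const, bot_le]
  obtain ⟨t, ht, ht2⟩ := isClosed_closure.exists_infDist_eq_dist hA (0 : ℝ)
  have hmin : ∀ s ∈ A, |t| ≤ |s| := by
    intro s hs
    have := Metric.infDist_le_dist_of_mem (x := (0 : ℝ)) (subset_closure hs)
    rw [ht2, dist_comm, dist_comm 0 s, Real.dist_0_eq_abs, Real.dist_0_eq_abs] at this
    exact this
  have h5 : -((t ^ 2 / (2 * w ^ 2) : ℝ) : EReal) ≤
      -(⨅ t ∈ closure A, ((t ^ 2 / (2 * w ^ 2) : ℝ) : EReal)) := by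
    rw [EReal.neg_le_neg_iff]
    exact iInf₂_le t ht
  refine le_trans ?_ h5
  rw [← EReal.coe_neg]
  by_cases ht0 : t = 0
  · refine limsup_le_of_le (by isBoundedDefault) (Eventually.of_forall fun n => ?_)
    apply elog_le _ _ (h.pos n)
    rw [ht0]
    simp [prob_le_one]
  have htp : 0 < |t| := abs_pos.2 ht0
  have key : ∀ e : ℝ, 0 < e → e < 1 → limsup (fun n : ℕ => ((α n : ℝ) : EReal) *
        ENNReal.log (ν {x | Real.sqrt (α n / n) * S n x ∈ A})) atTop ≤
          ((-((|t| * (1 - e)) ^ 2 / (2 * w ^ 2) - e) : ℝ) : EReal) := by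
    intro e he he1
    refine limsup_le_of_le (by isBoundedDefault) ?_
    have h6 : 0 < |t| * (1 - e) := mul_pos htp (by linarith)
    filter_upwards [d.upper_abs w B hw hB0 h1 h2 h3 α h (|t| * (1 - e)) e h6 he,
      eventually_gt_atTop 0] with n a1 a2
    have hp := h.pos n
    have hn : (0 : ℝ) < n := by exact_mod_cast a2
    apply elog_le _ _ hp
    rw [neg_div]
    refine le_trans (measure_mono ?_) a1
    intro y hy
    have hy' := hmin _ hy
    show |t| * (1 - e) * Lsc α n < |S n y|
    have hL : 0 < Lsc α n := Real.sqrt_pos.2 (by positivity)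
    have e1 : √(α n / n) * Lsc α n = 1 := by
      rw [Lsc, ← Real.sqrt_mul (by positivity)]
      have : α n / n * (n / α n) = 1 := by field_simp
      rw [this, Real.sqrt_one]
    rw [abs_mul, abs_of_nonneg (Real.sqrt_nonneg _)] at hy'
    have e2 : |t| * Lsc α n ≤ |S n y| := by
      have := mul_le_mul_of_nonneg_right hy' hL.le
      calc _ ≤ _ := this
        _ = _ := by linear_combination (|S n y|) * e1
    have : 0 < |t| * e * Lsc α n := by positivity
    linarith
  have t1 : Tendsto (fun e : ℝ => ((-((|t| * (1 - e)) ^ 2 / (2 * w ^ 2) - e) : ℝ) : EReal))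
      (nhdsWithin 0 (Ioi 0)) (nhds ((-((|t| * (1 - 0)) ^ 2 / (2 * w ^ 2) - 0) : ℝ) : EReal)) := by
    apply Tendsto.mono_left _ nhdsWithin_le_nhds
    refine (continuous_coe_real_ereal.tendsto _).comp ?_
    apply Continuous.tendsto (f := fun e : ℝ => (-((|t| * (1 - e)) ^ 2 / (2 * w ^ 2) - e) : ℝ))
    fun_prop
  rw [sub_zero, sub_zero, mul_one, sq_abs] at t1
  refine ge_of_tendsto t1 ?_
  filter_upwards [self_mem_nhdsWithin, nhdsWithin_le_nhds (gt_mem_nhds (show (0 : ℝ) < 1 by norm_num))]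
    with e he he1 using key e he he1

theorem mdp (h0 : ∀ n, ∫ x, S n x ∂ν = 0)
    (hdiv : Tendsto (fun n => ∫ x, S n x ^ 2 ∂ν) atTop atTop) :
    ∃ σ2 : ℝ, 0 < σ2 ∧ Tendsto (fun n : ℕ => (∫ x, S n x ^ 2 ∂ν) / n) atTop (nhds σ2) ∧
      ∀ α : ℕ → ℝ, Scale γ α → ∀ A : Set ℝ,
        (-(⨅ t ∈ interior A, ((t ^ 2 / (2 * σ2) : ℝ) : EReal)) ≤
          liminf (fun n : ℕ => ((α n : ℝ) : EReal) *
            ENNReal.log (ν {x | Real.sqrt (α n / n) * S n x ∈ A})) atTop) ∧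
        (limsup (fun n : ℕ => ((α n : ℝ) : EReal) *
          ENNReal.log (ν {x | Real.sqrt (α n / n) * S n x ∈ A})) atTop ≤ 
        -(⨅ t ∈ closure A, ((t ^ 2 / (2 * σ2) : ℝ) : EReal))) := by
  obtain ⟨w, B, hw, hB0, hv, -, h1, h2, h3⟩ := d.a_moments h0
  have hsq : ∀ n, ∫ x, S n x ^ 2 ∂ν = l2 ν (S n) ^ 2 := fun n => (l2_sq ν (S n)).symm
  have hw0 : 0 < w := by
    rcases hw.eq_or_lt with h | h
    · exfalso
      obtain ⟨n, hn⟩ := (hdiv.eventually_gt_atTop (B ^ 2)).exists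
      have := hv n
      rw [← h, zero_mul, sub_zero, abs_of_nonneg (l2_nonneg _ _)] at this
      rw [hsq] at hn
      have : l2 ν (S n) ^ 2 ≤ B ^ 2 := by gcongr; exact l2_nonneg _ _
      linarith
    · exact h
  refine ⟨w ^ 2, by positivity, ?_, fun α hα A =>
    ⟨d.mdp_lower h0 w B hw0 hB0 h1 h2 h3 α hα A, d.mdp_upper w B hw0 hB0 h1 h2 h3 α hα A⟩⟩
  have t1 : Tendsto (fun n : ℕ => l2 ν (S n) / √n) atTop (nhds w) := by
    rw [tendsto_iff_norm_sub_tendsto_zero]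
    have t2 : Tendsto (fun n : ℕ => B / √(n : ℝ)) atTop (nhds 0) :=
      tendsto_const_nhds.div_atTop (Real.tendsto_sqrt_atTop.comp tendsto_natCast_atTop_atTop)
    refine squeeze_zero' (Eventually.of_forall fun n => norm_nonneg _) ?_ t2
    filter_upwards [eventually_gt_atTop 0] with n hn
    have hs : 0 < √(n : ℝ) := Real.sqrt_pos.2 (by exact_mod_cast hn)
    have : l2 ν (S n) / √n - w = (l2 ν (S n) - w * √n) / √n := by field_simp
    rw [Real.norm_eq_abs, this, abs_div, abs_of_pos hs]
    gcongr
    exact hv n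
  refine (t1.pow 2).congr fun n => ?_
  rw [hsq, div_pow, Real.sq_sqrt (Nat.cast_nonneg n)]

end Decoup
end S18

namespace S18

/-- the inducing interval -/
def Yset : Set ℝ := Ioo (1 / 2) 1

/-- normalised Lebesgue measure on the inducing interval -/
noncomputable def mY : Measure ℝ := (2 : ENNReal) • volume.restrict Yset

instance mY_prob : IsProbabilityMeasure mY := by
  constructor
  rw [mY, Measure.smul_apply, Measure.restrict_apply MeasurableSet.univ, univ_inter, Yset,
    Real.volume_Ioo, smul_eq_mul, ← ENNReal.ofReal_ofNat, ← ENNReal.ofReal_mul (by norm_num)]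
  norm_num

lemma mY_ae : ∀ᵐ y ∂mY, y ∈ Yset := by
  rw [mY]
  apply Measure.ae_smul_measure
  exact ae_restrict_mem measurableSet_Ioo

lemma Yabs {u v : ℝ} (hu : u ∈ Yset) (hv : v ∈ Yset) : |u - v| ≤ 1 / 2 := by
  have h1 : 1 / 2 < u ∧ u < 1 := hu
  have h2 : 1 / 2 < v ∧ v < 1 := hv
  rw [abs_le]
  constructor <;> linarith

/-- full branch induced system with bounded distortion -/
structure Ind (T : ℝ → ℝ) (G D : ℕ → ℝ → ℝ) (db : ℕ → ℝ) (K c1 W γ η H : ℝ) : Prop where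
  hK : 0 ≤ K
  hc1 : 0 < c1
  hγ : γ ∈ Ioo (0 : ℝ) 1
  hη : η ∈ Ioc (0 : ℝ) 1
  hT : Measurable T
  hG : ∀ r, Measurable (G r)
  hGY : ∀ r, ∀ u ∈ Yset, G r u ∈ Yset
  hGc : ∀ r, ∀ u ∈ Yset, ∀ v ∈ Yset, |G r u - G r v| ≤ |u - v| / 2
  hTG : ∀ r, ∀ u ∈ Yset, T^[r + 1] (G r u) = u
  hD : ∀ r, Measurable (D r)
  hD0 : ∀ r, ∀ u ∈ Yset, 0 < D r u
  hDK : ∀ r, ∀ u ∈ Yset, ∀ v ∈ Yset, D r u ≤ Real.exp (K * |u - v|) * D r v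
  hDb : ∀ r, ∀ u ∈ Yset, D r u ≤ db r
  hW : ∑' r : ℕ, ENNReal.ofReal (Real.exp (c1 * ((r : ℝ) + 1) ^ γ) * db r) ≤ ENNReal.ofReal W
  hcv : ∀ F : ℝ → ENNReal, Measurable F →
    ∫⁻ x, F x ∂mY = ∑' r, ∫⁻ u, F (G r u) * ENNReal.ofReal (D r u) ∂mY
  hH : ∀ r, ∀ u ∈ Yset, ∀ v ∈ Yset,
    ∑ i ∈ Finset.range (r + 1), |T^[i] (G r u) - T^[i] (G r v)| ^ η ≤ H * |u - v| ^ η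
  hT2 : ∀ y ∈ Yset, T y = 2 * y - 1

/-- inverse branch along a word -/
def GW (G : ℕ → ℝ → ℝ) : List ℕ → ℝ → ℝ
  | [] => fun u => u
  | r :: l => fun u => GW G l (G r u)

/-- total time of a word -/
def tau : List ℕ → ℕ
  | [] => 0
  | r :: l => tau l + (r + 1)

lemma tau_append (l l' : List ℕ) : tau (l ++ l') = tau l + tau l' := by
  induction l with
  | nil => simp [tau]
  | cons r l ih => simp only [List.cons_append, tau, ih]; omega

lemma GW_append (G : ℕ → ℝ → ℝ) (l l' : List ℕ) (u : ℝ) :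
    GW G (l ++ l') u = GW G l' (GW G l u) := by
  induction l generalizing u with
  | nil => simp [GW]
  | cons r l ih => simp only [List.cons_append, GW, ih]

lemma tau_pos {l : List ℕ} (h : l ≠ []) : 1 ≤ tau l := by
  cases l with
  | nil => exact absurd rfl h
  | cons r l => simp only [tau]; omega

section
variable {T : ℝ → ℝ} {G D : ℕ → ℝ → ℝ} {db : ℕ → ℝ} {K c1 W γ η H : ℝ}

lemma Ind.GW_meas (d : Ind T G D db K c1 W γ η H) (l : List ℕ) : Measurable (GW G l) := by
  induction l with
  | nil => exact measurable_id
  | cons r l ih => exact ih.comp (d.hG r)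

lemma Ind.GW_Y (d : Ind T G D db K c1 W γ η H) (l : List ℕ) (u : ℝ) (hu : u ∈ Yset) :
    GW G l u ∈ Yset := by
  induction l generalizing u with
  | nil => exact hu
  | cons r l ih => exact ih _ (d.hGY r u hu)

lemma Ind.T_GW (d : Ind T G D db K c1 W γ η H) (l : List ℕ) (u : ℝ) (hu : u ∈ Yset) :
    T^[tau l] (GW G l u) = u := by
  induction l generalizing u with
  | nil => rfl
  | cons r l ih =>
    rw [tau, add_comm, Function.iterate_add_apply, GW, ih _ (d.hGY r u hu), d.hTG r u hu]

lemma Ind.GW_c (d : Ind T G D db K c1 W γ η H) (l : List ℕ) (u v : ℝ) (hu : u ∈ Yset)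
    (hv : v ∈ Yset) : |GW G l u - GW G l v| ≤ |u - v| := by
  induction l generalizing u v with
  | nil => exact le_rfl
  | cons r l ih =>
    have h1 := ih _ _ (d.hGY r u hu) (d.hGY r v hv)
    have h2 := d.hGc r u hu v hv
    have h3 := abs_nonneg (u - v)
    simp only [GW]
    linarith

lemma Ind.GW_c2 (d : Ind T G D db K c1 W γ η H) (l : List ℕ) (hl : l ≠ []) (u v : ℝ)
    (hu : u ∈ Yset) (hv : v ∈ Yset) : |GW G l u - GW G l v| ≤ |u - v| / 2 := by
  cases l with
  | nil => exact absurd rfl hl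
  | cons r l =>
    have h1 := d.GW_c l _ _ (d.hGY r u hu) (d.hGY r v hv)
    have h2 := d.hGc r u hu v hv
    simp only [GW]
    linarith

end

/-- sum over words of given length -/
noncomputable def sumL (k : ℕ) (F : List ℕ → ENNReal) : ENNReal :=
  ∑' l : List ℕ, if l.length = k then F l else 0

lemma tsum_list (F : List ℕ → ENNReal) :
    ∑' l, F l = F [] + ∑' l, ∑' r, F (r :: l) := by
  rw [ENNReal.summable.tsum_eq_add_tsum_ite' []]
  congr 1
  have inj : Function.Injective (fun q : List ℕ × ℕ => q.2 :: q.1) := by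
    rintro ⟨l, r⟩ ⟨l', r'⟩ h
    simp only [List.cons.injEq] at h
    simp [h.1, h.2]
  rw [← inj.tsum_eq, ENNReal.tsum_prod']
  · simp
  · intro l hl
    cases l with
    | nil => simp at hl
    | cons r l => exact ⟨(l, r), rfl⟩

lemma tsum_eq_sumL (F : List ℕ → ENNReal) : ∑' l, F l = ∑' k, sumL k F := by
  simp only [sumL]
  rw [ENNReal.tsum_comm]
  congr 1
  ext l
  simp [tsum_ite_eq]

lemma sumL_zero (F : List ℕ → ENNReal) : sumL 0 F = F [] := by
  rw [sumL, tsum_list]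
  simp

lemma sumL_succ (k : ℕ) (F : List ℕ → ENNReal) :
    sumL (k + 1) F = sumL k (fun l => ∑' r, F (r :: l)) := by
  rw [sumL, tsum_list, sumL]
  simp only [List.length_nil, List.length_cons, add_left_inj]
  rw [if_neg (by omega), zero_add]
  congr 1
  ext l
  split_ifs <;> simp

lemma sumL_mono (k : ℕ) {F F' : List ℕ → ENNReal} (h : ∀ l, F l ≤ F' l) : sumL k F ≤ sumL k F' := by
  apply ENNReal.tsum_le_tsum
  intro l
  split_ifs
  · exact h l
  · exact le_rfl

lemma sumL_add (k : ℕ) (F F' : List ℕ → ENNReal) :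
    sumL k (fun l => F l + F' l) = sumL k F + sumL k F' := by
  rw [sumL, sumL, sumL, ← ENNReal.tsum_add]
  congr 1
  ext l
  split_ifs <;> simp

lemma sumL_mul (k : ℕ) (a : ENNReal) (F : List ℕ → ENNReal) :
    sumL k (fun l => a * F l) = a * sumL k F := by
  rw [sumL, sumL, ← ENNReal.tsum_mul_left]
  congr 1
  ext l
  split_ifs <;> simp

end S18

namespace S18

/-- positive functions with Lipschitz logarithm -/
structure LL (A : ℝ) (R : ℝ → ℝ) : Prop where
  meas : Measurable R
  pos : ∀ u ∈ Yset, 0 < R u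
  lip : ∀ u ∈ Yset, ∀ v ∈ Yset, R u ≤ Real.exp (A * |u - v|) * R v

lemma LL.comp {A : ℝ} {R : ℝ → ℝ} (h : LL A R) (hA : 0 ≤ A) (u v : ℝ) (hu : u ∈ Yset)
    (hv : v ∈ Yset) : R u ≤ Real.exp (A / 2) * R v := by
  have h1 := h.lip u hu v hv
  have h2 : Real.exp (A * |u - v|) ≤ Real.exp (A / 2) := by
    apply Real.exp_le_exp.2
    have := mul_le_mul_of_nonneg_left (Yabs hu hv) hA
    linarith
  exact h1.trans (mul_le_mul_of_nonneg_right h2 (h.pos v hv).le)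

lemma LL.int_le {A : ℝ} {R : ℝ → ℝ} (h : LL A R) (hA : 0 ≤ A) (v : ℝ) (hv : v ∈ Yset) :
    ∫⁻ u, ENNReal.ofReal (R u) ∂mY ≤ ENNReal.ofReal (Real.exp (A / 2) * R v) := by
  calc ∫⁻ u, ENNReal.ofReal (R u) ∂mY ≤ ∫⁻ _, ENNReal.ofReal (Real.exp (A / 2) * R v) ∂mY := by
        apply lintegral_mono_ae
        filter_upwards [mY_ae] with u hu
        exact ENNReal.ofReal_le_ofReal (h.comp hA u v hu hv)
    _ = _ := by simp

lemma LL.le_int {A : ℝ} {R : ℝ → ℝ} (h : LL A R) (hA : 0 ≤ A) (v : ℝ) (hv : v ∈ Yset) :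
    ENNReal.ofReal (R v) ≤ ENNReal.ofReal (Real.exp (A / 2)) * ∫⁻ u, ENNReal.ofReal (R u) ∂mY := by
  rw [← lintegral_const_mul _ (h.meas.ennreal_ofReal)]
  calc ENNReal.ofReal (R v) = ∫⁻ _, ENNReal.ofReal (R v) ∂mY := by simp
    _ ≤ _ := by
      apply lintegral_mono_ae
      filter_upwards [mY_ae] with u hu
      rw [← ENNReal.ofReal_mul (Real.exp_pos _).le]
      exact ENNReal.ofReal_le_ofReal (h.comp hA v u hv hu)

lemma LL.int_ne {A : ℝ} {R : ℝ → ℝ} (h : LL A R) (hA : 0 ≤ A) :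
    ∫⁻ u, ENNReal.ofReal (R u) ∂mY ≠ ⊤ := by
  have : (3 / 4 : ℝ) ∈ Yset := ⟨by norm_num, by norm_num⟩
  exact ((h.int_le hA _ this).trans_lt ENNReal.ofReal_lt_top).ne

lemma LL.sub {A t : ℝ} {R : ℝ → ℝ} (h : LL (3 * A) R) (hA : 0 ≤ A)
    (ht : ∀ v ∈ Yset, t ≤ R v / 4) : LL (4 * A) (fun u => R u - t) := by
  refine ⟨h.meas.sub_const _, fun u hu => ?_, fun u hu v hv => ?_⟩
  · have := ht u hu
    have := h.pos u hu
    linarith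
  · have h1 := h.lip u hu v hv
    have h2 := ht v hv
    have h3 := h.pos v hv
    set s := Real.exp (A * |u - v|) with hs
    have s1 : 1 ≤ s := Real.one_le_exp (mul_nonneg hA (abs_nonneg _))
    have e3 : Real.exp (3 * A * |u - v|) = s ^ 3 := by
      rw [hs, ← Real.exp_nat_mul]; congr 1; push_cast; ring
    have e4 : Real.exp (4 * A * |u - v|) = s ^ 4 := by
      rw [hs, ← Real.exp_nat_mul]; congr 1; push_cast; ring
    rw [e3] at h1
    rw [e4]
    have p1 : 0 ≤ s ^ 4 - (4 / 3) * s ^ 3 + 1 / 3 := by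
      have : s ^ 4 - (4 / 3) * s ^ 3 + 1 / 3 = (s - 1) ^ 2 * (3 * s ^ 2 + 2 * s + 1) / 3 := by ring
      rw [this]; positivity
    have p2 : 1 ≤ s ^ 3 := one_le_pow₀ s1
    nlinarith [mul_nonneg p1 (by linarith : 0 ≤ R v - t),
      mul_nonneg (sub_nonneg.2 p2) (by linarith : 0 ≤ R v / 3 - 4 / 3 * t)]

/-- the regeneration rate -/
noncomputable def th (K : ℝ) : ℝ := Real.exp (-(3 * K / 2)) / 4

lemma th_pos (K : ℝ) : 0 < th K := by unfold th; positivity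

lemma th_lt (K : ℝ) (hK : 0 ≤ K) : th K < 1 := by
  unfold th
  have : Real.exp (-(3 * K / 2)) ≤ 1 := Real.exp_le_one_iff.2 (by linarith)
  linarith

/-- mass of a branch -/
noncomputable def am (G D : ℕ → ℝ → ℝ) (r : ℕ) (R : ℝ → ℝ) : ENNReal :=
  ∫⁻ v, ENNReal.ofReal (R (G r v) * D r v) ∂mY

/-- remaining densities -/
noncomputable def RW (G D : ℕ → ℝ → ℝ) (K : ℝ) : List ℕ → ℝ → ℝ
  | [] => fun _ => 1
  | r :: l => fun u => RW G D K l (G r u) * D r u - th K * (am G D r (RW G D K l)).toReal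

/-- word weights -/
noncomputable def pw (G D : ℕ → ℝ → ℝ) (K : ℝ) : List ℕ → ENNReal
  | [] => 0
  | r :: l => ENNReal.ofReal (th K) * am G D r (RW G D K l)

namespace Ind
variable {T : ℝ → ℝ} {G D : ℕ → ℝ → ℝ} {db : ℕ → ℝ} {K c1 W γ η H : ℝ}
variable (d : Ind T G D db K c1 W γ η H)
include d

lemma rho_LL {R : ℝ → ℝ} (h : LL (4 * K) R) (r : ℕ) : LL (3 * K) (fun u => R (G r u) * D r u) := by
  refine ⟨(h.meas.comp (d.hG r)).mul (d.hD r), fun u hu => ?_, fun u hu v hv => ?_⟩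
  · exact mul_pos (h.pos _ (d.hGY r u hu)) (d.hD0 r u hu)
  · have h1 := h.lip _ (d.hGY r u hu) _ (d.hGY r v hv)
    have h2 := d.hDK r u hu v hv
    have h3 := d.hGc r u hu v hv
    have h4 : Real.exp (4 * K * |G r u - G r v|) ≤ Real.exp (2 * K * |u - v|) := by
      apply Real.exp_le_exp.2
      have := mul_le_mul_of_nonneg_left h3 d.hK
      linarith
    have h5 := h1.trans (mul_le_mul_of_nonneg_right h4 (h.pos _ (d.hGY r v hv)).le)
    calc R (G r u) * D r u ≤ (Real.exp (2 * K * |u - v|) * R (G r v)) *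
          (Real.exp (K * |u - v|) * D r v) := by
          apply mul_le_mul h5 h2 (d.hD0 r u hu).le
          have := h.pos _ (d.hGY r v hv)
          positivity
      _ = (Real.exp (2 * K * |u - v|) * Real.exp (K * |u - v|)) * (R (G r v) * D r v) := by ring
      _ = _ := by rw [← Real.exp_add]; congr 2; ring

lemma am_ne {R : ℝ → ℝ} (h : LL (4 * K) R) (r : ℕ) : am G D r R ≠ ⊤ :=
  (d.rho_LL h r).int_ne (by have := d.hK; linarith)

lemma am_le {R : ℝ → ℝ} (h : LL (4 * K) R) (r : ℕ) (v : ℝ) (hv : v ∈ Yset) :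
    th K * (am G D r R).toReal ≤ R (G r v) * D r v / 4 := by
  have hK := d.hK
  have h1 := (d.rho_LL h r).int_le (by linarith) v hv
  have p := (d.rho_LL h r).pos v hv
  have h2 : (am G D r R).toReal ≤ Real.exp (3 * K / 2) * (R (G r v) * D r v) :=
    ENNReal.toReal_le_of_le_ofReal (by positivity) h1
  calc th K * (am G D r R).toReal ≤ th K * (Real.exp (3 * K / 2) * (R (G r v) * D r v)) :=
        mul_le_mul_of_nonneg_left h2 (th_pos K).le
    _ = (Real.exp (-(3 * K / 2)) * Real.exp (3 * K / 2)) * (R (G r v) * D r v) / 4 := by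
        unfold th; ring
    _ = _ := by rw [← Real.exp_add]; simp

lemma RW_LL (l : List ℕ) : LL (4 * K) (RW G D K l) := by
  induction l with
  | nil =>
    refine ⟨measurable_const, fun u _ => by simp [RW], fun u _ v _ => ?_⟩
    simp only [RW, mul_one]
    apply Real.one_le_exp
    have := d.hK
    positivity
  | cons r l ih => exact (d.rho_LL ih r).sub d.hK fun v hv => d.am_le ih r v hv

lemma RW_split (l : List ℕ) (r : ℕ) (u : ℝ) (hu : u ∈ Yset) :
    ENNReal.ofReal (RW G D K l (G r u)) * ENNReal.ofReal (D r u) =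
      ENNReal.ofReal (RW G D K (r :: l) u) + pw G D K (r :: l) := by
  have h := d.RW_LL l
  have h' := d.RW_LL (r :: l)
  rw [← ENNReal.ofReal_mul (h.pos _ (d.hGY r u hu)).le]
  have : pw G D K (r :: l) = ENNReal.ofReal (th K * (am G D r (RW G D K l)).toReal) := by
    rw [pw, ENNReal.ofReal_mul (th_pos K).le, ENNReal.ofReal_toReal (d.am_ne h r)]
  rw [this, ← ENNReal.ofReal_add (h'.pos u hu).le]
  · simp [RW]
  · have := th_pos K
    positivity

lemma RW_step (F : ℝ → ENNReal) (hF : Measurable F) (l : List ℕ) :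
    ∫⁻ u, F (GW G l u) * ENNReal.ofReal (RW G D K l u) ∂mY =
      ∑' r, (∫⁻ u, F (GW G (r :: l) u) * ENNReal.ofReal (RW G D K (r :: l) u) ∂mY +
        pw G D K (r :: l) * ∫⁻ u, F (GW G (r :: l) u) ∂mY) := by
  rw [d.hcv (fun u => F (GW G l u) * ENNReal.ofReal (RW G D K l u))
    ((hF.comp (d.GW_meas l)).mul (d.RW_LL l).meas.ennreal_ofReal)]
  congr 1
  ext r
  have m1 : Measurable fun u => F (GW G (r :: l) u) := hF.comp (d.GW_meas (r :: l))
  rw [← lintegral_const_mul _ m1, ← lintegral_add_right _ (m1.const_mul _)]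
  apply lintegral_congr_ae
  filter_upwards [mY_ae] with u hu
  rw [mul_assoc, d.RW_split l r u hu, mul_add, mul_comm (pw G D K (r :: l))]
  rfl

lemma pw_le (F : ℝ → ENNReal) (hF : Measurable F) :
    ∑' l, pw G D K l * ∫⁻ u, F (GW G l u) ∂mY ≤ ∫⁻ u, F u ∂mY := by
  rw [tsum_eq_sumL]
  set A := fun l => ∫⁻ u, F (GW G l u) * ENNReal.ofReal (RW G D K l u) ∂mY with hA
  set B := fun l => pw G D K l * ∫⁻ u, F (GW G l u) ∂mY with hB
  have h1 : ∀ n, sumL n A = sumL (n + 1) A + sumL (n + 1) B := by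
    intro n
    rw [← sumL_add, sumL_succ]
    congr 1
    ext l
    exact d.RW_step F hF l
  have h2 : ∀ n, ∑ k ∈ Finset.range (n + 1), sumL k B + sumL n A = ∫⁻ u, F u ∂mY := by
    intro n
    induction n with
    | zero => simp [sumL_zero, hA, hB, GW, RW, pw]
    | succ n ih => rw [Finset.sum_range_succ, ← ih, h1 n]; ring
  apply ENNReal.tsum_le_of_sum_range_le
  intro n
  rw [← h2 n]
  calc ∑ k ∈ Finset.range n, sumL k B ≤ ∑ k ∈ Finset.range (n + 1), sumL k B :=
        Finset.sum_le_sum_of_subset (Finset.range_mono (Nat.le_succ n))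
    _ ≤ _ := le_self_add

lemma RW_mass (l : List ℕ) (r : ℕ) :
    ∫⁻ u, ENNReal.ofReal (RW G D K (r :: l) u) ∂mY =
      ENNReal.ofReal (1 - th K) * am G D r (RW G D K l) := by
  have h := d.RW_LL l
  have e : am G D r (RW G D K l) = ∫⁻ u, ENNReal.ofReal (RW G D K (r :: l) u) ∂mY +
      ENNReal.ofReal (th K) * am G D r (RW G D K l) := by
    have : ENNReal.ofReal (th K) * am G D r (RW G D K l) =
      ∫⁻ _, ENNReal.ofReal (th K) * am G D r (RW G D K l) ∂mY := by simp
    rw [this, ← lintegral_add_right _ measurable_const, am]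
    apply lintegral_congr_ae
    filter_upwards [mY_ae] with u hu
    rw [ENNReal.ofReal_mul (h.pos _ (d.hGY r u hu)).le]
    exact d.RW_split l r u hu
  have e2 : am G D r (RW G D K l) = ENNReal.ofReal (1 - th K) * am G D r (RW G D K l) +
      ENNReal.ofReal (th K) * am G D r (RW G D K l) := by
    rw [← add_mul, ← ENNReal.ofReal_add (sub_nonneg.2 (th_lt K d.hK).le) (th_pos K).le]
    simp
  have ne : ENNReal.ofReal (th K) * am G D r (RW G D K l) ≠ ⊤ :=
    ENNReal.mul_ne_top ENNReal.ofReal_ne_top (d.am_ne h r)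
  exact (ENNReal.add_left_inj ne).1 (e.symm.trans e2)

lemma am_sum (l : List ℕ) :
    ∑' r, am G D r (RW G D K l) = ∫⁻ u, ENNReal.ofReal (RW G D K l u) ∂mY := by
  rw [d.hcv _ (d.RW_LL l).meas.ennreal_ofReal]
  congr 1
  ext r
  rw [am]
  apply lintegral_congr_ae
  filter_upwards [mY_ae] with u hu
  rw [ENNReal.ofReal_mul ((d.RW_LL l).pos _ (d.hGY r u hu)).le]

lemma am_bd (l : List ℕ) (r : ℕ) : am G D r (RW G D K l) ≤
    ENNReal.ofReal (Real.exp (2 * K)) * ENNReal.ofReal (db r) *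
      ∫⁻ u, ENNReal.ofReal (RW G D K l u) ∂mY := by
  have hK := d.hK
  rw [am]
  calc ∫⁻ v, ENNReal.ofReal (RW G D K l (G r v) * D r v) ∂mY ≤ ∫⁻ _, ENNReal.ofReal (Real.exp (2 * K)) * ENNReal.ofReal (db r) *
      (∫⁻ u, ENNReal.ofReal (RW G D K l u) ∂mY) ∂mY := by
        apply lintegral_mono_ae
        filter_upwards [mY_ae] with u hu
        have h1 := (d.RW_LL l).le_int (by linarith) _ (d.hGY r u hu)
        rw [ENNReal.ofReal_mul ((d.RW_LL l).pos _ (d.hGY r u hu)).le]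
        have h2 : ENNReal.ofReal (D r u) ≤ ENNReal.ofReal (db r) :=
          ENNReal.ofReal_le_ofReal (d.hDb r u hu)
        refine (mul_le_mul' h1 h2).trans (le_of_eq ?_)
        rw [show 4 * K / 2 = 2 * K by ring]
        ring
    _ = _ := by simp

lemma pw_sum : ∑' l, pw G D K l = 1 := by
  have t0 := th_pos K
  have t1 := th_lt K d.hK
  set A := fun l => ∫⁻ u, ENNReal.ofReal (RW G D K l u) ∂mY with hA
  have h1 : ∀ n, sumL n A = ENNReal.ofReal (1 - th K) ^ n := by
    intro n
    induction n with
    | zero => simp [sumL_zero, hA, RW]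
    | succ n ih =>
      rw [sumL_succ, pow_succ', ← ih, ← sumL_mul]
      congr 1
      ext l
      simp only [hA]
      rw [← d.am_sum, ← ENNReal.tsum_mul_left]
      congr 1
      ext r
      exact d.RW_mass l r
  have h2 : ∀ n, sumL (n + 1) (pw G D K) = ENNReal.ofReal (th K) * ENNReal.ofReal (1 - th K) ^ n := by
    intro n
    rw [sumL_succ, ← h1, ← sumL_mul]
    congr 1
    ext l
    simp only [hA, pw]
    rw [← d.am_sum, ← ENNReal.tsum_mul_left]
  rw [tsum_eq_sumL, tsum_eq_zero_add' ENNReal.summable, sumL_zero]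
  simp only [h2]
  rw [ENNReal.tsum_mul_left, ENNReal.tsum_geometric, pw, zero_add]
  have : 1 - ENNReal.ofReal (1 - th K) = ENNReal.ofReal (th K) := by
    rw [← ENNReal.ofReal_one, ← ENNReal.ofReal_sub _ (by linarith)]
    congr 1; ring
  rw [this]
  exact ENNReal.mul_inv_cancel (by simpa using t0) ENNReal.ofReal_ne_top

lemma pw_eq (F : ℝ → ENNReal) (hF : Measurable F) :
    ∫⁻ u, F u ∂mY = ∑' l, pw G D K l * ∫⁻ u, F (GW G l u) ∂mY := by
  set μ : Measure ℝ := Measure.sum fun l => pw G D K l • mY.map (GW G l) with hμ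
  have hi : ∀ F : ℝ → ENNReal, Measurable F → ∫⁻ u, F u ∂μ =
      ∑' l, pw G D K l * ∫⁻ u, F (GW G l u) ∂mY := by
    intro F hF
    rw [hμ, lintegral_sum_measure]
    congr 1
    ext l
    rw [lintegral_smul_measure, lintegral_map hF (d.GW_meas l), smul_eq_mul]
  have h1 : μ ≤ mY := by
    rw [Measure.le_iff]
    intro s hs
    rw [← lintegral_indicator_one hs, ← lintegral_indicator_one hs,
      hi _ (measurable_one.indicator hs)]
    exact d.pw_le _ (measurable_one.indicator hs)
  have h2 : μ univ = 1 := by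
    rw [← lintegral_one, hi _ measurable_const]
    simp [d.pw_sum]
  have : IsFiniteMeasure μ := ⟨by rw [h2]; simp⟩
  have h3 : μ = mY := Measure.eq_of_le_of_measure_univ_eq h1 (by rw [h2]; simp)
  rw [← hi F hF, h3]

/-- exponential weight -/
noncomputable def _root_.S18.ew (c γ : ℝ) (n : ℕ) : ENNReal :=
  ENNReal.ofReal (Real.exp (c * (n : ℝ) ^ γ))

omit d in
lemma _root_.S18.ew_add (c γ : ℝ) (hc : 0 ≤ c) (h0 : 0 ≤ γ) (h1 : γ ≤ 1) (n k : ℕ) :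
    ew c γ (n + k) ≤ ew c γ n * ew c γ k := by
  rw [ew, ew, ew, ← ENNReal.ofReal_mul (Real.exp_pos _).le, ← Real.exp_add]
  apply ENNReal.ofReal_le_ofReal
  apply Real.exp_le_exp.2
  rw [← mul_add]
  apply mul_le_mul_of_nonneg_left _ hc
  push_cast
  exact Real.rpow_add_le_add_rpow (by positivity) (by positivity) h0 h1

lemma tail_step : ∃ c : ℝ, 0 < c ∧ ∀ l : List ℕ,
    ∑' r, ew c γ (r + 1) * am G D r (RW G D K l) ≤
      ENNReal.ofReal (1 + th K) * ∫⁻ u, ENNReal.ofReal (RW G D K l u) ∂mY := by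
  have t0 := th_pos K
  have hc1 := d.hc1
  set s : ℝ := min 1 (th K / (Real.exp (2 * K) * (|W| + 1))) with hs
  have s0 : 0 < s := by rw [hs]; apply lt_min <;> positivity
  have s1 : s ≤ 1 := min_le_left _ _
  have s2 : s * (Real.exp (2 * K) * W) ≤ th K := by
    have h1 : s ≤ th K / (Real.exp (2 * K) * (|W| + 1)) := min_le_right _ _
    rw [le_div_iff₀ (by positivity)] at h1
    refine le_trans ?_ h1
    apply mul_le_mul_of_nonneg_left _ s0.le
    apply mul_le_mul_of_nonneg_left _ (Real.exp_pos _).le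
    have := le_abs_self W
    linarith
  refine ⟨s * c1, by positivity, fun l => ?_⟩
  set I := ∫⁻ u, ENNReal.ofReal (RW G D K l u) ∂mY with hI
  have hew : ∀ r : ℕ, ew (s * c1) γ (r + 1) ≤
      1 + ENNReal.ofReal (s * Real.exp (c1 * ((r : ℝ) + 1) ^ γ)) := by
    intro r
    rw [ew, ← ENNReal.ofReal_one, ← ENNReal.ofReal_add zero_le_one (by positivity)]
    apply ENNReal.ofReal_le_ofReal
    push_cast
    have hconv := convexOn_exp.2 (mem_univ (0 : ℝ)) (mem_univ (c1 * ((r : ℝ) + 1) ^ γ))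
      (sub_nonneg.2 s1) s0.le (by ring)
    simp only [smul_eq_mul, mul_zero, zero_add, Real.exp_zero, mul_one] at hconv
    rw [mul_assoc]
    linarith
  calc ∑' r, ew (s * c1) γ (r + 1) * am G D r (RW G D K l)
      ≤ ∑' r : ℕ, (am G D r (RW G D K l) + (ENNReal.ofReal (s * Real.exp (2 * K)) * I) *
          ENNReal.ofReal (Real.exp (c1 * ((r : ℝ) + 1) ^ γ) * db r)) := by
        apply ENNReal.tsum_le_tsum
        intro r
        refine (mul_le_mul' (hew r) le_rfl).trans ?_
        rw [add_mul, one_mul]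
        apply add_le_add le_rfl
        refine (mul_le_mul' le_rfl (d.am_bd l r)).trans (le_of_eq ?_)
        rw [ENNReal.ofReal_mul s0.le, ENNReal.ofReal_mul s0.le,
          ENNReal.ofReal_mul (Real.exp_pos _).le]
        ring
    _ = I + (ENNReal.ofReal (s * Real.exp (2 * K)) * I) *
          ∑' r : ℕ, ENNReal.ofReal (Real.exp (c1 * ((r : ℝ) + 1) ^ γ) * db r) := by
        rw [ENNReal.tsum_add, ENNReal.tsum_mul_left, d.am_sum]
    _ ≤ I + (ENNReal.ofReal (s * Real.exp (2 * K)) * I) * ENNReal.ofReal W := by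
        apply add_le_add le_rfl
        exact mul_le_mul' le_rfl d.hW
    _ = I + ENNReal.ofReal (s * (Real.exp (2 * K) * W)) * I := by
        rw [← mul_assoc s, ENNReal.ofReal_mul (p := s * Real.exp (2 * K)) (by positivity)]
        ring
    _ ≤ I + ENNReal.ofReal (th K) * I := by
        apply add_le_add le_rfl
        exact mul_le_mul' (ENNReal.ofReal_le_ofReal s2) le_rfl
    _ = _ := by
        rw [ENNReal.ofReal_add zero_le_one t0.le, ENNReal.ofReal_one]
        ring

lemma pw_tail : ∃ c B : ℝ, 0 < c ∧
    ∑' l, pw G D K l * ew c γ (tau l) ≤ ENNReal.ofReal B := by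
  obtain ⟨c, hc, h⟩ := d.tail_step
  have t0 := th_pos K
  have t1 := th_lt K d.hK
  have g0 := d.hγ.1.le
  have g1 := d.hγ.2.le
  set A := fun l => ew c γ (tau l) * ∫⁻ u, ENNReal.ofReal (RW G D K l u) ∂mY with hA
  have key : ∀ l, ∑' r, ew c γ (tau (r :: l)) * am G D r (RW G D K l) ≤
      ENNReal.ofReal (1 + th K) * A l := by
    intro l
    calc ∑' r, ew c γ (tau (r :: l)) * am G D r (RW G D K l)
        ≤ ∑' r, ew c γ (tau l) * (ew c γ (r + 1) * am G D r (RW G D K l)) := by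
          apply ENNReal.tsum_le_tsum
          intro r
          rw [← mul_assoc]
          exact mul_le_mul' (ew_add c γ hc.le g0 g1 _ _) le_rfl
      _ = ew c γ (tau l) * ∑' r, (ew c γ (r + 1) * am G D r (RW G D K l)) :=
          ENNReal.tsum_mul_left
      _ ≤ ew c γ (tau l) * (ENNReal.ofReal (1 + th K) *
          ∫⁻ u, ENNReal.ofReal (RW G D K l u) ∂mY) := mul_le_mul' le_rfl (h l)
      _ = _ := by simp only [hA]; ring
  set q := ENNReal.ofReal (1 - th K ^ 2) with hq
  have hA0 : A [] = 1 := by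
    simp [hA, ew, RW, tau, Real.zero_rpow d.hγ.1.ne']
  have h1 : ∀ n, sumL n A ≤ q ^ n := by
    intro n
    induction n with
    | zero => simp [sumL_zero, hA0]
    | succ n ih =>
      rw [sumL_succ, pow_succ']
      refine le_trans ?_ (mul_le_mul' le_rfl ih)
      rw [← sumL_mul]
      apply sumL_mono
      intro l
      calc ∑' r, A (r :: l) = ENNReal.ofReal (1 - th K) *
            ∑' r, ew c γ (tau (r :: l)) * am G D r (RW G D K l) := by
            rw [← ENNReal.tsum_mul_left]
            congr 1
            ext r
            simp only [hA]
            rw [d.RW_mass l r]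
            ring
        _ ≤ ENNReal.ofReal (1 - th K) * (ENNReal.ofReal (1 + th K) * A l) :=
            mul_le_mul' le_rfl (key l)
        _ = q * A l := by
            rw [← mul_assoc, ← ENNReal.ofReal_mul (by linarith)]
            congr 2
            ring
  have h2 : ∀ n, sumL (n + 1) (fun l => pw G D K l * ew c γ (tau l)) ≤
      ENNReal.ofReal (th K) * ENNReal.ofReal (1 + th K) * q ^ n := by
    intro n
    refine le_trans ?_ (mul_le_mul' le_rfl (h1 n))
    rw [sumL_succ, ← sumL_mul]
    apply sumL_mono
    intro l
    rw [mul_assoc]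
    refine le_trans (le_of_eq ?_) (mul_le_mul' le_rfl (key l))
    rw [← ENNReal.tsum_mul_left]
    congr 1
    ext r
    rw [pw]
    ring
  have fin : ∑' l, pw G D K l * ew c γ (tau l) ≠ ⊤ := by
    rw [tsum_eq_sumL, tsum_eq_zero_add' ENNReal.summable, sumL_zero, pw, zero_mul, zero_add]
    refine ((ENNReal.tsum_le_tsum h2).trans_lt ?_).ne
    rw [ENNReal.tsum_mul_left, ENNReal.tsum_geometric]
    refine ENNReal.mul_lt_top (ENNReal.mul_lt_top ENNReal.ofReal_lt_top ENNReal.ofReal_lt_top) ?_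
    rw [ENNReal.inv_lt_top, hq]
    apply tsub_pos_of_lt
    rw [← ENNReal.ofReal_one]
    apply (ENNReal.ofReal_lt_ofReal_iff one_pos).2
    have : 0 < th K ^ 2 := by positivity
    linarith
  exact ⟨c, _, hc, (ENNReal.ofReal_toReal fin).ge⟩

lemma key : ∃ (p : PMF (List ℕ)) (c B : ℝ), 0 < c ∧ 0 ≤ B ∧ p [] = 0 ∧
    (∀ F : ℝ → ENNReal, Measurable F →
      ∫⁻ u, F u ∂mY = ∑' l, p l * ∫⁻ u, F (GW G l u) ∂mY) ∧
    ∑' l, p l * ew c γ (tau l) ≤ ENNReal.ofReal B := by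
  obtain ⟨c, B, hc, hB⟩ := d.pw_tail
  have hs : HasSum (pw G D K) 1 := by
    rw [← d.pw_sum]
    exact ENNReal.summable.hasSum
  refine ⟨⟨pw G D K, hs⟩, c, |B|, hc, abs_nonneg _, rfl, d.pw_eq, hB.trans ?_⟩
  exact ENNReal.ofReal_le_ofReal (le_abs_self B)

end Ind
end S18

namespace S18

instance listMS : MeasurableSpace (List ℕ) := ⊤
instance listDMS : DiscreteMeasurableSpace (List ℕ) := ⟨fun _ => trivial⟩

/-- expectation of a discrete law -/
noncomputable def EP {α : Type} (q : PMF α) (f : α → ENNReal) : ENNReal := ∑' s, q s * f s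

lemma EP_mono {α : Type} (q : PMF α) {f g : α → ENNReal} (h : ∀ s, q s ≠ 0 → f s ≤ g s) :
    EP q f ≤ EP q g := by
  apply ENNReal.tsum_le_tsum
  intro s
  by_cases hs : q s = 0
  · simp [hs]
  · exact mul_le_mul' le_rfl (h s hs)

lemma EP_congr {α : Type} (q : PMF α) {f g : α → ENNReal} (h : ∀ s, q s ≠ 0 → f s = g s) :
    EP q f = EP q g :=
  le_antisymm (EP_mono q fun s hs => (h s hs).le) (EP_mono q fun s hs => (h s hs).ge)

lemma EP_const {α : Type} (q : PMF α) (a : ENNReal) : EP q (fun _ => a) = a := by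
  rw [EP, ENNReal.tsum_mul_right, q.tsum_coe, one_mul]

lemma EP_add {α : Type} (q : PMF α) (f g : α → ENNReal) :
    EP q (fun s => f s + g s) = EP q f + EP q g := by
  rw [EP, EP, EP, ← ENNReal.tsum_add]
  congr 1
  ext s
  ring

lemma EP_mul {α : Type} (q : PMF α) (a : ENNReal) (f : α → ENNReal) :
    EP q (fun s => a * f s) = a * EP q f := by
  rw [EP, EP, ← ENNReal.tsum_mul_left]
  congr 1
  ext s
  ring

lemma EP_pure {α : Type} (a : α) (f : α → ENNReal) : EP (PMF.pure a) f = f a := by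
  rw [EP, tsum_eq_single a]
  · simp
  · intro b hb
    simp [PMF.pure_apply, hb]

lemma EP_bind {α β : Type} (p : PMF α) (q : α → PMF β) (f : β → ENNReal) :
    EP (p.bind q) f = EP p (fun a => EP (q a) f) := by
  simp only [EP, PMF.bind_apply, ← ENNReal.tsum_mul_right, ← ENNReal.tsum_mul_left]
  rw [ENNReal.tsum_comm]
  simp only [mul_assoc]

lemma EP_map {α β : Type} (p : PMF α) (g : α → β) (f : β → ENNReal) :
    EP (p.map g) f = EP p (fun a => f (g a)) := by
  rw [PMF.map, EP_bind]
  simp only [Function.comp_apply, EP_pure]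

lemma EP_lint {α : Type} [MeasurableSpace α] [DiscreteMeasurableSpace α] [Countable α] (q : PMF α)
    (f : α → ENNReal) : ∫⁻ s, f s ∂q.toMeasure = EP q f := by
  rw [lintegral_countable', EP]
  congr 1
  ext s
  rw [q.toMeasure_apply_singleton _ (measurableSet_singleton s), mul_comm]

/-- a law on words reproducing the reference measure -/
def Rep (G : ℕ → ℝ → ℝ) (q : PMF (List ℕ)) : Prop :=
  ∀ F : ℝ → ENNReal, Measurable F → ∫⁻ u, F u ∂mY = EP q (fun l => ∫⁻ u, F (GW G l u) ∂mY)

section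
variable {T : ℝ → ℝ} {G D : ℕ → ℝ → ℝ} {db : ℕ → ℝ} {K c1 W γ η H : ℝ}

lemma Ind.PN (d : Ind T G D db K c1 W γ η H) (p : PMF (List ℕ)) (p0 : p [] = 0) (hp : Rep G p)
    (N : ℕ) : ∃ q : PMF (List ℕ), (∀ s, q s ≠ 0 → N ≤ tau s) ∧ Rep G q ∧
      ∀ f : ℕ → ENNReal, EP q (fun s => f (tau s - N)) ≤
        f 0 + ∑ i ∈ Finset.range (N + 1), EP p (fun w => if i ≤ tau w then f (tau w - i) else 0) := by
  induction N using Nat.strong_induction_on with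
  | _ N ih =>
  rcases Nat.eq_zero_or_pos N with h0 | h0
  · subst h0
    refine ⟨PMF.pure [], fun _ _ => Nat.zero_le _, fun F hF => ?_, fun f => ?_⟩
    · rw [EP_pure]; rfl
    · rw [EP_pure]
      exact le_self_add
  have h1 : ∀ k, ∃ q : PMF (List ℕ), k < N → (∀ s, q s ≠ 0 → k ≤ tau s) ∧ Rep G q ∧
      ∀ f : ℕ → ENNReal, EP q (fun s => f (tau s - k)) ≤
        f 0 + ∑ i ∈ Finset.range (k + 1), EP p (fun w => if i ≤ tau w then f (tau w - i) else 0) := by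
    intro k
    by_cases hk : k < N
    · obtain ⟨q, hq⟩ := ih k hk
      exact ⟨q, fun _ => hq⟩
    · exact ⟨PMF.pure [], fun h => absurd h hk⟩
  choose Q hQ using h1
  set qq : List ℕ → PMF (List ℕ) := fun w =>
    if tau w < N then (Q (N - tau w)).map (fun s => s ++ w) else PMF.pure w with hqq
  have hwt : ∀ w, p w ≠ 0 → 1 ≤ tau w := by
    intro w hw
    apply tau_pos
    rintro rfl
    exact hw p0
  refine ⟨p.bind qq, ?_, ?_, ?_⟩
  · intro s hs
    rw [← PMF.mem_support_iff, PMF.mem_support_bind_iff] at hs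
    obtain ⟨w, hw, hs⟩ := hs
    rw [PMF.mem_support_iff] at hw
    have hw1 := hwt w hw
    simp only [hqq] at hs
    split_ifs at hs with hlt
    · rw [PMF.mem_support_map_iff] at hs
      obtain ⟨s', hs', rfl⟩ := hs
      have := (hQ (N - tau w) (by omega)).1 s' hs'
      rw [tau_append]
      omega
    · rw [PMF.mem_support_pure_iff] at hs
      subst hs
      omega
  · intro F hF
    rw [hp F hF, EP_bind]
    apply EP_congr
    intro w hw
    have hw1 := hwt w hw
    simp only [hqq]
    split_ifs with hlt
    · rw [EP_map, (hQ (N - tau w) (by omega)).2.1 (fun u => F (GW G w u))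
        (hF.comp (d.GW_meas w))]
      simp only [GW_append]
    · rw [EP_pure]
  · intro f
    rw [EP_bind, Finset.sum_range_succ, ← add_assoc]
    set b := fun i => EP p (fun w => if i ≤ tau w then f (tau w - i) else 0) with hb
    calc EP p (fun a => EP (qq a) fun s => f (tau s - N))
        ≤ EP p (fun w => (f 0 + ∑ i ∈ Finset.range N, b i) +
          if N ≤ tau w then f (tau w - N) else 0) := by
          apply EP_mono
          intro w hw
          have hw1 := hwt w hw
          simp only [hqq]
          split_ifs with hlt h2 h2
          · omega
          · rw [EP_map, add_zero]
            have h3 := (hQ (N - tau w) (by omega)).2.2 f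
            have e : (fun s => f (tau (s ++ w) - N)) = fun s => f (tau s - (N - tau w)) := by
              ext s
              rw [tau_append]
              congr 1
              omega
            rw [e]
            refine h3.trans ?_
            apply add_le_add le_rfl
            apply Finset.sum_le_sum_of_subset
            apply Finset.range_mono
            omega
          · rw [EP_pure]
            exact le_add_self
          · omega
      _ = _ := by rw [EP_add, EP_const]

lemma sum_f_le (f : ℕ → ENNReal) (hf : Monotone f) (p : PMF (List ℕ)) (n : ℕ) :
    ∑ i ∈ Finset.range n, EP p (fun w => if i ≤ tau w then f (tau w - i) else 0) ≤
      EP p (fun w => ((tau w : ENNReal) + 1) * f (tau w)) := by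
  have : ∑ i ∈ Finset.range n, EP p (fun w => if i ≤ tau w then f (tau w - i) else 0) =
      EP p (fun w => ∑ i ∈ Finset.range n, if i ≤ tau w then f (tau w - i) else 0) := by
    induction n with
    | zero => simp [EP]
    | succ n ih => simp only [Finset.sum_range_succ, ih, EP_add]
  rw [this]
  apply EP_mono
  intro w _
  rw [← Finset.sum_filter]
  calc ∑ i ∈ Finset.range n with i ≤ tau w, f (tau w - i)
      ≤ ∑ i ∈ Finset.range (tau w + 1), f (tau w) := by
        refine le_trans (Finset.sum_le_sum fun i _ => hf (Nat.sub_le _ _)) ?_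
        apply Finset.sum_le_sum_of_subset
        intro i hi
        simp at hi ⊢
        omega
    _ = _ := by simp

lemma Rep.mp (d : Ind T G D db K c1 W γ η H) (q : PMF (List ℕ)) (hq : Rep G q) :
    MeasurePreserving (fun z : List ℕ × ℝ => GW G z.1 z.2) (q.toMeasure.prod mY) mY := by
  have hm : Measurable (fun z : List ℕ × ℝ => GW G z.1 z.2) :=
    measurable_from_prod_countable_right fun l => d.GW_meas l
  refine ⟨hm, ?_⟩
  ext A hA
  rw [Measure.map_apply hm hA, Measure.prod_apply (hm hA), EP_lint]
  rw [← lintegral_indicator_one hA, hq _ (measurable_one.indicator hA)]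
  apply EP_congr
  intro s _
  have : (fun u => A.indicator (1 : ℝ → ENNReal) (GW G s u)) = (GW G s ⁻¹' A).indicator 1 := by
    ext u; rfl
  rw [this, lintegral_indicator_one (d.GW_meas s hA)]
  rfl

/-- moment bound used for all error terms -/
lemma ew_big (hγ : γ ∈ Ioo (0 : ℝ) 1) (p : PMF (List ℕ)) (c B C0 : ℝ) (hc : 0 < c)
    (hC0 : 1 ≤ C0) (hB : EP p (fun l => ew c γ (tau l)) ≤ ENNReal.ofReal B) :
    ∃ c2 B2 : ℝ, 0 < c2 ∧ 0 ≤ B2 ∧ EP p (fun w => ((tau w : ENNReal) + 1) *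
      ENNReal.ofReal (Real.exp (c2 * (C0 * (((tau w : ℕ) : ℝ) + 1)) ^ γ))) ≤ ENNReal.ofReal B2 := by
  obtain ⟨B3, hB3, h3⟩ := pow_le_exp hγ.1 (show 0 < c / 2 by linarith) 1
  have hCp : 0 < C0 ^ γ := Real.rpow_pos_of_pos (by linarith) _
  refine ⟨c / 2 / C0 ^ γ, |B3 * Real.exp c * B|, by positivity, abs_nonneg _, ?_⟩
  calc _ ≤ EP p (fun w => ENNReal.ofReal (B3 * Real.exp c) * ew c γ (tau w)) := by
        apply EP_mono
        intro w _
        rw [ew, ← ENNReal.ofReal_mul (by positivity)]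
        set t : ℝ := ((tau w : ℕ) : ℝ) with ht
        have t0 : 0 ≤ t := by positivity
        have e1 : ((tau w : ENNReal) + 1) = ENNReal.ofReal (t + 1) := by
          rw [ENNReal.ofReal_add t0 zero_le_one, ht, ENNReal.ofReal_natCast, ENNReal.ofReal_one]
        rw [e1, ← ENNReal.ofReal_mul (by positivity)]
        apply ENNReal.ofReal_le_ofReal
        have h4 := h3 (t + 1) (by positivity)
        rw [pow_one] at h4
        have h5 : c / 2 / C0 ^ γ * (C0 * (t + 1)) ^ γ = c / 2 * (t + 1) ^ γ := by
          rw [Real.mul_rpow (by linarith) (by positivity)]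
          field_simp
        rw [h5]
        have h6 : (t + 1) ^ γ ≤ t ^ γ + 1 := by
          have := Real.rpow_add_le_add_rpow t0 zero_le_one hγ.1.le hγ.2.le
          rwa [Real.one_rpow] at this
        calc (t + 1) * Real.exp (c / 2 * (t + 1) ^ γ)
            ≤ (B3 * Real.exp (c / 2 * (t + 1) ^ γ)) * Real.exp (c / 2 * (t + 1) ^ γ) := by
              apply mul_le_mul_of_nonneg_right h4 (Real.exp_pos _).le
          _ = B3 * Real.exp (c * (t + 1) ^ γ) := by
              rw [mul_assoc, ← Real.exp_add]; congr 2; ring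
          _ ≤ B3 * Real.exp (c + c * t ^ γ) := by
              apply mul_le_mul_of_nonneg_left _ hB3.le
              apply Real.exp_le_exp.2
              have := mul_le_mul_of_nonneg_left h6 hc.le
              linarith
          _ = B3 * Real.exp c * Real.exp (c * t ^ γ) := by rw [Real.exp_add]; ring
    _ = ENNReal.ofReal (B3 * Real.exp c) * EP p (fun l => ew c γ (tau l)) := EP_mul _ _ _
    _ ≤ ENNReal.ofReal (B3 * Real.exp c) * ENNReal.ofReal B := mul_le_mul' le_rfl hB
    _ = ENNReal.ofReal (B3 * Real.exp c * B) := by rw [← ENNReal.ofReal_mul (by positivity)]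
    _ ≤ _ := ENNReal.ofReal_le_ofReal (le_abs_self _)

end
end S18

namespace S18

lemma exists_Q (p : PMF (List ℕ)) (p0 : p [] = 0) (hfin : EP p (fun w => (tau w : ENNReal)) ≠ ⊤) :
    ∃ Q : PMF (List ℕ × ℕ), (∀ z, Q z ≠ 0 → z.2 < tau z.1) ∧
      ∀ f : List ℕ × ℕ → ENNReal, EP Q f = (EP p (fun w => (tau w : ENNReal)))⁻¹ *
        EP p (fun w => ∑ k ∈ Finset.range (tau w), f (w, k)) := by
  set fq : List ℕ × ℕ → ENNReal := fun z => p z.1 * if z.2 < tau z.1 then 1 else 0 with hfq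
  have hs : ∀ f : List ℕ × ℕ → ENNReal, ∑' z, fq z * f z =
      EP p (fun w => ∑ k ∈ Finset.range (tau w), f (w, k)) := by
    intro f
    rw [ENNReal.tsum_prod', EP]
    congr 1
    ext w
    simp only [hfq, mul_assoc]
    rw [ENNReal.tsum_mul_left]
    congr 1
    rw [tsum_eq_sum (s := Finset.range (tau w))]
    · apply Finset.sum_congr rfl
      intro k hk
      rw [if_pos (Finset.mem_range.1 hk), one_mul]
    · intro k hk
      rw [if_neg (by simpa using hk), zero_mul]
  have hM : ∑' z, fq z = EP p (fun w => (tau w : ENNReal)) := by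
    have := hs (fun _ => 1)
    simpa using this
  have h1 : 1 ≤ EP p (fun w => (tau w : ENNReal)) := by
    calc (1 : ENNReal) = EP p (fun _ => 1) := (EP_const p 1).symm
      _ ≤ _ := by
        apply EP_mono
        intro w hw
        have : 1 ≤ tau w := tau_pos (by rintro rfl; exact hw p0)
        exact_mod_cast this
  have hn0 : tsum fq ≠ 0 := by
    rw [hM]
    intro h
    rw [h] at h1
    simp at h1
  have hnt : tsum fq ≠ ⊤ := by rw [hM]; exact hfin
  refine ⟨PMF.normalize fq hn0 hnt, fun z hz => ?_, fun f => ?_⟩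
  · by_contra h
    apply hz
    rw [PMF.normalize_apply]
    simp only [hfq, if_neg h, mul_zero, zero_mul]
  · rw [EP, ← hs f, ← ENNReal.tsum_mul_left]
    congr 1
    ext z
    rw [PMF.normalize_apply, hM]
    ring

/-- tower map -/
def Gam (T : ℝ → ℝ) (G : ℕ → ℝ → ℝ) (z : (List ℕ × ℕ) × ℝ) : ℝ := T^[z.1.2] (GW G z.1.1 z.2)

/-- candidate invariant measure -/
noncomputable def nu0 (T : ℝ → ℝ) (G : ℕ → ℝ → ℝ) (Q : PMF (List ℕ × ℕ)) : Measure ℝ :=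
  Measure.map (Gam T G) (Q.toMeasure.prod mY)

namespace Ind
variable {T : ℝ → ℝ} {G D : ℕ → ℝ → ℝ} {db : ℕ → ℝ} {K c1 W γ η H : ℝ}
variable (d : Ind T G D db K c1 W γ η H)
include d

lemma Gam_meas : Measurable (Gam T G) :=
  measurable_from_prod_countable_right fun z => (d.hT.iterate z.2).comp (d.GW_meas z.1)

lemma nu0_prob (Q : PMF (List ℕ × ℕ)) : IsProbabilityMeasure (nu0 T G Q) :=
  Measure.isProbabilityMeasure_map d.Gam_meas.aemeasurable

lemma nu0_mp (Q : PMF (List ℕ × ℕ)) :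
    MeasurePreserving (Gam T G) (Q.toMeasure.prod mY) (nu0 T G Q) := ⟨d.Gam_meas, rfl⟩

variable (p : PMF (List ℕ)) (p0 : p [] = 0) (hp : Rep G p)
  (hfin : EP p (fun w => (tau w : ENNReal)) ≠ ⊤)
  (Q : PMF (List ℕ × ℕ))
  (hQ : ∀ f : List ℕ × ℕ → ENNReal, EP Q f = (EP p (fun w => (tau w : ENNReal)))⁻¹ *
        EP p (fun w => ∑ k ∈ Finset.range (tau w), f (w, k)))
include hQ

lemma nu0_lint (F : ℝ → ENNReal) (hF : Measurable F) :
    ∫⁻ x, F x ∂(nu0 T G Q) = (EP p (fun w => (tau w : ENNReal)))⁻¹ *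
      EP p (fun w => ∑ k ∈ Finset.range (tau w), ∫⁻ y, F (T^[k] (GW G w y)) ∂mY) := by
  rw [nu0, lintegral_map hF d.Gam_meas,
    lintegral_prod (fun z => F (Gam T G z)) (hF.comp d.Gam_meas).aemeasurable, EP_lint, hQ]
  rfl

include p0 in
lemma tau_ge1 : 1 ≤ EP p (fun w => (tau w : ENNReal)) := by
  calc (1 : ENNReal) = EP p (fun _ => 1) := (EP_const p 1).symm
    _ ≤ _ := by
      apply EP_mono
      intro w hw
      have : 1 ≤ tau w := tau_pos (by rintro rfl; exact hw p0)
      exact_mod_cast this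

include p0 hp hfin in
lemma mY_le : mY ≤ EP p (fun w => (tau w : ENNReal)) • nu0 T G Q := by
  have h1 := d.tau_ge1 p p0 Q hQ
  rw [Measure.le_iff]
  intro s hs
  have m1 : Measurable (s.indicator (1 : ℝ → ENNReal)) := measurable_one.indicator hs
  rw [Measure.smul_apply, ← lintegral_indicator_one hs, ← lintegral_indicator_one hs,
    d.nu0_lint p Q hQ _ m1, smul_eq_mul, ← mul_assoc, ENNReal.mul_inv_cancel, one_mul, hp _ m1]
  · apply EP_mono
    intro w hw
    have : 1 ≤ tau w := tau_pos (by rintro rfl; exact hw p0)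
    exact Finset.single_le_sum (f := fun k => ∫⁻ y, s.indicator 1 (T^[k] (GW G w y)) ∂mY)
      (fun _ _ => zero_le) (Finset.mem_range.2 this)
  · intro h
    rw [h] at h1
    simp at h1
  · exact hfin

include hp in
lemma nu0_inv : MeasurePreserving T (nu0 T G Q) (nu0 T G Q) := by
  refine ⟨d.hT, ?_⟩
  ext A hA
  have m1 : Measurable (A.indicator (1 : ℝ → ENNReal)) := measurable_one.indicator hA
  have m2 : Measurable (fun x => A.indicator (1 : ℝ → ENNReal) (T x)) := m1.comp d.hT
  rw [← lintegral_indicator_one hA, ← lintegral_indicator_one hA, lintegral_map m1 d.hT,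
    d.nu0_lint p Q hQ _ m1, d.nu0_lint p Q hQ _ m2]
  congr 1
  set F := A.indicator (1 : ℝ → ENNReal) with hF
  have hne : ∫⁻ y, F y ∂mY ≠ ⊤ := by
    rw [hF, lintegral_indicator_one hA]
    exact measure_ne_top _ _
  apply (ENNReal.add_left_inj hne).1
  have e1 : ∫⁻ y, F y ∂mY = EP p (fun w => ∫⁻ y, F (GW G w y) ∂mY) := hp F m1
  have e2 : ∫⁻ y, F y ∂mY = EP p (fun w => ∫⁻ y, F (T^[tau w] (GW G w y)) ∂mY) := by
    rw [← EP_const p (∫⁻ y, F y ∂mY)]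
    apply EP_congr
    intro w _
    apply lintegral_congr_ae
    filter_upwards [mY_ae] with y hy
    rw [d.T_GW w y hy]
  nth_rewrite 1 [e1]
  rw [e2, ← EP_add, ← EP_add]
  apply EP_congr
  intro w _
  rw [← Finset.sum_range_succ (fun k => ∫⁻ y, F (T^[k] (GW G w y)) ∂mY), Finset.sum_range_succ']
  simp only [Function.iterate_succ_apply', Function.iterate_zero, id]

omit hQ in
include hp p0 in
lemma mY_erg (A : Set ℝ) (hA : MeasurableSet A) (hTA : T ⁻¹' A = A) : mY A = 0 ∨ mY A = 1 := by
  have hmem : ∀ w y, y ∈ Yset → (GW G w y ∈ A ↔ y ∈ A) := by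
    intro w y hy
    have h1 : ∀ k x, x ∈ A ↔ T^[k] x ∈ A := by
      intro k
      induction k with
      | zero => intro x; rfl
      | succ k ih =>
        intro x
        rw [Function.iterate_succ_apply, ← ih]
        nth_rewrite 1 [← hTA]
        rfl
    rw [h1 (tau w) (GW G w y), d.T_GW w y hy]
  set a := mY.real A with ha
  -- correlation with the set decays
  have key : ∀ n : ℕ, ∀ g : ℝ → ℝ, Measurable g → ∀ Bg : ℝ, (∀ x, |g x| ≤ Bg) → ∀ ε : ℝ,
      (∀ u ∈ Yset, ∀ v ∈ Yset, |u - v| ≤ (1 / 2) ^ n → |g u - g v| ≤ ε) →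
      |∫ x, g x * (A.indicator 1 x - a) ∂mY| ≤ ε := by
    have hind : ∀ x, |A.indicator (1 : ℝ → ℝ) x - a| ≤ 1 := by
      intro x
      have a0 : 0 ≤ a := measureReal_nonneg
      have a1 : a ≤ 1 := measureReal_le_one
      by_cases hx : x ∈ A
      · rw [indicator_of_mem hx, Pi.one_apply, abs_le]; constructor <;> linarith
      · rw [indicator_of_notMem hx, abs_le]; constructor <;> linarith
    have hmi : Measurable fun x => A.indicator (1 : ℝ → ℝ) x - a :=
      (measurable_one.indicator hA).sub_const _
    have hii : Integrable (fun x => A.indicator (1 : ℝ → ℝ) x - a) mY :=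
      Integrable.of_bound hmi.aestronglyMeasurable 1 (ae_of_all _ hind)
    intro n
    induction n with
    | zero =>
      intro g hg Bg hB ε h
      have h34 : (3 / 4 : ℝ) ∈ Yset := ⟨by norm_num, by norm_num⟩
      have e0 : ∫ x, (A.indicator (1 : ℝ → ℝ) x - a) ∂mY = 0 := by
        rw [integral_sub _ (integrable_const _), integral_indicator_one hA]
        · simp [ha]
        · exact (integrable_const (1 : ℝ)).indicator hA
      have hgi : Integrable (fun x => g x * (A.indicator (1 : ℝ → ℝ) x - a)) mY := by
        apply hii.bdd_mul hg.aestronglyMeasurable (c := Bg) (ae_of_all _ hB)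
      have e1 : ∫ x, g x * (A.indicator 1 x - a) ∂mY =
          ∫ x, (g x - g (3 / 4)) * (A.indicator 1 x - a) ∂mY := by
        simp only [sub_mul (g _) (g (3 / 4))]
        rw [integral_sub hgi (hii.const_mul _), integral_const_mul, e0]
        ring
      rw [e1]
      have := norm_integral_le_of_norm_le_const (μ := mY) (C := ε)
        (f := fun x => (g x - g (3 / 4)) * (A.indicator 1 x - a)) (by
          filter_upwards [mY_ae] with x hx
          rw [Real.norm_eq_abs, abs_mul]
          have h1 := h x hx _ h34 (by have := Yabs hx h34; norm_num; norm_num at this; linarith)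
          calc |g x - g (3 / 4)| * |A.indicator 1 x - a| ≤ ε * 1 :=
                mul_le_mul h1 (hind x) (abs_nonneg _) ((abs_nonneg _).trans h1)
            _ = ε := mul_one _)
      simpa using this
    | succ n ih =>
      intro g hg Bg hB ε h
      have mp := Rep.mp d p hp
      have hmm : Measurable fun x => g x * (A.indicator (1 : ℝ → ℝ) x - a) := hg.mul hmi
      rw [← mp.map_eq, integral_map mp.measurable.aemeasurable hmm.aestronglyMeasurable,
        integral_prod]
      · have := norm_integral_le_of_norm_le_const (μ := p.toMeasure) (C := ε)
          (f := fun w => ∫ y, g (GW G w y) * (A.indicator 1 (GW G w y) - a) ∂mY) (by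
            have hne : ∀ᵐ w ∂p.toMeasure, w ≠ [] := by
              rw [ae_iff]
              have : {w : List ℕ | ¬ w ≠ []} = {[]} := by ext w; simp
              rw [this, p.toMeasure_apply_singleton _ (measurableSet_singleton _), p0]
            filter_upwards [hne] with w hw
            rw [Real.norm_eq_abs]
            have e : ∫ y, g (GW G w y) * (A.indicator 1 (GW G w y) - a) ∂mY =
                ∫ y, g (GW G w y) * (A.indicator 1 y - a) ∂mY := by
              apply integral_congr_ae
              filter_upwards [mY_ae] with y hy
              have : A.indicator (1 : ℝ → ℝ) (GW G w y) = A.indicator 1 y := by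
                by_cases hyA : y ∈ A
                · rw [indicator_of_mem hyA, indicator_of_mem ((hmem w y hy).2 hyA)]; rfl
                · rw [indicator_of_notMem hyA, indicator_of_notMem (mt (hmem w y hy).1 hyA)]
              rw [this]
            rw [e]
            apply ih (fun y => g (GW G w y)) (hg.comp (d.GW_meas w)) Bg (fun x => hB _)
            intro u hu v hv huv
            apply h _ (d.GW_Y w u hu) _ (d.GW_Y w v hv)
            have := d.GW_c2 w hw u v hu hv
            rw [pow_succ]
            linarith)
        simpa using this
      · refine Integrable.of_bound (hmm.comp mp.measurable).aestronglyMeasurable Bg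
          (ae_of_all _ fun z => ?_)
        rw [Real.norm_eq_abs]
        simp only [abs_mul]
        calc |g (GW G z.1 z.2)| * |A.indicator 1 (GW G z.1 z.2) - a| ≤ Bg * 1 :=
              mul_le_mul (hB _) (hind _) (abs_nonneg _) ((abs_nonneg _).trans (hB 0))
          _ = Bg := mul_one _
  have hres : mY.restrict A = (mY A) • mY := by
    have : IsFiniteMeasure ((mY A) • mY) := ⟨by
      rw [Measure.smul_apply, smul_eq_mul]
      exact ENNReal.mul_lt_top (measure_lt_top _ _) (measure_lt_top _ _)⟩
    apply ext_of_forall_integral_eq_of_IsFiniteMeasure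
    intro f
    have hf := f.continuous
    have hfB : ∀ x, |f x| ≤ ‖f‖ := fun x => f.norm_coe_le_norm x
    have hfi : Integrable f mY := Integrable.of_bound hf.aestronglyMeasurable ‖f‖ (ae_of_all _ hfB)
    have hz : |∫ x, f x * (A.indicator 1 x - a) ∂mY| ≤ 0 := by
      apply le_of_forall_pos_le_add
      intro ε hε
      rw [zero_add]
      have huc := (isCompact_Icc (a := (1 / 2 : ℝ)) (b := 1)).uniformContinuousOn_of_continuous
        hf.continuousOn
      obtain ⟨δ, hδ, hu⟩ := Metric.uniformContinuousOn_iff.1 huc ε hε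
      obtain ⟨n, hn⟩ := exists_pow_lt_of_lt_one hδ (show (1 / 2 : ℝ) < 1 by norm_num)
      refine key n f hf.measurable ‖f‖ hfB ε fun u hu' v hv' huv => ?_
      have := hu u (Ioo_subset_Icc_self hu') v (Ioo_subset_Icc_self hv')
        (by rw [Real.dist_eq]; linarith)
      rw [Real.dist_eq] at this
      exact this.le
    have hz' := abs_eq_zero.1 (le_antisymm hz (abs_nonneg _))
    rw [integral_smul_measure, ← integral_indicator hA]
    have e1 : ∫ x, f x * (A.indicator 1 x - a) ∂mY = ∫ x, A.indicator f x ∂mY - a * ∫ x, f x ∂mY := by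
      rw [← integral_const_mul, ← integral_sub (hfi.indicator hA) (hfi.const_mul _)]
      apply integral_congr_ae
      refine ae_of_all _ fun x => ?_
      by_cases hx : x ∈ A
      · simp [hx]; ring
      · simp [hx]; ring
    rw [e1] at hz'
    rw [smul_eq_mul]
    change _ = a * _
    linarith
  have h2 := congrArg (fun μ => μ A) hres
  simp only [Measure.restrict_apply_self, Measure.smul_apply, smul_eq_mul] at h2
  by_cases h0 : mY A = 0
  · exact Or.inl h0
  · right
    have := (ENNReal.mul_right_inj h0 (measure_ne_top mY A) (b := 1) (c := mY A)).1
      (by rw [mul_one]; exact h2)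
    exact this.symm

include p0 hp hfin in
lemma nu0_erg : Ergodic T (nu0 T G Q) := by
  have := d.nu0_prob Q
  refine ⟨d.nu0_inv p hp Q hQ, ⟨fun A hA hTA => ?_⟩⟩
  have h1 : ∀ k x, x ∈ A ↔ T^[k] x ∈ A := by
    intro k
    induction k with
    | zero => intro x; rfl
    | succ k ih =>
      intro x
      rw [Function.iterate_succ_apply, ← ih]
      nth_rewrite 1 [← hTA]
      rfl
  have hval : nu0 T G Q A = mY A := by
    have m1 : Measurable (A.indicator (1 : ℝ → ENNReal)) := measurable_one.indicator hA
    rw [← lintegral_indicator_one hA, ← lintegral_indicator_one hA, d.nu0_lint p Q hQ _ m1]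
    have : EP p (fun w => ∑ k ∈ Finset.range (tau w),
        ∫⁻ y, A.indicator 1 (T^[k] (GW G w y)) ∂mY) =
        EP p (fun w => (∫⁻ y, A.indicator 1 y ∂mY) * (tau w : ENNReal)) := by
      apply EP_congr
      intro w _
      have : ∀ k ∈ Finset.range (tau w), ∫⁻ y, A.indicator 1 (T^[k] (GW G w y)) ∂mY =
          ∫⁻ y, A.indicator 1 y ∂mY := by
        intro k hk
        apply lintegral_congr_ae
        filter_upwards [mY_ae] with y hy
        have e : T^[k] (GW G w y) ∈ A ↔ y ∈ A := by
          rw [← h1 k, h1 (tau w), d.T_GW w y hy]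
        by_cases hyA : y ∈ A
        · rw [indicator_of_mem hyA, indicator_of_mem (e.2 hyA)]; rfl
        · rw [indicator_of_notMem hyA, indicator_of_notMem (mt e.1 hyA)]
      rw [Finset.sum_congr rfl this]
      simp [mul_comm]
    rw [this, EP_mul, mul_comm, mul_assoc, ENNReal.mul_inv_cancel, mul_one]
    · have h1 := d.tau_ge1 p p0 Q hQ
      intro h
      rw [h] at h1
      simp at h1
    · exact hfin
  rw [eventuallyConst_set']
  rcases d.mY_erg p p0 hp A hA hTA with h | h
  · left
    rw [ae_eq_empty, hval, h]
  · right
    rw [ae_eq_univ, prob_compl_eq_zero_iff hA, hval, h]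

include p0 hp hfin in
lemma unique (ν : Measure ℝ) [IsProbabilityMeasure ν] (hsupp : ν (Icc (0 : ℝ) 1)ᶜ = 0)
    (hac : ν ≪ volume) (hinv : MeasurePreserving T ν ν) : ν = nu0 T G Q := by
  have := d.nu0_prob Q
  refine (d.nu0_erg p p0 hp hfin Q hQ).eq_of_absolutelyContinuous hinv ?_
  refine Measure.AbsolutelyContinuous.mk fun B hB h0 => ?_
  have h1 : nu0 T G Q (T ⁻¹' B) = 0 := by
    rw [(d.nu0_inv p hp Q hQ).measure_preimage hB.nullMeasurableSet, h0]
  have h2 : mY (T ⁻¹' B) = 0 := by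
    have := Measure.le_iff.1 (d.mY_le p p0 hp hfin Q hQ) _ (d.hT hB)
    rw [Measure.smul_apply, h1, smul_zero] at this
    exact le_antisymm this zero_le
  have h3 : volume ((T ⁻¹' B) ∩ Yset) = 0 := by
    rw [mY, Measure.smul_apply, Measure.restrict_apply (d.hT hB), smul_eq_mul, mul_eq_zero] at h2
    rcases h2 with h2 | h2
    · norm_num at h2
    · exact h2
  have h4 : volume (B ∩ Ioo 0 1) = 0 := by
    have hsub : B ∩ Ioo (0 : ℝ) 1 ⊆ (fun y : ℝ => 2 * y - 1) '' ((T ⁻¹' B) ∩ Yset) := by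
      rintro x ⟨hx, hx1, hx2⟩
      have hy : (x + 1) / 2 ∈ Yset := ⟨by linarith, by linarith⟩
      refine ⟨(x + 1) / 2, ⟨?_, hy⟩, by ring⟩
      show T ((x + 1) / 2) ∈ B
      rw [d.hT2 _ hy]
      convert hx using 1
      ring
    refine measure_mono_null hsub ?_
    have e : (fun y : ℝ => 2 * y - 1) = fun y => (-1 : ℝ) + 2 * y := by ext; ring
    have e2 : (fun y : ℝ => 2 * y - 1) '' ((T ⁻¹' B) ∩ Yset) =
        (fun z : ℝ => -1 + z) '' ((fun y : ℝ => 2 * y) '' ((T ⁻¹' B) ∩ Yset)) := by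
      rw [image_image, e]
    rw [e2]
    rw [image_add_left, measure_preimage_add]
    open scoped Pointwise in
    have e3 : ((fun y : ℝ => 2 * y) '' ((T ⁻¹' B) ∩ Yset)) = (2 : ℝ) • ((T ⁻¹' B) ∩ Yset) := rfl
    rw [e3, Measure.addHaar_smul, h3, mul_zero]
  have h5 : ν (B ∩ Ioo 0 1) = 0 := hac h4
  have h6 : ν {0} = 0 := hac (by simp)
  have h7 : ν {1} = 0 := hac (by simp)
  refine measure_mono_null ?_ (measure_union_null (measure_union_null h5 hsupp)
    (measure_union_null h6 h7))
  intro x hx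
  by_cases hx0 : x = 0
  · right; left; exact hx0
  by_cases hx1 : x = 1
  · right; right; exact hx1
  by_cases hxI : x ∈ Icc (0 : ℝ) 1
  · left; left
    exact ⟨hx, lt_of_le_of_ne hxI.1 (Ne.symm hx0), lt_of_le_of_ne hxI.2 hx1⟩
  · left; right; exact hxI

end Ind
end S18

namespace S18

/-- Birkhoff sums -/
noncomputable def BS (T ψ : ℝ → ℝ) (n : ℕ) (x : ℝ) : ℝ := ∑ k ∈ Finset.range n, ψ (T^[k] x)

lemma BS_add (T ψ : ℝ → ℝ) (n k : ℕ) (x : ℝ) :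
    BS T ψ (n + k) x = BS T ψ n x + BS T ψ k (T^[n] x) := by
  simp only [BS]
  rw [Finset.sum_range_add]
  congr 1
  apply Finset.sum_congr rfl
  intro j _
  rw [add_comm n j, Function.iterate_add_apply]

lemma BS_bd (T ψ : ℝ → ℝ) (B : ℝ) (hB : ∀ x, |ψ x| ≤ B) (n : ℕ) (x : ℝ) :
    |BS T ψ n x| ≤ B * n := by
  refine (Finset.abs_sum_le_sum_abs _ _).trans ?_
  refine (Finset.sum_le_sum fun k _ => hB _).trans (le_of_eq ?_)
  simp [mul_comm]

lemma BS_shift (T ψ : ℝ → ℝ) (B : ℝ) (hB : ∀ x, |ψ x| ≤ B) (n k : ℕ) (x : ℝ) :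
    |BS T ψ k x - BS T ψ k (T^[n] x)| ≤ 2 * B * n := by
  have h1 := BS_add T ψ n k x
  have h2 := BS_add T ψ k n x
  rw [add_comm k n] at h2
  have e : BS T ψ k x - BS T ψ k (T^[n] x) = BS T ψ n x - BS T ψ n (T^[k] x) := by linarith
  rw [e]
  have h3 := abs_sub (BS T ψ n x) (BS T ψ n (T^[k] x))
  have h4 := BS_bd T ψ B hB n x
  have h5 := BS_bd T ψ B hB n (T^[k] x)
  linarith

namespace Ind
variable {T : ℝ → ℝ} {G D : ℕ → ℝ → ℝ} {db : ℕ → ℝ} {K c1 W γ η H : ℝ}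
variable (d : Ind T G D db K c1 W γ η H)
include d

lemma Vsum (l : List ℕ) (u v : ℝ) (hu : u ∈ Yset) (hv : v ∈ Yset) :
    ∑ i ∈ Finset.range (tau l), |T^[i] (GW G l u) - T^[i] (GW G l v)| ^ η ≤
      |H| / (1 - (1 / 2) ^ η) * |u - v| ^ η := by
  have hη := d.hη.1
  have h12 : ((1 : ℝ) / 2) ^ η < 1 := Real.rpow_lt_one (by norm_num) (by norm_num) hη
  have hpos : 0 < 1 - ((1 : ℝ) / 2) ^ η := by linarith
  set H2 := |H| / (1 - (1 / 2) ^ η) with hH2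
  have hH20 : 0 ≤ H2 := by positivity
  have e : H2 * (1 / 2) ^ η + |H| = H2 := by
    rw [hH2]; field_simp; ring
  induction l generalizing u v with
  | nil => simp only [tau, Finset.range_zero, Finset.sum_empty]; positivity
  | cons r l ih =>
    simp only [tau, GW]
    rw [Finset.sum_range_add]
    have h1 := ih _ _ (d.hGY r u hu) (d.hGY r v hv)
    have h2 := d.hH r u hu v hv
    have h3 : ∀ i, T^[tau l + i] (GW G l (G r u)) = T^[i] (G r u) := by
      intro i
      rw [add_comm, Function.iterate_add_apply, d.T_GW l _ (d.hGY r u hu)]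
    have h4 : ∀ i, T^[tau l + i] (GW G l (G r v)) = T^[i] (G r v) := by
      intro i
      rw [add_comm, Function.iterate_add_apply, d.T_GW l _ (d.hGY r v hv)]
    simp only [h3, h4]
    have h5 : |G r u - G r v| ^ η ≤ (1 / 2) ^ η * |u - v| ^ η := by
      rw [← Real.mul_rpow (by norm_num) (abs_nonneg _)]
      apply Real.rpow_le_rpow (abs_nonneg _) _ hη.le
      have := d.hGc r u hu v hv
      linarith
    have h6 : H * |u - v| ^ η ≤ |H| * |u - v| ^ η :=
      mul_le_mul_of_nonneg_right (le_abs_self H) (by positivity)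
    have h7 := mul_le_mul_of_nonneg_left h5 hH20
    calc _ ≤ H2 * |G r u - G r v| ^ η + H * |u - v| ^ η := add_le_add h1 h2
      _ ≤ H2 * ((1 / 2) ^ η * |u - v| ^ η) + |H| * |u - v| ^ η := add_le_add h7 h6
      _ = (H2 * (1 / 2) ^ η + |H|) * |u - v| ^ η := by ring
      _ = _ := by rw [e]

lemma BS_word (ψ : ℝ → ℝ) (L : ℝ) (hL : ∀ x y, |ψ x - ψ y| ≤ L * |x - y| ^ η)
    (l : List ℕ) (N : ℕ) (hN : N ≤ tau l) (u v : ℝ) (hu : u ∈ Yset) (hv : v ∈ Yset) :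
    |BS T ψ N (GW G l u) - BS T ψ N (GW G l v)| ≤ L * (|H| / (1 - (1 / 2) ^ η)) := by
  have hη := d.hη.1
  have h12 : ((1 : ℝ) / 2) ^ η < 1 := Real.rpow_lt_one (by norm_num) (by norm_num) hη
  have hpos : 0 < 1 - ((1 : ℝ) / 2) ^ η := by linarith
  have hL0 : 0 ≤ L := by
    have := hL 1 0
    simp at this
    exact (abs_nonneg _).trans this
  have h1 := d.Vsum l u v hu hv
  simp only [BS]
  rw [← Finset.sum_sub_distrib]
  calc _ ≤ ∑ i ∈ Finset.range N, |ψ (T^[i] (GW G l u)) - ψ (T^[i] (GW G l v))| :=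
        Finset.abs_sum_le_sum_abs _ _
    _ ≤ ∑ i ∈ Finset.range N, L * |T^[i] (GW G l u) - T^[i] (GW G l v)| ^ η :=
        Finset.sum_le_sum fun i _ => hL _ _
    _ ≤ ∑ i ∈ Finset.range (tau l), L * |T^[i] (GW G l u) - T^[i] (GW G l v)| ^ η := by
        apply Finset.sum_le_sum_of_subset_of_nonneg (Finset.range_mono hN)
        intro i _ _
        positivity
    _ = L * ∑ i ∈ Finset.range (tau l), |T^[i] (GW G l u) - T^[i] (GW G l v)| ^ η := by
        rw [Finset.mul_sum]
    _ ≤ L * (|H| / (1 - (1 / 2) ^ η) * |u - v| ^ η) := mul_le_mul_of_nonneg_left h1 hL0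
    _ ≤ L * (|H| / (1 - (1 / 2) ^ η) * 1) := by
        apply mul_le_mul_of_nonneg_left _ hL0
        apply mul_le_mul_of_nonneg_left _ (by positivity)
        apply Real.rpow_le_one (abs_nonneg _) _ hη.le
        have := Yabs hu hv
        linarith
    _ = _ := by rw [mul_one]

theorem decoup (ν : Measure ℝ) [IsProbabilityMeasure ν] (hsupp : ν (Icc (0 : ℝ) 1)ᶜ = 0)
    (hac : ν ≪ volume) (hinv : MeasurePreserving T ν ν) (ψ : ℝ → ℝ) (hψ : Measurable ψ)
    (L : ℝ) (hL : ∀ x y, |ψ x - ψ y| ≤ L * |x - y| ^ η) (B : ℝ) (hB : ∀ x, |ψ x| ≤ B) :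
    ∃ c C : ℝ, Nonempty (Decoup (List ℕ) (List ℕ × ℕ) mY ν (BS T ψ) γ c C) := by
  obtain ⟨p, c, Bp, hc, hBp, p0, hp, htail⟩ := d.key
  have hη := d.hη.1
  have h12 : ((1 : ℝ) / 2) ^ η < 1 := Real.rpow_lt_one (by norm_num) (by norm_num) hη
  have hpos : 0 < 1 - ((1 : ℝ) / 2) ^ η := by linarith
  have hL0 : 0 ≤ L := by
    have := hL 1 0
    simp at this
    exact (abs_nonneg _).trans this
  have hB0 : 0 ≤ B := (abs_nonneg _).trans (hB 0)
  set V : ℝ := L * (|H| / (1 - (1 / 2) ^ η)) with hV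
  have hV0 : 0 ≤ V := by positivity
  set C0 : ℝ := 2 * B + V + 1 with hC0
  have hC01 : 1 ≤ C0 := by linarith
  have hC00 : 0 ≤ C0 := by linarith
  obtain ⟨c2, B2, hc2, hB2, hbig⟩ := ew_big d.hγ p c Bp C0 hc hC01 htail
  set f : ℕ → ENNReal := fun n => ENNReal.ofReal (Real.exp (c2 * (C0 * ((n : ℝ) + 1)) ^ γ)) with hf
  have hbig' : EP p (fun w => ((tau w : ENNReal) + 1) * f (tau w)) ≤ ENNReal.ofReal B2 := hbig
  have fmono : Monotone f := by
    intro n k hnk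
    apply ENNReal.ofReal_le_ofReal
    apply Real.exp_le_exp.2
    apply mul_le_mul_of_nonneg_left _ hc2.le
    apply Real.rpow_le_rpow (by positivity) _ d.hγ.1.le
    apply mul_le_mul_of_nonneg_left _ hC00
    have : (n : ℝ) ≤ k := by exact_mod_cast hnk
    linarith
  have f1 : ∀ n, 1 ≤ f n := by
    intro n
    rw [hf, ← ENNReal.ofReal_one]
    apply ENNReal.ofReal_le_ofReal
    apply Real.one_le_exp
    positivity
  have hfB : f 0 ≤ ENNReal.ofReal B2 := by
    refine le_trans ?_ hbig'
    rw [← EP_const p (f 0)]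
    apply EP_mono
    intro w _
    calc f 0 ≤ 1 * f (tau w) := by rw [one_mul]; exact fmono (Nat.zero_le _)
      _ ≤ _ := mul_le_mul' le_add_self le_rfl
  have htau : EP p (fun w => (tau w : ENNReal)) ≤ ENNReal.ofReal B2 := by
    refine le_trans ?_ hbig'
    apply EP_mono
    intro w _
    calc (tau w : ENNReal) = tau w * 1 := (mul_one _).symm
      _ ≤ _ := mul_le_mul' le_self_add (f1 _)
  have hfin : EP p (fun w => (tau w : ENNReal)) ≠ ⊤ := (htau.trans_lt ENNReal.ofReal_lt_top).ne
  obtain ⟨Q, hQ1, hQ⟩ := exists_Q p p0 hfin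
  have hν : ν = nu0 T G Q := d.unique p p0 hp hfin Q hQ ν hsupp hac hinv
  choose q hq1 hq2 hq3 using d.PN p p0 hp
  have hCB : B2 ≤ 2 * B2 + B := by linarith
  have h34 : (3 / 4 : ℝ) ∈ Yset := ⟨by norm_num, by norm_num⟩
  refine ⟨c2, 2 * B2 + B, ⟨?_⟩⟩
  refine
    { P := fun N => (q N).toMeasure
      hP := fun N => inferInstance
      Γ := fun _ z => GW G z.1 z.2
      a := fun N s => BS T ψ N (GW G s (3 / 4))
      U := fun N s => C0 * (((tau s - N : ℕ) : ℝ) + 1)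
      ha := fun N => Measurable.of_discrete
      hU := fun N => Measurable.of_discrete
      hΓ := fun N => Rep.mp d (q N) (hq2 N)
      hD := ?_
      haB := ?_
      hU0 := fun N s => by positivity
      hUi := ?_
      Q := Q.toMeasure
      hQ := inferInstance
      Γ' := Gam T G
      U' := fun z => C0 * ((tau z.1 : ℝ) + 1)
      hU' := Measurable.of_discrete
      hΓ' := hν ▸ d.nu0_mp Q
      hD' := ?_
      hU0' := fun z => by positivity
      hUi' := ?_
      hmν := ?_
      hS := ?_
      hS0 := fun x => by simp [BS]
      hSL := ?_
      hC := by linarith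
      hc := hc2
      hγ := d.hγ
      hm := inferInstance
      hν := inferInstance }
  · intro N
    have a1 : ∀ᵐ z ∂((q N).toMeasure.prod mY), N ≤ tau z.1 := by
      apply Measure.quasiMeasurePreserving_fst.ae (p := fun s : List ℕ => N ≤ tau s)
      rw [ae_iff_of_countable]
      intro s hs
      apply hq1 N
      rwa [(q N).toMeasure_apply_singleton _ (measurableSet_singleton _)] at hs
    have a2 : ∀ᵐ z ∂((q N).toMeasure.prod mY), z.2 ∈ Yset :=
      Measure.quasiMeasurePreserving_snd.ae mY_ae
    filter_upwards [a1, a2] with z hz1 hz2 k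
    rw [BS_add]
    have h1 := d.BS_word ψ L hL z.1 N hz1 z.2 (3 / 4) hz2 h34
    have h2 := BS_shift T ψ B hB (tau z.1 - N) k (T^[N] (GW G z.1 z.2))
    rw [← Function.iterate_add_apply, Nat.sub_add_cancel hz1, d.T_GW _ _ hz2] at h2
    have e : BS T ψ N (GW G z.1 z.2) + BS T ψ k (T^[N] (GW G z.1 z.2)) -
        BS T ψ N (GW G z.1 (3 / 4)) - BS T ψ k z.2 =
        (BS T ψ N (GW G z.1 z.2) - BS T ψ N (GW G z.1 (3 / 4))) +
        (BS T ψ k (T^[N] (GW G z.1 z.2)) - BS T ψ k z.2) := by ring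
    rw [e]
    refine (abs_add_le _ _).trans ?_
    set n : ℝ := ((tau z.1 - N : ℕ) : ℝ) with hn
    have hn0 : 0 ≤ n := by positivity
    rw [hC0]
    have := mul_nonneg hV0 hn0
    linarith
  · intro N s
    refine (BS_bd T ψ B hB N _).trans ?_
    apply mul_le_mul_of_nonneg_right _ (Nat.cast_nonneg _)
    linarith
  · intro N
    rw [EP_lint]
    refine (hq3 N f).trans ?_
    calc f 0 + ∑ i ∈ Finset.range (N + 1), EP p (fun w => if i ≤ tau w then f (tau w - i) else 0)
        ≤ ENNReal.ofReal B2 + ENNReal.ofReal B2 :=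
          add_le_add hfB ((sum_f_le f fmono p (N + 1)).trans hbig')
      _ = ENNReal.ofReal (B2 + B2) := (ENNReal.ofReal_add hB2 hB2).symm
      _ ≤ _ := ENNReal.ofReal_le_ofReal (by linarith)
  · have a1 : ∀ᵐ z ∂(Q.toMeasure.prod mY), z.1.2 < tau z.1.1 := by
      apply Measure.quasiMeasurePreserving_fst.ae (p := fun z : List ℕ × ℕ => z.2 < tau z.1)
      rw [ae_iff_of_countable]
      intro s hs
      apply hQ1
      rwa [Q.toMeasure_apply_singleton _ (measurableSet_singleton _)] at hs
    have a2 : ∀ᵐ z ∂(Q.toMeasure.prod mY), z.2 ∈ Yset :=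
      Measure.quasiMeasurePreserving_snd.ae mY_ae
    filter_upwards [a1, a2] with z hz1 hz2 k
    have h2 := BS_shift T ψ B hB (tau z.1.1 - z.1.2) k (Gam T G z)
    rw [Gam, ← Function.iterate_add_apply, Nat.sub_add_cancel hz1.le, d.T_GW _ _ hz2] at h2
    refine h2.trans ?_
    have : ((tau z.1.1 - z.1.2 : ℕ) : ℝ) ≤ tau z.1.1 := by exact_mod_cast Nat.sub_le _ _
    have h3 : 2 * B * ((tau z.1.1 - z.1.2 : ℕ) : ℝ) ≤ 2 * B * (tau z.1.1 : ℝ) :=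
      mul_le_mul_of_nonneg_left this (by linarith)
    have h4 : (0 : ℝ) ≤ tau z.1.1 := Nat.cast_nonneg _
    rw [hC0]
    have := mul_nonneg hV0 h4
    linarith
  · rw [EP_lint, hQ]
    have h1 := d.tau_ge1 p p0 Q hQ
    calc _ ≤ 1 * EP p (fun w => ((tau w : ENNReal) + 1) * f (tau w)) := by
          apply mul_le_mul'
          · exact ENNReal.inv_le_one.2 h1
          · apply EP_mono
            intro w _
            show ∑ _k ∈ Finset.range (tau w), f (tau w) ≤ ((tau w : ENNReal) + 1) * f (tau w)
            rw [Finset.sum_const, Finset.card_range, nsmul_eq_mul]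
            exact mul_le_mul' le_self_add le_rfl
      _ ≤ ENNReal.ofReal B2 := by rw [one_mul]; exact hbig'
      _ ≤ _ := ENNReal.ofReal_le_ofReal hCB
  · rw [hν]
    refine (d.mY_le p p0 hp hfin Q hQ).trans ?_
    rw [Measure.le_iff]
    intro s _
    rw [Measure.smul_apply, Measure.smul_apply]
    exact mul_le_mul' (htau.trans (ENNReal.ofReal_le_ofReal hCB)) le_rfl
  · intro n
    unfold BS
    exact Finset.measurable_sum _ fun k _ => hψ.comp (d.hT.iterate k)
  · intro n k x
    rw [BS_add, add_sub_cancel_left]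
    refine (BS_bd T ψ B hB k _).trans ?_
    apply mul_le_mul_of_nonneg_right _ (Nat.cast_nonneg _)
    linarith

end Ind
end S18

namespace S18

lemma rpow_neg_convex {p : ℝ} (hp : 0 < p) : ConvexOn ℝ (Ioi (0 : ℝ)) (fun x => x ^ (-p)) := by
  have hd : ∀ x ∈ Ioi (0 : ℝ), HasDerivAt (fun x : ℝ => x ^ (-p)) (-p * x ^ (-p - 1)) x :=
    fun x hx => Real.hasDerivAt_rpow_const (Or.inl (ne_of_gt hx))
  apply MonotoneOn.convexOn_of_deriv (convex_Ioi 0)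
  · exact fun x hx => (hd x hx).continuousAt.continuousWithinAt
  · rw [interior_Ioi]
    exact fun x hx => (hd x hx).differentiableAt.differentiableWithinAt
  · rw [interior_Ioi]
    intro x hx y hy hxy
    rw [(hd x hx).deriv, (hd y hy).deriv]
    have := Real.rpow_le_rpow_of_nonpos hx hxy (show -p - 1 ≤ 0 by linarith)
    nlinarith

/-- derivative of the left branch, in the variable `-log x` -/
noncomputable def hh (β L : ℝ) : ℝ :=
  1 + Real.log 2 ^ β * L ^ (-β) + Real.log 2 ^ β * β * L ^ (-β - 1)

/-- the left branch -/
noncomputable def Fb (β x : ℝ) : ℝ := x * (1 + Real.log 2 ^ β * (-Real.log x) ^ (-β))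

lemma c_pos (β : ℝ) : 0 < Real.log 2 ^ β := Real.rpow_pos_of_pos (Real.log_pos (by norm_num)) _

lemma hh_convex {β : ℝ} (hβ : 0 < β) : ConvexOn ℝ (Ioi (0 : ℝ)) (hh β) := by
  have h1 := (rpow_neg_convex hβ).smul (c_pos β).le
  have h2 := (rpow_neg_convex (show 0 < β + 1 by linarith)).smul (mul_pos (c_pos β) hβ).le
  have h3 := ((convexOn_const (1 : ℝ) (convex_Ioi (0 : ℝ))).add h1).add h2
  refine h3.congr ?_
  intro x _
  simp only [Pi.add_apply, smul_eq_mul, hh]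
  rw [show -(β + 1) = -β - 1 by ring]

lemma hh_anti {β : ℝ} (hβ : 0 < β) {x y : ℝ} (hx : 0 < x) (hxy : x ≤ y) : hh β y ≤ hh β x := by
  have h1 := Real.rpow_le_rpow_of_nonpos hx hxy (show -β ≤ 0 by linarith)
  have h2 := Real.rpow_le_rpow_of_nonpos hx hxy (show -β - 1 ≤ 0 by linarith)
  unfold hh
  have := mul_le_mul_of_nonneg_left h1 (c_pos β).le
  have := mul_le_mul_of_nonneg_left h2 (mul_pos (c_pos β) hβ).le
  linarith

lemma hh_one {β : ℝ} (hβ : 0 < β) {x : ℝ} (hx : 0 < x) : 1 ≤ hh β x := by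
  have h1 := Real.rpow_pos_of_pos hx (-β)
  have h2 := Real.rpow_pos_of_pos hx (-β - 1)
  have := mul_pos (c_pos β) h1
  have := mul_pos (mul_pos (c_pos β) hβ) h2
  unfold hh
  linarith

lemma neglog_pos {x : ℝ} (h0 : 0 < x) (h1 : x < 1) : 0 < -Real.log x := by
  have := Real.log_neg h0 h1; linarith

lemma neglog_le {x y : ℝ} (h0 : 0 < x) (h : x ≤ y) : -Real.log y ≤ -Real.log x := by
  have := Real.log_le_log h0 h; linarith

lemma Fb_deriv (β : ℝ) {x : ℝ} (h0 : 0 < x) (h1 : x < 1) :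
    HasDerivAt (Fb β) (hh β (-Real.log x)) x := by
  have hL := neglog_pos h0 h1
  have e1 : HasDerivAt (fun x => -Real.log x) (-x⁻¹) x := (Real.hasDerivAt_log h0.ne').neg
  have e2 := e1.rpow_const (p := -β) (Or.inl hL.ne')
  have e3 := (hasDerivAt_id x).mul ((e2.const_mul (Real.log 2 ^ β)).const_add 1)
  refine e3.congr_deriv ?_
  simp only [id, hh]
  field_simp

lemma Fq_le {β : ℝ} (hβ : 0 < β) {x : ℝ} (h0 : 0 < x) (h1 : x ≤ 1 / 2) :
    Real.log 2 ^ β * (-Real.log x) ^ (-β) ≤ 1 := by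
  have h2 : Real.log 2 ≤ -Real.log x := by
    have := Real.log_le_log h0 h1
    rw [one_div, Real.log_inv] at this
    linarith
  have hl : 0 < Real.log 2 := Real.log_pos (by norm_num)
  have := Real.rpow_le_rpow_of_nonpos hl h2 (show -β ≤ 0 by linarith)
  calc _ ≤ Real.log 2 ^ β * (Real.log 2) ^ (-β) := mul_le_mul_of_nonneg_left this (c_pos β).le
    _ = 1 := by rw [← Real.rpow_add hl]; simp

lemma Fq_pos {β : ℝ} {x : ℝ} (h0 : 0 < x) (h1 : x ≤ 1 / 2) :
    0 < Real.log 2 ^ β * (-Real.log x) ^ (-β) :=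
  mul_pos (c_pos β) (Real.rpow_pos_of_pos (neglog_pos h0 (by linarith)) _)

lemma Fb_zero (β : ℝ) : Fb β 0 = 0 := by simp [Fb]

lemma Fb_half (β : ℝ) : Fb β (1 / 2) = 1 := by
  have hl : 0 < Real.log 2 := Real.log_pos (by norm_num)
  rw [Fb, one_div, Real.log_inv, neg_neg, ← Real.rpow_add hl]
  norm_num

lemma Fb_le {β : ℝ} (hβ : 0 < β) {x : ℝ} (h : x ∈ Icc (0 : ℝ) (1 / 2)) : Fb β x ≤ 2 * x := by
  rcases h.1.eq_or_lt with h0 | h0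
  · rw [← h0, Fb_zero]; norm_num
  · have := Fq_le hβ h0 h.2
    rw [Fb]; nlinarith

/-- slope at least one -/
lemma Fb_slope {β : ℝ} (hβ : 0 < β) {x y : ℝ} (hx : 0 ≤ x) (hxy : x ≤ y) (hy : y ≤ 1 / 2) :
    y - x ≤ Fb β y - Fb β x := by
  rcases hx.eq_or_lt with h0 | h0
  · rw [← h0, Fb_zero]
    rcases (h0 ▸ hxy : 0 ≤ y).eq_or_lt with h1 | h1
    · rw [← h1, Fb_zero]
    · have := mul_pos h1 (Fq_pos (β := β) h1 hy)
      rw [Fb]; linarith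
  · have hy0 := h0.trans_le hxy
    have h2 : (-Real.log x) ^ (-β) ≤ (-Real.log y) ^ (-β) :=
      Real.rpow_le_rpow_of_nonpos (neglog_pos hy0 (by linarith)) (neglog_le h0 hxy) (by linarith)
    have h3 := mul_le_mul_of_nonneg_left h2 (c_pos β).le
    have h4 := mul_le_mul hxy h3 (Fq_pos (β := β) h0 (hxy.trans hy)).le hy0.le
    rw [Fb, Fb]; linarith

lemma Fb_cont {β : ℝ} (hβ : 0 < β) : ContinuousOn (Fb β) (Icc 0 (1 / 2)) := by
  intro x hx
  rcases hx.1.eq_or_lt with h0 | h0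
  · rw [← h0]
    have h1 : Tendsto (fun x : ℝ => 2 * x) (nhdsWithin 0 (Icc 0 (1 / 2))) (nhds 0) := by
      have : Tendsto (fun x : ℝ => 2 * x) (nhds 0) (nhds (2 * 0)) :=
        (continuous_const.mul continuous_id).tendsto 0
      rw [mul_zero] at this
      exact this.mono_left nhdsWithin_le_nhds
    rw [ContinuousWithinAt, Fb_zero]
    refine tendsto_of_tendsto_of_tendsto_of_le_of_le' tendsto_const_nhds h1 ?_ ?_
    · filter_upwards [self_mem_nhdsWithin] with y hy
      have := Fb_slope hβ le_rfl hy.1 hy.2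
      rw [Fb_zero] at this
      have := hy.1
      linarith
    · filter_upwards [self_mem_nhdsWithin] with y hy
      exact Fb_le hβ hy
  · exact (Fb_deriv β h0 (by linarith [hx.2])).continuousAt.continuousWithinAt

lemma Fb_convex {β : ℝ} (hβ : 0 < β) : ConvexOn ℝ (Icc 0 (1 / 2)) (Fb β) := by
  apply MonotoneOn.convexOn_of_deriv (convex_Icc _ _) (Fb_cont hβ)
  · rw [interior_Icc]
    exact fun x hx =>
      (Fb_deriv β hx.1 (by linarith [hx.2])).differentiableAt.differentiableWithinAt
  · rw [interior_Icc]
    intro x hx y hy hxy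
    rw [(Fb_deriv β hx.1 (by linarith [hx.2])).deriv, (Fb_deriv β hy.1 (by linarith [hy.2])).deriv]
    exact hh_anti hβ (neglog_pos hy.1 (by linarith [hy.2])) (neglog_le hx.1 hxy)

lemma g_exists {β : ℝ} (hβ : 0 < β) (y : ℝ) :
    ∃ x ∈ Icc (0 : ℝ) (1 / 2), Fb β x = max 0 (min y 1) := by
  have := intermediate_value_Icc (show (0 : ℝ) ≤ 1 / 2 by norm_num) (Fb_cont hβ)
  rw [Fb_zero, Fb_half] at this
  exact this ⟨le_max_left _ _, max_le (by norm_num) (min_le_right _ _)⟩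

/-- the inverse of the left branch -/
structure IB (β : ℝ) (g : ℝ → ℝ) : Prop where
  hβ : 0 < β
  mem : ∀ y, g y ∈ Icc (0 : ℝ) (1 / 2)
  inv : ∀ y ∈ Icc (0 : ℝ) 1, Fb β (g y) = y
  mono : Monotone g

lemma IB_exists {β : ℝ} (hβ : 0 < β) : ∃ g, IB β g := by
  choose g h1 h2 using g_exists hβ
  refine ⟨g, hβ, h1, ?_, ?_⟩
  · intro y hy
    rw [h2, min_eq_left hy.2, max_eq_right hy.1]
  · intro x y hxy
    by_contra hc
    push Not at hc
    have := Fb_slope hβ (h1 y).1 hc.le (h1 x).2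
    rw [h2, h2] at this
    have h3 : max 0 (min x 1) ≤ max 0 (min y 1) := max_le_max le_rfl (min_le_min hxy le_rfl)
    linarith

namespace IB
variable {β : ℝ} {g : ℝ → ℝ}

lemma lip (d : IB β g) {x y : ℝ} (hx : 0 ≤ x) (hxy : x ≤ y) (hy : y ≤ 1) :
    g y - g x ≤ y - x := by
  have := Fb_slope d.hβ (d.mem x).1 (d.mono hxy) (d.mem y).2
  rwa [d.inv x ⟨hx, hxy.trans hy⟩, d.inv y ⟨hx.trans hxy, hy⟩] at this

lemma left (d : IB β g) {x : ℝ} (hx : x ∈ Icc (0 : ℝ) (1 / 2)) : g (Fb β x) = x := by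
  have h0 : 0 ≤ Fb β x := by
    have := Fb_slope d.hβ le_rfl hx.1 hx.2
    rw [Fb_zero] at this
    have := hx.1
    linarith
  have h1 : Fb β x ≤ 1 := by have := Fb_le d.hβ hx; have := hx.2; linarith
  have h2 := d.inv _ ⟨h0, h1⟩
  rcases le_total (g (Fb β x)) x with h | h
  · have := Fb_slope d.hβ (d.mem _).1 h hx.2
    linarith
  · have := Fb_slope d.hβ hx.1 h (d.mem _).2
    linarith

lemma g0 (d : IB β g) : g 0 = 0 := by
  have := d.left (x := 0) (by norm_num)
  rwa [Fb_zero] at this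

lemma g1 (d : IB β g) : g 1 = 1 / 2 := by
  have := d.left (x := 1 / 2) (by norm_num)
  rwa [Fb_half] at this

lemma smono (d : IB β g) {x y : ℝ} (hx : 0 ≤ x) (hxy : x < y) (hy : y ≤ 1) : g x < g y := by
  rcases (d.mono hxy.le).eq_or_lt with h | h
  · have h1 := d.inv x ⟨hx, hxy.le.trans hy⟩
    have h2 := d.inv y ⟨hx.trans hxy.le, hy⟩
    rw [h] at h1
    linarith
  · exact h

lemma pos (d : IB β g) {x : ℝ} (hx : 0 < x) (hx1 : x ≤ 1) : 0 < g x := by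
  have := d.smono le_rfl hx hx1
  rwa [d.g0] at this

lemma le_self (d : IB β g) {x : ℝ} (hx : 0 ≤ x) (hx1 : x ≤ 1) : g x ≤ x := by
  have := d.lip le_rfl hx hx1
  rw [d.g0] at this; linarith

lemma half_le (d : IB β g) {x : ℝ} (hx : 0 ≤ x) (hx1 : x ≤ 1) : x ≤ 2 * g x := by
  have := Fb_le d.hβ (d.mem x)
  rwa [d.inv x ⟨hx, hx1⟩] at this

lemma mem1 (d : IB β g) (x : ℝ) : g x ∈ Icc (0 : ℝ) 1 :=
  ⟨(d.mem x).1, (d.mem x).2.trans (by norm_num)⟩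

lemma concave (d : IB β g) : ConcaveOn ℝ (Icc 0 1) g := by
  refine ⟨convex_Icc _ _, ?_⟩
  intro x hx y hy a b ha hb hab
  have h1 := (Fb_convex d.hβ).2 (d.mem x) (d.mem y) ha hb hab
  have hm := convex_Icc (0 : ℝ) (1 / 2) (d.mem x) (d.mem y) ha hb hab
  rw [d.inv x hx, d.inv y hy] at h1
  have := d.mono h1
  rwa [d.left hm] at this

lemma cont (d : IB β g) {x : ℝ} (hx : x ∈ Ioo (0 : ℝ) 1) : ContinuousAt g x :=
  d.concave.continuousOn_interior.continuousAt (by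
    rw [interior_Icc]; exact isOpen_Ioo.mem_nhds hx)

lemma contOn (d : IB β g) : ContinuousOn g (Icc 0 1) := by
  have : LipschitzOnWith 1 g (Icc 0 1) := by
    apply LipschitzOnWith.of_le_add
    intro x hx y hy
    rw [Real.dist_eq]
    rcases le_total x y with h | h
    · have := d.mono h
      have := abs_nonneg (x - y)
      linarith
    · have := d.lip hy.1 h hx.2
      have := le_abs_self (x - y)
      linarith
  exact this.continuousOn

lemma deriv (d : IB β g) {x : ℝ} (hx : x ∈ Ioo (0 : ℝ) 1) :
    HasDerivAt g (hh β (-Real.log (g x)))⁻¹ x := by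
  have h0 := d.pos hx.1 hx.2.le
  have h1 : g x < 1 := (d.mem x).2.trans_lt (by norm_num)
  refine HasDerivAt.of_local_left_inverse (d.cont hx) (Fb_deriv β h0 h1) ?_ ?_
  · have := hh_one d.hβ (neglog_pos h0 h1)
    linarith
  · filter_upwards [isOpen_Ioo.mem_nhds hx] with y hy
    exact d.inv y ⟨hy.1.le, hy.2.le⟩

end IB

lemma Tmap_left {γ x : ℝ} (h0 : 0 < x) (h1 : x ≤ 1 / 2) : Tmap γ x = Fb (1 / γ - 1) x := by
  rw [Tmap, if_neg (not_le.2 h0), if_pos h1, Fb, abs_of_neg (Real.log_neg h0 (by linarith)),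
    Real.rpow_neg (neglog_pos h0 (by linarith)).le, div_eq_mul_inv]

lemma Tmap_right {γ x : ℝ} (h1 : 1 / 2 < x) : Tmap γ x = 2 * x - 1 := by
  rw [Tmap, if_neg (by linarith), if_neg (by linarith)]

lemma Tmap_meas (γ : ℝ) : Measurable (Tmap γ) := by
  unfold Tmap
  refine Measurable.ite measurableSet_Iic measurable_const (Measurable.ite measurableSet_Iic ?_ ?_)
  · refine measurable_id.mul (measurable_const.add (measurable_const.div ?_))
    have : Measurable fun x : ℝ => |Real.log x| := by fun_prop
    exact this.pow_const _
  · fun_prop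

lemma Tmap_mem {γ : ℝ} (hγ : γ ∈ Ioo (0 : ℝ) 1) {x : ℝ} (hx : x ∈ Icc (0 : ℝ) 1) :
    Tmap γ x ∈ Icc (0 : ℝ) 1 := by
  have hβ : 0 < 1 / γ - 1 := by
    have := one_lt_one_div hγ.1 hγ.2; linarith
  rcases hx.1.eq_or_lt with h0 | h0
  · rw [← h0, Tmap, if_pos le_rfl]; norm_num
  · rcases le_or_gt x (1 / 2) with h1 | h1
    · rw [Tmap_left h0 h1]
      have h2 := Fb_le hβ ⟨hx.1, h1⟩
      have h3 := Fb_slope hβ le_rfl h0.le h1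
      rw [Fb_zero] at h3
      constructor <;> linarith
    · rw [Tmap_right h1]
      have := hx.2
      constructor <;> linarith

end S18

namespace S18

/-- the preimages of one -/
noncomputable def xs (g : ℝ → ℝ) (k : ℕ) : ℝ := g^[k] 1

/-- derivative of the iterates of the inverse branch -/
noncomputable def ED (β : ℝ) (g : ℝ → ℝ) : ℕ → ℝ → ℝ
  | 0 => fun _ => 1
  | k + 1 => fun u => (hh β (-Real.log (g^[k + 1] u)))⁻¹ * ED β g k u

namespace IB
variable {β : ℝ} {g : ℝ → ℝ}

lemma it_mem (d : IB β g) (k : ℕ) {x : ℝ} (hx : x ∈ Icc (0 : ℝ) 1) : g^[k] x ∈ Icc (0 : ℝ) 1 := by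
  induction k with
  | zero => exact hx
  | succ k ih => rw [Function.iterate_succ_apply']; exact d.mem1 _

lemma it_pos (d : IB β g) (k : ℕ) {x : ℝ} (h0 : 0 < x) (h1 : x ≤ 1) : 0 < g^[k] x := by
  induction k with
  | zero => exact h0
  | succ k ih =>
    rw [Function.iterate_succ_apply']; exact d.pos ih (d.it_mem k ⟨h0.le, h1⟩).2

lemma it_zero (d : IB β g) (k : ℕ) : g^[k] 0 = 0 := Function.iterate_fixed d.g0 k

lemma it_mono (d : IB β g) (k : ℕ) : Monotone g^[k] := d.mono.iterate k

lemma it_smono (d : IB β g) (k : ℕ) {x y : ℝ} (hx : 0 ≤ x) (hxy : x < y) (hy : y ≤ 1) :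
    g^[k] x < g^[k] y := by
  induction k with
  | zero => exact hxy
  | succ k ih =>
    rw [Function.iterate_succ_apply', Function.iterate_succ_apply']
    exact d.smono (d.it_mem k ⟨hx, hxy.le.trans hy⟩).1 ih (d.it_mem k ⟨hx.trans hxy.le, hy⟩).2

lemma it_lip (d : IB β g) (k : ℕ) {x y : ℝ} (hx : 0 ≤ x) (hxy : x ≤ y) (hy : y ≤ 1) :
    g^[k] y - g^[k] x ≤ y - x := by
  induction k with
  | zero => exact le_rfl
  | succ k ih =>
    rw [Function.iterate_succ_apply', Function.iterate_succ_apply']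
    exact (d.lip (d.it_mem k ⟨hx, hxy.trans hy⟩).1 (d.it_mono k hxy)
      (d.it_mem k ⟨hx.trans hxy, hy⟩).2).trans ih

lemma it_concave (d : IB β g) (k : ℕ) : ConcaveOn ℝ (Icc 0 1) g^[k] := by
  induction k with
  | zero => exact concaveOn_id (convex_Icc _ _)
  | succ k ih =>
    rw [Function.iterate_succ']
    refine ⟨convex_Icc _ _, ?_⟩
    intro x hx y hy a b ha hb hab
    have h1 := ih.2 hx hy ha hb hab
    exact (d.concave.2 (d.it_mem k hx) (d.it_mem k hy) ha hb hab).trans (d.mono h1)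

lemma it_contOn (d : IB β g) (k : ℕ) : ContinuousOn g^[k] (Icc 0 1) := by
  induction k with
  | zero => exact continuousOn_id
  | succ k ih =>
    rw [Function.iterate_succ']
    exact d.contOn.comp ih (fun x hx => d.it_mem k hx)

lemma it_lt_one (d : IB β g) (k : ℕ) {x : ℝ} (hx : x ∈ Ioo (0 : ℝ) 1) : g^[k] x < 1 :=
  (d.it_smono k hx.1.le hx.2 le_rfl).trans_le (d.it_mem k (by norm_num)).2

lemma it_deriv (d : IB β g) (k : ℕ) {x : ℝ} (hx : x ∈ Ioo (0 : ℝ) 1) :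
    HasDerivAt g^[k] (ED β g k x) x := by
  induction k with
  | zero => exact hasDerivAt_id x
  | succ k ih =>
    rw [Function.iterate_succ']
    have h1 := d.deriv (x := g^[k] x) ⟨d.it_pos k hx.1 hx.2.le, d.it_lt_one k hx⟩
    have h2 := h1.comp x ih
    rw [← Function.iterate_succ_apply' g k x] at h2
    exact h2

lemma xs_zero : xs g 0 = 1 := rfl

lemma xs_one (d : IB β g) : xs g 1 = 1 / 2 := d.g1

lemma xs_succ (k : ℕ) : xs g (k + 1) = g (xs g k) := Function.iterate_succ_apply' _ _ _

lemma xs_half (d : IB β g) (k : ℕ) : g^[k] (1 / 2) = xs g (k + 1) := by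
  rw [← d.g1, xs, Function.iterate_succ_apply]

lemma xs_pos (d : IB β g) (k : ℕ) : 0 < xs g k := d.it_pos k one_pos le_rfl

lemma xs_le_one (d : IB β g) (k : ℕ) : xs g k ≤ 1 := (d.it_mem k (by norm_num)).2

lemma xs_lt (d : IB β g) (k : ℕ) : xs g (k + 1) < xs g k := by
  rw [← d.xs_half]
  exact d.it_smono k (by norm_num) (by norm_num) le_rfl

lemma xs_anti (d : IB β g) : Antitone (xs g) := antitone_nat_of_succ_le fun k => (d.xs_lt k).le

lemma xs_le_half (d : IB β g) (k : ℕ) : xs g (k + 1) ≤ 1 / 2 := by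
  rw [xs_succ]; exact (d.mem _).2

lemma xs_two (d : IB β g) (k : ℕ) : xs g k ≤ 2 * xs g (k + 1) := by
  rw [xs_succ]; exact d.half_le (d.xs_pos k).le (d.xs_le_one k)

lemma xs_gap (d : IB β g) (k : ℕ) : xs g (k + 1) - xs g (k + 2) ≤ xs g k - xs g (k + 1) := by
  rw [xs_succ (k + 1), xs_succ k]
  exact d.lip (d.mem1 _).1 (by rw [← xs_succ (g := g)]; exact (d.xs_lt k).le) (d.xs_le_one k)

/-- slope bound by the size -/
lemma it_slope (d : IB β g) (k : ℕ) {u v : ℝ} (hu : 1 / 2 ≤ u) (huv : u ≤ v) (hv : v ≤ 1) :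
    g^[k] v - g^[k] u ≤ 2 * xs g k * (v - u) := by
  rcases huv.eq_or_lt with h | h
  · rw [h]; simp
  · have h1 := (d.it_concave k).slope_anti_adjacent (x := 0) (y := u) (z := v) (by norm_num)
      ⟨by linarith, hv⟩ (by linarith) h
    rw [d.it_zero, sub_zero, sub_zero, div_le_iff₀ (by linarith)] at h1
    refine h1.trans (mul_le_mul_of_nonneg_right ?_ (by linarith))
    rw [div_le_iff₀ (by linarith)]
    have h2 : g^[k] u ≤ xs g k := d.it_mono k (by linarith)
    have := d.xs_pos k
    nlinarith

/-- slope bound by the gap -/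
lemma it_slope2 (d : IB β g) (k : ℕ) {u v : ℝ} (hu : 1 / 2 ≤ u) (huv : u ≤ v) (hv : v ≤ 1) :
    g^[k] v - g^[k] u ≤ (xs g (k + 1) - xs g (k + 2)) / (1 / 2 - xs g 2) * (v - u) := by
  have hx2 : xs g 2 < 1 / 2 := by have := d.xs_lt 1; rwa [d.xs_one] at this
  have hx0 := d.xs_pos 2
  have e1 : g^[k] (xs g 2) = xs g (k + 2) := by
    rw [xs, xs, ← Function.iterate_add_apply]
  rcases huv.eq_or_lt with h | h
  · rw [h]; simp
  · have h1 := (d.it_concave k).slope_anti_adjacent (x := xs g 2) (y := u) (z := v)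
      ⟨hx0.le, d.xs_le_one 2⟩ ⟨by linarith, hv⟩ (by linarith) h
    have h2 : (g^[k] u - g^[k] (xs g 2)) / (u - xs g 2) ≤
        (g^[k] (1 / 2) - g^[k] (xs g 2)) / (1 / 2 - xs g 2) := by
      rcases hu.eq_or_lt with h' | h'
      · rw [← h']
      · have h3 := (d.it_concave k).slope_anti_adjacent (x := xs g 2) (y := 1 / 2) (z := u)
          ⟨hx0.le, d.xs_le_one 2⟩ ⟨by linarith, by linarith⟩ (by linarith) h'
        rw [div_le_div_iff₀ (by linarith) (by linarith)] at h3 ⊢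
        nlinarith
    rw [e1, d.xs_half] at h2
    rw [e1] at h1
    have h3 := h1.trans h2
    rwa [div_le_iff₀ (by linarith)] at h3

lemma T_it (d : IB (1 / γ - 1) g) (j m : ℕ) {u : ℝ} (h0 : 0 < u) (h1 : u ≤ 1) :
    (Tmap γ)^[j] (g^[j + m] u) = g^[m] u := by
  induction j with
  | zero => simp
  | succ j ih =>
    rw [Function.iterate_succ_apply, show j + 1 + m = (j + m) + 1 by ring,
      Function.iterate_succ_apply']
    have h2 := d.it_mem (j + m) ⟨h0.le, h1⟩
    have h3 := d.it_pos (j + m) h0 h1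
    rw [Tmap_left (d.pos h3 h2.2) (d.mem _).2, d.inv _ h2, ih]

/-- logarithmic decay rate -/
lemma ell_grow (d : IB (1 / γ - 1) g) (hγ : γ ∈ Ioo (0 : ℝ) 1) (k : ℕ) :
    (k : ℝ) * (Real.log 2 ^ (1 / γ - 1) / 2) ≤ (-Real.log (xs g k)) ^ (1 / γ) := by
  have hγ0 := hγ.1
  induction k with
  | zero =>
    rw [xs_zero]; simp
    rw [Real.zero_rpow (by positivity)]
  | succ k ih =>
    set c := Real.log 2 ^ (1 / γ - 1) with hc
    have p1 := d.xs_pos (k + 1)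
    have l1 := d.xs_le_half k
    have e1 : Fb (1 / γ - 1) (xs g (k + 1)) = xs g k := by
      rw [xs_succ]; exact d.inv _ ⟨(d.xs_pos k).le, d.xs_le_one k⟩
    set L := -Real.log (xs g (k + 1)) with hL
    set L0 := -Real.log (xs g k) with hL0
    have L00 : 0 ≤ L0 := by
      have := Real.log_nonpos (d.xs_pos k).le (d.xs_le_one k); linarith
    have LL : L0 ≤ L := neglog_le p1 (d.xs_lt k).le
    have Lp : 0 < L := neglog_pos p1 (by linarith)
    have q0 : 0 < c * L ^ (-(1 / γ - 1)) := Fq_pos p1 l1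
    have q1 : c * L ^ (-(1 / γ - 1)) ≤ 1 := Fq_le d.hβ p1 l1
    set t := c * L ^ (-(1 / γ - 1)) with ht
    have e2 : L - L0 = Real.log (1 + t) := by
      rw [hL, hL0, ← e1, Fb, Real.log_mul p1.ne' (by linarith)]
      ring
    have e3 : t / 2 ≤ L - L0 := by
      rw [e2]
      refine le_trans ?_ (Real.one_sub_inv_le_log_of_pos (by linarith))
      rw [← sub_nonneg]
      have : 1 - (1 + t)⁻¹ - t / 2 = t * (1 - t) / (2 * (1 + t)) := by field_simp; ring
      rw [this]
      apply div_nonneg <;> nlinarith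
    have e4 : L ^ (1 / γ) = L ^ (1 / γ - 1) * L := by
      rw [← Real.rpow_add_one Lp.ne']; ring_nf
    have e5 : L0 ^ (1 / γ) ≤ L ^ (1 / γ - 1) * L0 := by
      rcases L00.eq_or_lt with h | h
      · rw [← h, Real.zero_rpow (by positivity), mul_zero]
      · have : L0 ^ (1 / γ) = L0 ^ (1 / γ - 1) * L0 := by
          rw [← Real.rpow_add_one h.ne']; ring_nf
        rw [this]
        exact mul_le_mul_of_nonneg_right (Real.rpow_le_rpow L00 LL d.hβ.le) L00
    have e6 : L ^ (1 / γ - 1) * t = c := by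
      rw [ht, mul_left_comm, ← Real.rpow_add Lp]; simp
    have e7 := mul_le_mul_of_nonneg_left e3 (Real.rpow_nonneg Lp.le (1 / γ - 1))
    rw [e4]
    push_cast
    nlinarith

lemma xs_decay (d : IB (1 / γ - 1) g) (hγ : γ ∈ Ioo (0 : ℝ) 1) :
    ∃ κ : ℝ, 0 < κ ∧ ∀ k : ℕ, xs g k ≤ Real.exp (-κ * (k : ℝ) ^ γ) := by
  have hγ0 := hγ.1
  have hc := c_pos (1 / γ - 1)
  refine ⟨(Real.log 2 ^ (1 / γ - 1) / 2) ^ γ, by positivity, fun k => ?_⟩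
  have h1 := d.ell_grow hγ k
  have L00 : 0 ≤ -Real.log (xs g k) := by
    have := Real.log_nonpos (d.xs_pos k).le (d.xs_le_one k); linarith
  have h2 := Real.rpow_le_rpow (by positivity) h1 hγ0.le
  rw [← Real.rpow_mul L00, one_div, inv_mul_cancel₀ hγ0.ne', Real.rpow_one,
    Real.mul_rpow (by positivity) (by positivity)] at h2
  rw [← Real.log_le_iff_le_exp (d.xs_pos k)]
  rw [← one_div] at h2
  linarith

end IB

lemma summable_sexp {κ γ : ℝ} (hκ : 0 < κ) (hγ : 0 < γ) :
    Summable fun k : ℕ => Real.exp (-κ * (k : ℝ) ^ γ) := by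
  have h1 := (isLittleO_exp_neg_mul_rpow_atTop hκ (-2 / γ)).comp_tendsto
    ((tendsto_rpow_atTop hγ).comp tendsto_natCast_atTop_atTop)
  have h2 : Summable fun k : ℕ => ((k : ℝ) ^ γ) ^ (-2 / γ) := by
    have : Summable fun k : ℕ => (k : ℝ) ^ (-2 : ℝ) := by
      rw [Real.summable_nat_rpow]; norm_num
    refine this.congr fun k => ?_
    rw [← Real.rpow_mul (Nat.cast_nonneg k)]
    congr 1
    field_simp
  exact summable_of_isBigO_nat h2 h1.isBigO

end S18

namespace S18
namespace IB
variable {β : ℝ} {g : ℝ → ℝ}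

lemma Y1 {u : ℝ} (hu : u ∈ Yset) : u ∈ Ioo (0 : ℝ) 1 := by
  have h1 : 1 / 2 < u ∧ u < 1 := hu
  constructor <;> linarith

lemma L_pos (d : IB β g) (k : ℕ) {u : ℝ} (hu : u ∈ Ioo (0 : ℝ) 1) : 0 < -Real.log (g^[k] u) :=
  neglog_pos (d.it_pos k hu.1 hu.2.le) (d.it_lt_one k hu)

lemma ED_pos (d : IB β g) (k : ℕ) {u : ℝ} (hu : u ∈ Ioo (0 : ℝ) 1) : 0 < ED β g k u := by
  induction k with
  | zero => exact one_pos
  | succ k ih =>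
    have := hh_one d.hβ (d.L_pos (k + 1) hu)
    show 0 < (hh β (-Real.log (g^[k + 1] u)))⁻¹ * ED β g k u
    positivity

lemma ED_anti (d : IB β g) (k : ℕ) {u v : ℝ} (hu : u ∈ Ioo (0 : ℝ) 1) (hv : v ∈ Ioo (0 : ℝ) 1)
    (huv : u ≤ v) : ED β g k v ≤ ED β g k u := by
  induction k with
  | zero => exact le_rfl
  | succ k ih =>
    have h1 := hh_one d.hβ (d.L_pos (k + 1) hu)
    have h2 := hh_anti d.hβ (d.L_pos (k + 1) hv)
      (neglog_le (d.it_pos (k + 1) hu.1 hu.2.le) (d.it_mono (k + 1) huv))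
    show (hh β (-Real.log (g^[k + 1] v)))⁻¹ * ED β g k v ≤
      (hh β (-Real.log (g^[k + 1] u)))⁻¹ * ED β g k u
    apply mul_le_mul _ ih (d.ED_pos k hv).le (by positivity)
    exact inv_anti₀ (by linarith) h2

lemma ED_dist (d : IB β g) (k : ℕ) {u v : ℝ} (hu : u ∈ Ioo (0 : ℝ) 1) (hv : v ∈ Ioo (0 : ℝ) 1)
    (huv : u ≤ v) : ED β g k u ≤ Real.exp (∑ i ∈ Finset.range k,
      (hh β (-Real.log (g^[i + 1] v)) - hh β (-Real.log (g^[i + 1] u)))) * ED β g k v := by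
  induction k with
  | zero => simp [ED]
  | succ k ih =>
    have h1 := hh_one d.hβ (d.L_pos (k + 1) hu)
    have h2 := hh_anti d.hβ (d.L_pos (k + 1) hv)
      (neglog_le (d.it_pos (k + 1) hu.1 hu.2.le) (d.it_mono (k + 1) huv))
    rw [Finset.sum_range_succ, Real.exp_add]
    show (hh β (-Real.log (g^[k + 1] u)))⁻¹ * ED β g k u ≤ _ * _ *
      ((hh β (-Real.log (g^[k + 1] v)))⁻¹ * ED β g k v)
    set a := hh β (-Real.log (g^[k + 1] u))
    set b := hh β (-Real.log (g^[k + 1] v))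
    have h3 : a⁻¹ ≤ Real.exp (b - a) * b⁻¹ := by
      have h4 := Real.add_one_le_exp (b - a)
      rw [← div_eq_mul_inv, le_div_iff₀ (by linarith), inv_mul_le_iff₀ (by linarith)]
      nlinarith
    have h5 := mul_le_mul h3 ih (d.ED_pos k hu).le (mul_nonneg (Real.exp_pos _).le (inv_nonneg.2 (by linarith)))
    linarith

/-- reference points for the telescoping bound -/
noncomputable def mm (g : ℝ → ℝ) (i : ℕ) : ℝ :=
  if i = 0 then -Real.log (xs g 1) / 2 else -Real.log (xs g i)

lemma mm_pos (d : IB β g) (i : ℕ) : 0 < mm g i := by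
  have h : ∀ i, 0 < -Real.log (xs g (i + 1)) := fun i =>
    neglog_pos (d.xs_pos _) ((d.xs_le_half i).trans_lt (by norm_num))
  rw [mm]
  split_ifs with hi
  · exact half_pos (h 0)
  · obtain ⟨j, rfl⟩ := Nat.exists_eq_succ_of_ne_zero hi
    exact h j

lemma mm_gap (d : IB β g) (i : ℕ) :
    (xs g i - xs g (i + 1)) / (2 * xs g i) ≤ mm g (i + 1) - mm g i := by
  have p0 := d.xs_pos i
  have p1 := d.xs_pos (i + 1)
  have h1 : (xs g i - xs g (i + 1)) / xs g i ≤ -Real.log (xs g (i + 1)) + Real.log (xs g i) := by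
    have := Real.one_sub_inv_le_log_of_pos (div_pos p0 p1)
    rw [Real.log_div p0.ne' p1.ne', inv_div] at this
    rw [sub_div, div_self p0.ne']
    linarith
  have h2 : (xs g i - xs g (i + 1)) / (2 * xs g i) = (xs g i - xs g (i + 1)) / xs g i / 2 := by
    field_simp
  have h3 : 0 ≤ (xs g i - xs g (i + 1)) / xs g i := by
    have := d.xs_lt i
    apply div_nonneg <;> linarith
  rw [h2, mm, mm, if_neg (by omega)]
  split_ifs with hi
  · subst hi
    rw [xs_zero, Real.log_one] at h1
    rw [xs_zero] at h3 ⊢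
    linarith
  · linarith

lemma tele (d : IB β g) (i : ℕ) {u v : ℝ} (hu : u ∈ Yset) (hv : v ∈ Yset) (huv : u ≤ v) :
    hh β (-Real.log (g^[i + 1] v)) - hh β (-Real.log (g^[i + 1] u)) ≤
      8 / (1 / 2 - xs g 2) * (v - u) * (hh β (mm g i) - hh β (mm g (i + 1))) := by
  have hu1 : 1 / 2 < u ∧ u < 1 := hu
  have hv1 : 1 / 2 < v ∧ v < 1 := hv
  have hx2 : xs g 2 < 1 / 2 := by have := d.xs_lt 1; rwa [d.xs_one] at this
  have p0 := d.xs_pos i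
  have p1 := d.xs_pos (i + 1)
  have p2 := d.xs_pos (i + 2)
  have m0 := d.mm_pos i
  have gap := d.mm_gap i
  have hgp : 0 < (xs g i - xs g (i + 1)) / (2 * xs g i) := by
    have := d.xs_lt i
    apply div_pos <;> linarith
  set a := g^[i + 1] u with ha
  set b := g^[i + 1] v with hb
  have hab : a ≤ b := d.it_mono _ huv
  have hxa : xs g (i + 2) < a := by
    rw [← d.xs_half]; exact d.it_smono _ (by norm_num) hu1.1 hu1.2.le
  have hbx : b < xs g (i + 1) := d.it_smono _ (by linarith) hv1.2 le_rfl
  have ha0 : 0 < a := by linarith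
  -- convexity
  have hm1 : mm g (i + 1) = -Real.log (xs g (i + 1)) := by rw [mm, if_neg (by omega)]
  have hLb : mm g (i + 1) < -Real.log b := by
    rw [hm1]; have := Real.log_lt_log (ha0.trans_le hab) hbx; linarith
  have hLab : -Real.log b ≤ -Real.log a := neglog_le ha0 hab
  have cv := hh_convex d.hβ
  have hmm : mm g i < mm g (i + 1) := by linarith
  have hanti := hh_anti d.hβ m0 hmm.le
  have hdiff : -Real.log a - -Real.log b ≤ 8 / (1 / 2 - xs g 2) * (v - u) *
      (mm g (i + 1) - mm g i) := by
    have h1 : -Real.log a - -Real.log b ≤ (b - a) / a := by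
      have := Real.log_le_sub_one_of_pos (div_pos (ha0.trans_le hab) ha0)
      rw [Real.log_div (ha0.trans_le hab).ne' ha0.ne'] at this
      rw [sub_div, div_self ha0.ne']
      linarith
    have h2 : (b - a) / a ≤ (b - a) / xs g (i + 2) :=
      div_le_div_of_nonneg_left (by linarith) p2 hxa.le
    have h3 := d.it_slope2 (i + 1) hu1.1.le huv hv1.2.le
    have h4 := (d.xs_gap (i + 1)).trans (d.xs_gap i)
    have h5 : xs g i ≤ 4 * xs g (i + 2) := by
      have := d.xs_two i; have := d.xs_two (i + 1)
      rw [show i + 1 + 1 = i + 2 by ring] at this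
      linarith
    have h6 : b - a ≤ (xs g i - xs g (i + 1)) / (1 / 2 - xs g 2) * (v - u) := by
      refine h3.trans (mul_le_mul_of_nonneg_right ?_ (by linarith))
      exact div_le_div_of_nonneg_right h4 (by linarith)
    calc _ ≤ (b - a) / xs g (i + 2) := h1.trans h2
      _ ≤ (xs g i - xs g (i + 1)) / (1 / 2 - xs g 2) * (v - u) / xs g (i + 2) :=
          div_le_div_of_nonneg_right h6 p2.le
      _ ≤ (xs g i - xs g (i + 1)) / (1 / 2 - xs g 2) * (v - u) / (xs g i / 4) := by
          apply div_le_div_of_nonneg_left _ (by linarith) (by linarith)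
          have := d.xs_lt i
          apply mul_nonneg (div_nonneg _ _) <;> linarith
      _ = 8 / (1 / 2 - xs g 2) * (v - u) * ((xs g i - xs g (i + 1)) / (2 * xs g i)) := by
          have : 1 / 2 - xs g 2 ≠ 0 := by linarith
          field_simp
          ring
      _ ≤ _ := by
          apply mul_le_mul_of_nonneg_left gap
          apply mul_nonneg (div_nonneg _ _) <;> linarith
  rcases hLab.eq_or_lt with h | h
  · rw [h, sub_self]
    apply mul_nonneg (mul_nonneg (div_nonneg _ _) _) <;> linarith
  · have s1 := cv.slope_mono_adjacent (x := mm g (i + 1)) (y := -Real.log b) (z := -Real.log a)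
      (d.mm_pos _) (mem_Ioi.2 (by linarith)) hLb h
    have s2 := cv.slope_mono_adjacent (x := mm g i) (y := mm g (i + 1)) (z := -Real.log b)
      m0 (mem_Ioi.2 (by linarith)) hmm hLb
    have s3 := s2.trans s1
    rw [div_le_div_iff₀ (by linarith) (by linarith)] at s3
    set P := hh β (mm g i)
    set Q := hh β (mm g (i + 1))
    set R := 8 / (1 / 2 - xs g 2) * (v - u)
    have s4 := mul_le_mul_of_nonneg_left hdiff (show 0 ≤ P - Q by linarith)
    have s5 : (hh β (-Real.log b) - hh β (-Real.log a)) * (mm g (i + 1) - mm g i) ≤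
        (R * (P - Q)) * (mm g (i + 1) - mm g i) := by linarith
    exact le_of_mul_le_mul_right s5 (by linarith)

lemma ED_dist' (d : IB β g) : ∃ K, 0 ≤ K ∧ ∀ k, ∀ u ∈ Yset, ∀ v ∈ Yset,
    ED β g k u ≤ Real.exp (K * |u - v|) * ED β g k v := by
  have hx2 : xs g 2 < 1 / 2 := by have := d.xs_lt 1; rwa [d.xs_one] at this
  have hh0 : 0 ≤ hh β (mm g 0) := by have := hh_one d.hβ (d.mm_pos 0); linarith
  have hK0 : 0 ≤ 8 / (1 / 2 - xs g 2) * hh β (mm g 0) :=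
    mul_nonneg (div_nonneg (by norm_num) (by linarith)) hh0
  refine ⟨8 / (1 / 2 - xs g 2) * hh β (mm g 0), hK0, ?_⟩
  intro k u hu v hv
  rcases le_total u v with h | h
  · refine (d.ED_dist k (Y1 hu) (Y1 hv) h).trans
      (mul_le_mul_of_nonneg_right (Real.exp_le_exp.2 ?_) (d.ED_pos k (Y1 hv)).le)
    calc _ ≤ ∑ i ∈ Finset.range k, 8 / (1 / 2 - xs g 2) * (v - u) *
          (hh β (mm g i) - hh β (mm g (i + 1))) :=
          Finset.sum_le_sum fun i _ => d.tele i hu hv h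
      _ = 8 / (1 / 2 - xs g 2) * (v - u) * (hh β (mm g 0) - hh β (mm g k)) := by
          rw [← Finset.mul_sum, Finset.sum_range_sub']
      _ ≤ 8 / (1 / 2 - xs g 2) * (v - u) * hh β (mm g 0) := by
          apply mul_le_mul_of_nonneg_left
          · have := hh_one d.hβ (d.mm_pos k); linarith
          · apply mul_nonneg (div_nonneg _ _) <;> linarith
      _ = _ := by rw [abs_of_nonpos (by linarith)]; ring
  · refine (d.ED_anti k (Y1 hv) (Y1 hu) h).trans ?_
    have := d.ED_pos k (Y1 hv)
    have h2 : 1 ≤ Real.exp (8 / (1 / 2 - xs g 2) * hh β (mm g 0) * |u - v|) :=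
      Real.one_le_exp (mul_nonneg hK0 (abs_nonneg _))
    nlinarith

lemma ED_le (d : IB β g) (k : ℕ) {u : ℝ} (hu : u ∈ Yset) : 1 / 2 * ED β g k u ≤ xs g k := by
  have hu1 : 1 / 2 < u ∧ u < 1 := hu
  have h1 := (d.it_concave k).le_slope_of_hasDerivAt (x := 0) (y := u) (by norm_num)
    ⟨by linarith, hu1.2.le⟩ (by linarith) (d.it_deriv k (Y1 hu))
  rw [slope_def_field, d.it_zero, sub_zero, sub_zero, le_div_iff₀ (by linarith)] at h1
  have h2 : g^[k] u ≤ xs g k := d.it_mono k (by linarith)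
  have := d.ED_pos k (Y1 hu)
  nlinarith

lemma it_meas (d : IB β g) (k : ℕ) : Measurable g^[k] := (d.it_mono k).measurable

lemma ED_meas (d : IB β g) (k : ℕ) : Measurable (ED β g k) := by
  induction k with
  | zero => exact measurable_const
  | succ k ih =>
    have h1 := d.it_meas (k + 1)
    have h2 : Measurable fun u => -Real.log (g^[k + 1] u) := (Real.measurable_log.comp h1).neg
    have h3 : Measurable (hh β) := by
      unfold hh
      have a1 : Measurable fun L : ℝ => L ^ (-β) := measurable_id.pow_const _
      have a2 : Measurable fun L : ℝ => L ^ (-β - 1) := measurable_id.pow_const _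
      fun_prop
    exact (h3.comp h2).inv.mul ih

end IB
end S18

namespace S18

/-- inverse branches of the induced map -/
noncomputable def Gb (g : ℝ → ℝ) (r : ℕ) (u : ℝ) : ℝ := (1 + g^[r] u) / 2

/-- their derivatives -/
noncomputable def Db (β : ℝ) (g : ℝ → ℝ) (r : ℕ) (u : ℝ) : ℝ := 1 / 2 * ED β g r u

namespace IB
variable {β γ : ℝ} {g : ℝ → ℝ}

lemma Gb_image (d : IB β g) (r : ℕ) :
    Gb g r '' Yset = Ioo ((1 + xs g (r + 1)) / 2) ((1 + xs g r) / 2) := by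
  ext z
  constructor
  · rintro ⟨u, hu, rfl⟩
    have hu1 : 1 / 2 < u ∧ u < 1 := hu
    have h1 : xs g (r + 1) < g^[r] u := by
      rw [← d.xs_half]; exact d.it_smono _ (by norm_num) hu1.1 hu1.2.le
    have h2 : g^[r] u < xs g r := d.it_smono _ (by linarith) hu1.2 le_rfl
    rw [Gb]
    constructor <;> linarith
  · intro hz
    have h := intermediate_value_Ioo (show (1 / 2 : ℝ) ≤ 1 by norm_num)
      ((d.it_contOn r).mono (Icc_subset_Icc (by norm_num) le_rfl))
    have hz1 := hz.1
    have hz2 := hz.2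
    obtain ⟨u, hu, hu2⟩ := h (show 2 * z - 1 ∈ Ioo (g^[r] (1 / 2)) (g^[r] 1) by
      rw [d.xs_half]
      change 2 * z - 1 ∈ Ioo (xs g (r + 1)) (xs g r)
      constructor <;> linarith)
    refine ⟨u, hu, ?_⟩
    rw [Gb, hu2]; ring

lemma cv (d : IB β g) (hx : Tendsto (xs g) atTop (nhds 0)) (F : ℝ → ENNReal) :
    ∫⁻ x, F x ∂mY = ∑' r, ∫⁻ u, F (Gb g r u) * ENNReal.ofReal (Db β g r u) ∂mY := by
  have hcover : (⋃ r, Gb g r '' Yset : Set ℝ) =ᵐ[volume] Yset := by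
    have hc : (range fun r => (1 + xs g r) / 2 : Set ℝ).Countable := countable_range _
    have hae : ∀ᵐ z : ℝ, z ∉ (range fun r => (1 + xs g r) / 2 : Set ℝ) := by
      exact hc.ae_notMem _
    filter_upwards [hae] with z hz
    apply propext
    show z ∈ (⋃ r, Gb g r '' Yset : Set ℝ) ↔ z ∈ Yset
    rw [mem_iUnion]
    constructor
    · rintro ⟨r, hr⟩
      rw [d.Gb_image] at hr
      have := d.xs_pos (r + 1)
      have := d.xs_le_one r
      have := hr.1
      have := hr.2
      constructor <;> linarith
    · intro hzY
      have hz1 : 1 / 2 < z ∧ z < 1 := hzY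
      have hex : ∃ r, xs g r < 2 * z - 1 := by
        have := (hx.eventually (gt_mem_nhds (show 0 < 2 * z - 1 by linarith))).exists
        exact this
      classical
      have hs := Nat.find_spec hex
      have hne : Nat.find hex ≠ 0 := by
        intro h0
        rw [h0, xs_zero] at hs
        linarith
      obtain ⟨r, hr⟩ := Nat.exists_eq_succ_of_ne_zero hne
      rw [hr] at hs
      have hm := Nat.find_min hex (m := r) (by omega)
      refine ⟨r, ?_⟩
      rw [d.Gb_image]
      have hs' : xs g (r + 1) < 2 * z - 1 := hs
      refine ⟨by linarith, ?_⟩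
      rcases (not_lt.1 hm).eq_or_lt with h | h
      · exfalso
        apply hz
        refine ⟨r, ?_⟩
        show (1 + xs g r) / 2 = z
        linarith
      · linarith
  have hmeas : ∀ r, MeasurableSet (Gb g r '' Yset) := fun r => by
    rw [d.Gb_image]; exact measurableSet_Ioo
  have hdisj : Pairwise (Function.onFun Disjoint fun r => Gb g r '' Yset) := by
    have key : ∀ i j, i < j → Disjoint (Gb g i '' Yset) (Gb g j '' Yset) := by
      intro i j hij
      rw [d.Gb_image, d.Gb_image, Set.disjoint_left]
      intro z h1 h2
      have := d.xs_anti (show i + 1 ≤ j from hij)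
      have := h1.1
      have := h2.2
      linarith
    intro i j hij
    rcases lt_or_gt_of_ne hij with h | h
    · exact key i j h
    · exact (key j i h).symm
  have e1 : ∫⁻ x in Yset, F x = ∑' r, ∫⁻ u in Yset, F (Gb g r u) * ENNReal.ofReal (Db β g r u) := by
    rw [← setLIntegral_congr hcover, lintegral_iUnion hmeas hdisj]
    congr 1
    ext r
    rw [lintegral_image_eq_lintegral_abs_deriv_mul (f := Gb g r) (f' := Db β g r)
      (show MeasurableSet Yset from measurableSet_Ioo)]
    · apply setLIntegral_congr_fun measurableSet_Ioo
      intro u hu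
      have := d.ED_pos r (Y1 hu)
      show ENNReal.ofReal |Db β g r u| * F (Gb g r u) = F (Gb g r u) * ENNReal.ofReal (Db β g r u)
      rw [mul_comm, abs_of_pos (by rw [Db]; positivity)]
    · intro u hu
      have h1 := (((d.it_deriv r (Y1 hu)).const_add 1).div_const 2).hasDerivWithinAt (s := Yset)
      refine h1.congr_deriv ?_
      rw [Db]; ring
    · intro u hu v hv huv
      have hu1 : 1 / 2 < u ∧ u < 1 := hu
      have hv1 : 1 / 2 < v ∧ v < 1 := hv
      have huv' : g^[r] u = g^[r] v := by
        have : (1 + g^[r] u) / 2 = (1 + g^[r] v) / 2 := huv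
        linarith
      rcases lt_trichotomy u v with h | h | h
      · have := d.it_smono r (by linarith) h hv1.2.le
        linarith
      · exact h
      · have := d.it_smono r (by linarith) h hu1.2.le
        linarith
  simp only [mY, lintegral_smul_measure]
  rw [e1]
  simp only [smul_eq_mul, ENNReal.tsum_mul_left]

lemma ind (d : IB (1 / γ - 1) g) (hγ : γ ∈ Ioo (0 : ℝ) 1) {η : ℝ} (hη : η ∈ Ioc (0 : ℝ) 1) :
    ∃ K c1 W H, Ind (Tmap γ) (Gb g) (Db (1 / γ - 1) g) (xs g) K c1 W γ η H := by
  obtain ⟨K, hK, hKd⟩ := d.ED_dist'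
  obtain ⟨κ, hκ, hdec⟩ := d.xs_decay hγ
  have hx : Tendsto (xs g) atTop (nhds 0) :=
    squeeze_zero (fun k => (d.xs_pos k).le) hdec (summable_sexp hκ hγ.1).tendsto_atTop_zero
  have hsum1 : Summable fun k : ℕ => Real.exp (κ / 2 * ((k : ℝ) + 1) ^ γ) * xs g k := by
    refine Summable.of_nonneg_of_le (fun k => mul_nonneg (Real.exp_pos _).le (d.xs_pos k).le) ?_
      ((summable_sexp (half_pos hκ) hγ.1).mul_left (Real.exp (κ / 2)))
    intro k
    have h1 := Real.rpow_add_le_add_rpow (Nat.cast_nonneg k) zero_le_one hγ.1.le hγ.2.le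
    rw [Real.one_rpow] at h1
    calc _ ≤ Real.exp (κ / 2 * ((k : ℝ) ^ γ + 1)) * Real.exp (-κ * (k : ℝ) ^ γ) :=
          mul_le_mul (Real.exp_le_exp.2 (mul_le_mul_of_nonneg_left h1 (by linarith))) (hdec k)
            (d.xs_pos k).le (Real.exp_pos _).le
      _ = _ := by rw [← Real.exp_add, ← Real.exp_add]; congr 1; ring
  have hsum2 : Summable fun k : ℕ => (2 * xs g k) ^ η := by
    have hη0 := hη.1
    refine Summable.of_nonneg_of_le (fun k => Real.rpow_nonneg (by linarith [d.xs_pos k]) _) ?_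
      ((summable_sexp (mul_pos hκ hη0) hγ.1).mul_left (2 ^ η))
    intro k
    rw [Real.mul_rpow (by norm_num) (d.xs_pos k).le]
    apply mul_le_mul_of_nonneg_left _ (by positivity)
    refine (Real.rpow_le_rpow (d.xs_pos k).le (hdec k) hη0.le).trans_eq ?_
    rw [← Real.exp_mul]; congr 1; ring
  have hmem : ∀ r, ∀ u ∈ Yset, Gb g r u ∈ Yset := by
    intro r u hu
    have h1 := d.it_pos r (Y1 hu).1 (Y1 hu).2.le
    have h2 := d.it_lt_one r (Y1 hu)
    show 1 / 2 < (1 + g^[r] u) / 2 ∧ (1 + g^[r] u) / 2 < 1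
    constructor <;> linarith
  have habs : ∀ r, ∀ u ∈ Yset, ∀ v ∈ Yset, |g^[r] u - g^[r] v| ≤ |u - v| ∧
      |g^[r] u - g^[r] v| ≤ 2 * xs g r * |u - v| := by
    have key : ∀ r, ∀ u ∈ Yset, ∀ v ∈ Yset, u ≤ v → |g^[r] u - g^[r] v| ≤ |u - v| ∧
      |g^[r] u - g^[r] v| ≤ 2 * xs g r * |u - v| := by
      intro r u hu v hv huv
      have hu1 : 1 / 2 < u ∧ u < 1 := hu
      have hv1 : 1 / 2 < v ∧ v < 1 := hv
      have h0 := d.it_mono r huv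
      rw [abs_sub_comm, abs_of_nonneg (by linarith), abs_sub_comm u v, abs_of_nonneg (by linarith)]
      exact ⟨d.it_lip r (by linarith) huv hv1.2.le, d.it_slope r hu1.1.le huv hv1.2.le⟩
    intro r u hu v hv
    rcases le_total u v with h | h
    · exact key r u hu v hv h
    · rw [abs_sub_comm, abs_sub_comm u v]; exact key r v hv u hu h
  have hT1 : ∀ r, ∀ u ∈ Yset, Tmap γ (Gb g r u) = g^[r] u := by
    intro r u hu
    have h1 : 1 / 2 < Gb g r u ∧ Gb g r u < 1 := hmem r u hu
    rw [Tmap_right h1.1, Gb]; ring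
  have hTj : ∀ r j, j ≤ r → ∀ u ∈ Yset, (Tmap γ)^[j + 1] (Gb g r u) = g^[r - j] u := by
    intro r j hj u hu
    rw [Function.iterate_succ_apply, hT1 r u hu]
    have := d.T_it j (r - j) (Y1 hu).1 (Y1 hu).2.le
    rwa [Nat.add_sub_cancel' hj] at this
  refine ⟨K, κ / 2, ∑' k : ℕ, Real.exp (κ / 2 * ((k : ℝ) + 1) ^ γ) * xs g k,
    1 + ∑' k : ℕ, (2 * xs g k) ^ η, ?_⟩
  refine
    { hK := hK
      hc1 := half_pos hκ
      hγ := hγ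
      hη := hη
      hT := Tmap_meas γ
      hG := fun r => (measurable_const.add (d.it_meas r)).div_const 2
      hGY := hmem
      hGc := ?_
      hTG := fun r u hu => by rw [hTj r r le_rfl u hu, Nat.sub_self]; rfl
      hD := fun r => measurable_const.mul (d.ED_meas r)
      hD0 := fun r u hu => mul_pos (by norm_num) (d.ED_pos r (Y1 hu))
      hDK := ?_
      hDb := fun r u hu => d.ED_le r hu
      hW := ?_
      hcv := fun F _ => d.cv hx F
      hH := ?_
      hT2 := fun y hy => Tmap_right (show 1 / 2 < y ∧ y < 1 from hy).1 }
  · intro r u hu v hv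
    have := (habs r u hu v hv).1
    have e : Gb g r u - Gb g r v = (g^[r] u - g^[r] v) / 2 := by rw [Gb, Gb]; ring
    rw [e, abs_div, abs_of_pos (show (0 : ℝ) < 2 by norm_num)]
    linarith
  · intro r u hu v hv
    have := hKd r u hu v hv
    rw [Db, Db]
    linarith
  · rw [ENNReal.ofReal_tsum_of_nonneg
      (fun k => mul_nonneg (Real.exp_pos _).le (d.xs_pos k).le) hsum1]
  · intro r u hu v hv
    have hη0 := hη.1
    have hgc : |Gb g r u - Gb g r v| ≤ |u - v| := by
      have := (habs r u hu v hv).1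
      have e : Gb g r u - Gb g r v = (g^[r] u - g^[r] v) / 2 := by rw [Gb, Gb]; ring
      rw [e, abs_div, abs_of_pos (show (0 : ℝ) < 2 by norm_num)]
      have := abs_nonneg (u - v)
      linarith
    rw [Finset.sum_range_succ', Function.iterate_zero, id, id, add_mul, one_mul, add_comm]
    apply add_le_add
    · exact Real.rpow_le_rpow (abs_nonneg _) hgc hη0.le
    · have e1 : ∀ j ∈ Finset.range r,
          |(Tmap γ)^[j + 1] (Gb g r u) - (Tmap γ)^[j + 1] (Gb g r v)| ^ η ≤
          (2 * xs g (r - j)) ^ η * |u - v| ^ η := by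
        intro j hj
        have hj' := (Finset.mem_range.1 hj).le
        rw [hTj r j hj' u hu, hTj r j hj' v hv, ← Real.mul_rpow (by linarith [d.xs_pos (r - j)])
          (abs_nonneg _)]
        exact Real.rpow_le_rpow (abs_nonneg _) (habs _ u hu v hv).2 hη0.le
      refine (Finset.sum_le_sum e1).trans ?_
      rw [← Finset.sum_mul]
      apply mul_le_mul_of_nonneg_right _ (by positivity)
      have hnn : ∀ k, 0 ≤ (2 * xs g k) ^ η :=
        fun k => Real.rpow_nonneg (by linarith [d.xs_pos k]) _
      calc _ ≤ ∑ j ∈ Finset.range (r + 1), (2 * xs g (r - j)) ^ η :=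
            Finset.sum_le_sum_of_subset_of_nonneg (Finset.range_mono (Nat.le_succ r))
              (fun k _ _ => hnn _)
        _ = ∑ j ∈ Finset.range (r + 1), (2 * xs g j) ^ η := by
            have := Finset.sum_range_reflect (fun j => (2 * xs g j) ^ η) (r + 1)
            simpa using this
        _ ≤ _ := hsum2.sum_le_tsum _ (fun k _ => hnn k)

end IB
end S18

/-- Moderate deviation principle for Hölder observables when `γ ∈ (0,1)`: if
`σ_n² = Var_ν(S_n(φ)) → ∞` then `σ_n²/n → σ² > 0` and, for every positive sequence
`a_n → 0` with `a_n n^{γ/(2-γ)} → ∞`, for every Borel set `A`,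
`-inf_{A°} t²/(2σ²) ≤ liminf a_n log ν(√(a_n/n) S_n(φ) ∈ A)`
  `≤ limsup a_n log ν(√(a_n/n) S_n(φ) ∈ A) ≤ -inf_{closure A} t²/(2σ²)`
(logarithms of measures computed in the extended reals). -/
theorem stmt18 (γ : ℝ) (hγ : γ ∈ Set.Ioo (0 : ℝ) 1) (η : ℝ) (hη : η ∈ Set.Ioc (0 : ℝ) 1)
    (ν : Measure ℝ) [IsProbabilityMeasure ν]
    (hsupp : ν (Set.Icc (0 : ℝ) 1)ᶜ = 0) (hac : ν ≪ volume)
    (hinv : ∀ A : Set ℝ, MeasurableSet A → ν (Tmap γ ⁻¹' A) = ν A)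
    (φ : ℝ → ℝ)
    (hHol : ∃ Cφ : ℝ, ∀ x ∈ Set.Icc (0 : ℝ) 1, ∀ y ∈ Set.Icc (0 : ℝ) 1,
      |φ x - φ y| ≤ Cφ * |x - y| ^ η)
    (S : ℕ → ℝ → ℝ)
    (hS : ∀ n x, S n x = (∑ k ∈ Finset.range n, φ ((Tmap γ)^[k] x)) - n * ∫ z, φ z ∂ν)
    (σsq : ℕ → ℝ)
    (hσsq : ∀ n, σsq n = (∫ x, (S n x) ^ 2 ∂ν) - (∫ x, S n x ∂ν) ^ 2)
    (hdiv : Filter.Tendsto σsq Filter.atTop Filter.atTop) :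
    ∃ σ2 : ℝ, 0 < σ2 ∧
      Filter.Tendsto (fun n : ℕ => σsq n / n) Filter.atTop (nhds σ2) ∧
      ∀ a : ℕ → ℝ, (∀ n, 0 < a n) →
        Filter.Tendsto a Filter.atTop (nhds 0) →
        Filter.Tendsto (fun n : ℕ => a n * (n : ℝ) ^ (γ / (2 - γ))) Filter.atTop Filter.atTop →
        ∀ A : Set ℝ, MeasurableSet A →
          (-(⨅ t ∈ interior A, ((t ^ 2 / (2 * σ2) : ℝ) : EReal)) ≤
            Filter.liminf (fun n : ℕ =>
              ((a n : ℝ) : EReal) *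
                ENNReal.log (ν {x | Real.sqrt (a n / n) * S n x ∈ A})) Filter.atTop) ∧
          (Filter.limsup (fun n : ℕ =>
              ((a n : ℝ) : EReal) *
                ENNReal.log (ν {x | Real.sqrt (a n / n) * S n x ∈ A})) Filter.atTop ≤
            -(⨅ t ∈ closure A, ((t ^ 2 / (2 * σ2) : ℝ) : EReal))) := by
  obtain ⟨Cφ, hC⟩ := hHol
  have hη0 := hη.1
  have hβ : 0 < 1 / γ - 1 := by
    have := one_lt_one_div hγ.1 hγ.2; linarith
  obtain ⟨g, hg⟩ := S18.IB_exists hβ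
  obtain ⟨K, c1, W, H, hI⟩ := hg.ind hγ hη
  have hmp : MeasurePreserving (Tmap γ) ν ν := by
    refine ⟨hI.hT, ?_⟩
    ext A hA
    rw [Measure.map_apply hI.hT hA, hinv A hA]
  -- clamping to the unit interval
  set cl : ℝ → ℝ := fun x => max 0 (min x 1) with hcl
  have cl_mem : ∀ x, cl x ∈ Icc (0 : ℝ) 1 := fun x =>
    ⟨le_max_left _ _, max_le (by norm_num) (min_le_right _ _)⟩
  have cl_id : ∀ x ∈ Icc (0 : ℝ) 1, cl x = x := fun x hx => by
    simp only [hcl]; rw [min_eq_left hx.2, max_eq_right hx.1]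
  have cl_lip : ∀ x y, |cl x - cl y| ≤ |x - y| := fun x y => by
    simp only [hcl]
    have h1 := abs_max_sub_max_le_max 0 (min x 1) 0 (min y 1)
    have h2 := abs_min_sub_min_le_max x 1 y 1
    rw [sub_self, abs_zero, max_eq_right (abs_nonneg (min x 1 - min y 1))] at h1
    rw [sub_self, abs_zero, max_eq_left (abs_nonneg (x - y))] at h2
    exact h1.trans h2
  have hC0 : 0 ≤ Cφ := by
    have h1 := (abs_nonneg _).trans (hC 0 (by norm_num) 1 (by norm_num))
    simpa using h1
  set M := ∫ z, φ z ∂ν with hM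
  set ψ : ℝ → ℝ := fun x => φ (cl x) - M with hψ
  have hL : ∀ x y, |ψ x - ψ y| ≤ Cφ * |x - y| ^ η := by
    intro x y
    have h1 := hC _ (cl_mem x) _ (cl_mem y)
    have h2 := Real.rpow_le_rpow (abs_nonneg _) (cl_lip x y) hη0.le
    have e : ψ x - ψ y = φ (cl x) - φ (cl y) := by simp only [hψ]; ring
    rw [e]
    exact h1.trans (mul_le_mul_of_nonneg_left h2 hC0)
  have hψc : Continuous ψ := by
    have hh : HolderWith Cφ.toNNReal η.toNNReal ψ := by
      intro x y
      rw [Real.coe_toNNReal η hη0.le, edist_dist, edist_dist,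
        ENNReal.ofReal_rpow_of_nonneg dist_nonneg hη0.le]
      change _ ≤ ENNReal.ofReal Cφ * _
      rw [← ENNReal.ofReal_mul hC0]
      exact ENNReal.ofReal_le_ofReal (hL x y)
    exact hh.continuous (Real.toNNReal_pos.2 hη0)
  have hψm : Measurable ψ := hψc.measurable
  have hB : ∀ x, |ψ x| ≤ |ψ 0| + Cφ := by
    intro x
    have h1 := hC _ (cl_mem x) _ (cl_mem 0)
    have h2 : |cl x - cl 0| ^ η ≤ 1 := by
      apply Real.rpow_le_one (abs_nonneg _) _ hη0.le
      have a := cl_mem x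
      have b := cl_mem 0
      rw [abs_le]
      constructor <;> linarith [a.1, a.2, b.1, b.2]
    have e : ψ x - ψ 0 = φ (cl x) - φ (cl 0) := by simp only [hψ]; ring
    have h3 : |ψ x - ψ 0| ≤ Cφ := by
      rw [e]; nlinarith
    have h4 := abs_sub_abs_le_abs_sub (ψ x) (ψ 0)
    linarith
  obtain ⟨c, C, ⟨dc⟩⟩ := hI.decoup ν hsupp hac hmp ψ hψm Cφ hL _ hB
  have hsae : ∀ᵐ x ∂ν, x ∈ Icc (0 : ℝ) 1 := by
    rw [ae_iff]; exact hsupp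
  have hiter : ∀ (k : ℕ) (x : ℝ), x ∈ Icc (0 : ℝ) 1 → (Tmap γ)^[k] x ∈ Icc (0 : ℝ) 1 := by
    intro k
    induction k with
    | zero => exact fun x hx => hx
    | succ k ih => exact fun x hx => ih _ (S18.Tmap_mem hγ hx)
  have hSe : ∀ x ∈ Icc (0 : ℝ) 1, ∀ n, S n x = S18.BS (Tmap γ) ψ n x := by
    intro x hx n
    rw [hS, S18.BS]
    simp only [hψ]
    rw [Finset.sum_sub_distrib, Finset.sum_const, Finset.card_range, nsmul_eq_mul]
    congr 1
    apply Finset.sum_congr rfl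
    intro k _
    rw [cl_id _ (hiter k x hx)]
  have hψi : ∀ k : ℕ, Integrable (fun x => ψ ((Tmap γ)^[k] x)) ν := by
    intro k
    refine Integrable.of_bound (hψm.comp (hI.hT.iterate k)).aestronglyMeasurable
      (|ψ 0| + Cφ) (Eventually.of_forall fun x => hB _)
  have hψ0 : ∀ k : ℕ, ∫ x, ψ ((Tmap γ)^[k] x) ∂ν = 0 := by
    intro k
    have e1 : ∫ x, ψ ((Tmap γ)^[k] x) ∂ν = ∫ x, ψ x ∂ν := by
      have h1 := integral_map (μ := ν) (hI.hT.iterate k).aemeasurable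
        (f := ψ) hψm.aestronglyMeasurable
      rw [(hmp.iterate k).map_eq] at h1
      exact h1.symm
    have e2 : ∫ x, ψ x ∂ν = ∫ x, (φ x - M) ∂ν := by
      apply integral_congr_ae
      filter_upwards [hsae] with x hx
      simp only [hψ]
      rw [cl_id x hx]
    have e3 : Integrable φ ν := by
      have h1 : Integrable (fun x => ψ x + M) ν := (hψi 0).add (integrable_const M)
      refine h1.congr ?_
      filter_upwards [hsae] with x hx
      simp only [hψ]
      rw [cl_id x hx]; ring
    rw [e1, e2, integral_sub e3 (integrable_const M)]
    simp [hM]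
  have hBS0 : ∀ n, ∫ x, S18.BS (Tmap γ) ψ n x ∂ν = 0 := by
    intro n
    simp only [S18.BS]
    rw [integral_finsetSum _ (fun k _ => hψi k)]
    exact Finset.sum_eq_zero fun k _ => hψ0 k
  have hσ : ∀ n, σsq n = ∫ x, S18.BS (Tmap γ) ψ n x ^ 2 ∂ν := by
    intro n
    have e1 : ∫ x, S n x ∂ν = ∫ x, S18.BS (Tmap γ) ψ n x ∂ν := by
      apply integral_congr_ae
      filter_upwards [hsae] with x hx
      exact hSe x hx n
    have e2 : ∫ x, S n x ^ 2 ∂ν = ∫ x, S18.BS (Tmap γ) ψ n x ^ 2 ∂ν := by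
      apply integral_congr_ae
      filter_upwards [hsae] with x hx
      simp only [hSe x hx n]
    rw [hσsq, e1, e2, hBS0]
    simp
  have hσf : σsq = fun n => ∫ x, S18.BS (Tmap γ) ψ n x ^ 2 ∂ν := funext hσ
  rw [hσf] at hdiv
  obtain ⟨σ2, hσ2, hlim, hmdp⟩ := dc.mdp hBS0 hdiv
  refine ⟨σ2, hσ2, ?_, ?_⟩
  · rw [hσf]; exact hlim
  · intro a ha ha0 hag A _
    have hset : ∀ n : ℕ, ν {x | Real.sqrt (a n / n) * S n x ∈ A} =
        ν {x | Real.sqrt (a n / n) * S18.BS (Tmap γ) ψ n x ∈ A} := by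
      intro n
      apply measure_congr
      filter_upwards [hsae] with x hx
      apply propext
      change Real.sqrt (a n / n) * S n x ∈ A ↔
        Real.sqrt (a n / n) * S18.BS (Tmap γ) ψ n x ∈ A
      rw [hSe x hx n]
    simp only [hset]
    exact hmdp a ⟨hγ.1, hγ.2, ha, ha0, hag⟩ A
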